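/- Let G be a finite nonabelian simple group and suppose that for some x ∈ G, the set Sol_G(x) is the underlying set of a maximal subgroup of G that is a metacyclic 2-group. Then G is isomorphic to PSL(2,p), where p ≥ 31 is a Mersenne prime (p = 2^n − 1). -/

import Mathlib

open scoped MatrixGroups

/-- The solubilizer of an element `x` of a group `G`: the set of all `y ∈ G`
such that the subgroup generated by `x` and `y` is soluble. -/
def solubilizer {G : Type*} [Group G] (x : G) : Set G :=
  {y | IsSolvable ↥(Subgroup.closure ({x, y} : Set G))}

/-- A group is metacyclic if it has a cyclic normal subgroup with cyclic quotient. -/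
def IsMetacyclic (Q : Type*) [Group Q] : Prop :=
  ∃ C : Subgroup Q, ∃ _ : C.Normal, IsCyclic C ∧ IsCyclic (Q ⧸ C)

section Characters

theorem Matrix.exists_natCast_trace_eq_of_isIdempotentElem {k ι : Type*} [Field k] [Fintype ι]
    [DecidableEq ι] {E : Matrix ι ι k} (hE : IsIdempotentElem E) :
    ∃ c : ℕ, E.trace = c := by
  have h : IsIdempotentElem (Matrix.toLin' E) := by
    unfold IsIdempotentElem
    rw [Module.End.mul_eq_comp, ← Matrix.toLin'_mul, hE.eq]
  refine ⟨Module.finrank k (LinearMap.range (Matrix.toLin' E)), ?_⟩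
  rw [← Matrix.trace_toLin'_eq]
  exact (LinearMap.IsIdempotentElem.isProj_range _ h).trace

theorem sum_class_function_smul_commute {G k ι : Type*} [Group G] [Fintype G] [Field k]
    [Fintype ι] [DecidableEq ι] (R : G →* Matrix ι ι k) {φ : G → k}
    (hφ : ∀ g h, φ (h * g * h⁻¹) = φ g) (h : G) :
    R h * (∑ g, φ g • R g) = (∑ g, φ g • R g) * R h := by
  rw [Finset.mul_sum, Finset.sum_mul]
  refine Fintype.sum_bijective (fun g => h * g * h⁻¹) (MulAut.conj h).bijective _ _ ?_
  intro g
  rw [hφ, mul_smul_comm, smul_mul_assoc, ← map_mul, ← map_mul]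
  simp

/-- A complete set of irreducible matrix representations of a finite group over a field. -/
structure IrreducibleReps (G k : Type*) [Group G] [Fintype G] [Field k] where
  /-- the number of irreducible representations -/
  n : ℕ
  /-- the degrees -/
  d : Fin n → ℕ
  /-- the representations -/
  rep : ∀ i, G →* Matrix (Fin (d i)) (Fin (d i)) k
  pos : ∀ i, 0 < d i
  surj : ∀ B : (∀ i, Matrix (Fin (d i)) (Fin (d i)) k), ∃ φ : G → k,
    ∀ i, ∑ g, φ g • rep i g = B i
  inj : ∀ φ : G → k, (∀ i, ∑ g, φ g • rep i g = 0) → φ = 0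

theorem nonempty_irreducibleReps (G k : Type*) [Group G] [Fintype G] [Field k] [CharZero k]
    [IsAlgClosed k] : Nonempty (IrreducibleReps G k) := by
  have : NeZero (Nat.card G : k) := ⟨Nat.cast_ne_zero.2 Nat.card_pos.ne'⟩
  obtain ⟨n, d, hd, ⟨e⟩⟩ := IsSemisimpleRing.exists_algEquiv_pi_matrix_of_isAlgClosed k
    (MonoidAlgebra k G)
  let rep : ∀ i, G →* Matrix (Fin (d i)) (Fin (d i)) k := fun i =>
    ((Pi.evalMonoidHom (fun i => Matrix (Fin (d i)) (Fin (d i)) k) i).comp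
      (e : MonoidAlgebra k G →* ∀ i, Matrix (Fin (d i)) (Fin (d i)) k)).comp
      (MonoidAlgebra.of k G)
  have key : ∀ (φ : G → k) i, ∑ g, φ g • rep i g =
      e (∑ g, φ g • MonoidAlgebra.of k G g) i := by
    intro φ i
    rw [map_sum, Finset.sum_apply]
    simp_rw [map_smul]
    rfl
  refine ⟨⟨n, d, rep, fun i => Nat.pos_of_ne_zero (hd i).out, fun B => ?_, fun φ h => ?_⟩⟩
  · refine ⟨fun g => (e.symm B).coeff g, fun i => ?_⟩
    rw [key]
    have : ∑ g, (e.symm B).coeff g • MonoidAlgebra.of k G g = e.symm B := by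
      ext x
      simp
    rw [this, e.apply_symm_apply]
  · have h0 : e (∑ g, φ g • MonoidAlgebra.of k G g) = 0 := by
      ext i : 1
      rw [← key, h]; rfl
    rw [map_eq_zero_iff _ e.injective] at h0
    funext x
    have := congrArg (fun a => MonoidAlgebra.coeff a x) h0
    classical
    simpa [Finsupp.single_apply] using this

namespace IrreducibleReps

variable {G k : Type*} [Group G] [Fintype G] [Field k] (I : IrreducibleReps G k)

/-- The irreducible characters. -/
def χ (i : Fin I.n) (g : G) : k := (I.rep i g).trace

theorem χ_one (i : Fin I.n) : I.χ i 1 = I.d i := by simp [χ]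

theorem χ_conj (i : Fin I.n) (g h : G) : I.χ i (h * g * h⁻¹) = I.χ i g := by
  unfold χ
  rw [map_mul, Matrix.trace_mul_comm, ← map_mul]
  simp

theorem exists_smul_one_of_commute (i : Fin I.n) {X : Matrix (Fin (I.d i)) (Fin (I.d i)) k}
    (hX : ∀ g, I.rep i g * X = X * I.rep i g) : ∃ c : k, X = c • 1 := by
  have hB : ∀ B, B * X = X * B := by
    intro B
    obtain ⟨φ, hφ⟩ := I.surj (Pi.single i B)
    have := hφ i
    rw [Pi.single_eq_same] at this
    rw [← this, Finset.sum_mul, Finset.mul_sum]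
    exact Finset.sum_congr rfl fun g _ => by
      rw [smul_mul_assoc, hX, mul_smul_comm]
  obtain ⟨c, hc⟩ := Matrix.mem_range_scalar_iff_commute_single'.2
    (fun a b => hB (Matrix.single a b 1))
  exact ⟨c, by rw [← hc]; ext a b; simp [Matrix.scalar_apply, Matrix.diagonal_apply, Matrix.one_apply]⟩

theorem class_sum_eq [CharZero k] (i : Fin I.n) {φ : G → k} (hφ : ∀ g h, φ (h * g * h⁻¹) = φ g) :
    ∃ c : k, ∑ g, φ g • I.rep i g = c • 1 ∧ ∑ g, φ g * I.χ i g = c * I.d i := by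
  obtain ⟨c, hc⟩ := I.exists_smul_one_of_commute i
    (sum_class_function_smul_commute (I.rep i) hφ)
  refine ⟨c, hc, ?_⟩
  have := congrArg Matrix.trace hc
  simpa [Matrix.trace_sum, Matrix.trace_smul, χ] using this

/-- Multiplicativity of central characters. -/
theorem central [CharZero k] (i : Fin I.n) {φ : G → k} (hφ : ∀ g h, φ (h * g * h⁻¹) = φ g) :
    I.d i * ∑ g, ∑ h, φ g * φ h * I.χ i (g * h) = (∑ g, φ g * I.χ i g) ^ 2 := by
  obtain ⟨c, hc, hc'⟩ := I.class_sum_eq i hφ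
  have h1 : ∑ g, ∑ h, φ g * φ h * I.χ i (g * h) =
      ((∑ g, φ g • I.rep i g) * (∑ g, φ g • I.rep i g)).trace := by
    simp_rw [Finset.sum_mul, Finset.mul_sum, Matrix.trace_sum, χ, map_mul, smul_mul_smul_comm,
      Matrix.trace_smul, smul_eq_mul]
  rw [h1, hc, hc', smul_mul_smul_comm, Matrix.trace_smul]
  simp; ring

theorem orth [CharZero k] (i j : Fin I.n) :
    ∑ g, I.χ i g⁻¹ * I.χ j g = if i = j then (Fintype.card G : k) else 0 := by
  let T (X : Matrix (Fin (I.d i)) (Fin (I.d j)) k) : Matrix (Fin (I.d i)) (Fin (I.d j)) k :=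
    ∑ g, I.rep i g⁻¹ * X * I.rep j g
  have hT : ∀ X h, I.rep i h * T X = T X * I.rep j h := by
    intro X h
    simp only [T]
    rw [Matrix.mul_sum, Matrix.sum_mul]
    refine Fintype.sum_bijective (fun g => g * h⁻¹) (Group.mulRight_bijective h⁻¹) _ _ ?_
    intro g
    simp only [mul_inv_rev, inv_inv, map_mul, Matrix.mul_assoc]
    rw [← map_mul (I.rep j)]
    simp
  have hsum : ∑ g, I.χ i g⁻¹ * I.χ j g =
      ∑ a, ∑ b, T (Matrix.single a b 1) a b := by
    simp only [T, χ, Matrix.trace, Matrix.diag, Matrix.sum_apply, Finset.sum_mul_sum]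
    rw [Finset.sum_comm]
    refine Finset.sum_congr rfl fun a _ => ?_
    rw [Finset.sum_comm]
    refine Finset.sum_congr rfl fun b _ => Finset.sum_congr rfl fun g _ => ?_
    simp [Matrix.mul_apply, Matrix.single_apply, ite_and]
  rw [hsum]
  split_ifs with hij
  · subst hij
    have hd : (I.d i : k) ≠ 0 := Nat.cast_ne_zero.2 (I.pos i).ne'
    have : ∀ a b, T (Matrix.single a b 1) a b =
        if a = b then (Fintype.card G : k) / I.d i else 0 := by
      intro a b
      obtain ⟨c, hc⟩ := I.exists_smul_one_of_commute i (hT (Matrix.single a b 1))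
      have htr := congrArg Matrix.trace hc
      have h2 : (T (Matrix.single a b 1)).trace =
          Fintype.card G * (if a = b then 1 else 0) := by
        simp only [T, Matrix.trace_sum]
        have : ∀ g, (I.rep i g⁻¹ * Matrix.single a b 1 * I.rep i g).trace =
            if a = b then (1 : k) else 0 := by
          intro g
          rw [Matrix.trace_mul_comm, ← Matrix.mul_assoc, ← map_mul]
          simp
          split_ifs with h
          · subst h; simp
          · exact Matrix.trace_single_eq_of_ne _ _ _ h
        simp [this]
      rw [h2, Matrix.trace_smul, Matrix.trace_one, Fintype.card_fin, smul_eq_mul] at htr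
      rw [hc, Matrix.smul_apply, Matrix.one_apply]
      split_ifs with h
      · simp [h] at htr ⊢
        field_simp; exact htr.symm
      · simp
    simp_rw [this]
    simp
    field_simp
  · have : ∀ X, T X = 0 := by
      intro X
      obtain ⟨φ, hφ⟩ := I.surj (Pi.single i 1)
      have h1 := hφ i
      have h2 := hφ j
      rw [Pi.single_eq_same] at h1
      rw [Pi.single_eq_of_ne (Ne.symm hij)] at h2
      calc T X = (∑ g, φ g • I.rep i g) * T X := by rw [h1, Matrix.one_mul]
        _ = T X * (∑ g, φ g • I.rep j g) := by
          rw [Matrix.sum_mul, Matrix.mul_sum]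
          exact Finset.sum_congr rfl fun g _ => by
            rw [Matrix.smul_mul, hT, Matrix.mul_smul]
        _ = 0 := by rw [h2, Matrix.mul_zero]
    simp [this]

theorem complete [CharZero k] {φ : G → k} (hφ : ∀ g h, φ (h * g * h⁻¹) = φ g) (g : G) :
    Fintype.card G * φ g = ∑ i, (∑ h, φ h⁻¹ * I.χ i h) * I.χ i g := by
  have hG : (Fintype.card G : k) ≠ 0 := Nat.cast_ne_zero.2 Fintype.card_ne_zero
  let φ' : G → k := fun g => Fintype.card G * φ g⁻¹ -
    ∑ i, (∑ h, φ h⁻¹ * I.χ i h) * I.χ i g⁻¹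
  have hconj : ∀ g h : G, (h * g * h⁻¹)⁻¹ = h * g⁻¹ * h⁻¹ := fun g h => by group
  have hφ' : ∀ g h, φ' (h * g * h⁻¹) = φ' g := by
    intro g h
    simp only [φ', hconj, hφ, I.χ_conj]
  have h0 : φ' = 0 := by
    apply I.inj
    intro j
    obtain ⟨c, hc, hc'⟩ := I.class_sum_eq j hφ'
    have h1 : ∑ g, φ' g * I.χ j g = 0 := by
      simp only [φ', sub_mul, Finset.sum_sub_distrib, Finset.sum_mul]
      rw [sub_eq_zero, Finset.sum_comm]
      have : ∀ i, ∑ x, ∑ y, φ y⁻¹ * I.χ i y * I.χ i x⁻¹ * I.χ j x =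
          (∑ y, φ y⁻¹ * I.χ i y) * if i = j then (Fintype.card G : k) else 0 := by
        intro i
        rw [← I.orth i j, Finset.sum_mul_sum, Finset.sum_comm]
        refine Finset.sum_congr rfl fun _ _ => Finset.sum_congr rfl fun _ _ => by ring
      simp_rw [this]
      simp [Finset.sum_mul]
      exact Finset.sum_congr rfl fun _ _ => by ring
    rw [h1] at hc'
    have hd : (I.d j : k) ≠ 0 := Nat.cast_ne_zero.2 (I.pos j).ne'
    have : c = 0 := by simpa [hd] using hc'.symm
    rw [hc, this, zero_smul]
  have := congrFun h0 g⁻¹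
  simpa [φ', sub_eq_zero] using this

/-- The multiplicities of irreducible characters in a character are natural numbers. -/
theorem decomp [CharZero k] {ι : Type*} [Fintype ι] [DecidableEq ι] (R : G →* Matrix ι ι k)
    (i : Fin I.n) : ∃ c : ℕ, ∑ h, (R h⁻¹).trace * I.χ i h = Fintype.card G * (c : k) := by
  have hG : (Fintype.card G : k) ≠ 0 := Nat.cast_ne_zero.2 Fintype.card_ne_zero
  have hclass : ∀ g h, (R (h * g * h⁻¹)).trace = (R g).trace := by
    intro g h
    rw [map_mul, Matrix.trace_mul_comm, ← map_mul]
    simp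
  obtain ⟨φ, hφ⟩ := I.surj (Pi.single i (Matrix.single ⟨0, I.pos i⟩ ⟨0, I.pos i⟩ 1))
  -- the convolution square of `φ` is `φ`
  have hconv : ∀ x, ∑ g, φ g * φ (g⁻¹ * x) = φ x := by
    have : (fun x => ∑ g, φ g * φ (g⁻¹ * x) - φ x) = 0 := by
      apply I.inj
      intro j
      simp only [sub_smul, Finset.sum_sub_distrib, Finset.sum_smul]
      have h1 : ∑ x, ∑ g, (φ g * φ (g⁻¹ * x)) • I.rep j x =
          (∑ g, φ g • I.rep j g) * (∑ g, φ g • I.rep j g) := by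
        rw [Finset.sum_comm, Finset.sum_mul]
        refine Finset.sum_congr rfl fun g _ => ?_
        rw [Finset.mul_sum]
        refine Fintype.sum_bijective (g⁻¹ * ·) (Group.mulLeft_bijective g⁻¹) _ _ fun x => ?_
        rw [smul_mul_smul_comm, ← map_mul]
        simp
      rw [h1, hφ]
      by_cases hij : j = i
      · subst hij; simp
      · simp [Pi.single_eq_of_ne hij]
    intro x
    simpa [sub_eq_zero] using congrFun this x
  have hidem : IsIdempotentElem (∑ g, φ g • R g) := by
    unfold IsIdempotentElem
    conv_rhs => enter [2, x]; rw [← hconv x]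
    simp_rw [Finset.sum_smul]
    rw [Finset.sum_comm, Finset.sum_mul]
    refine Finset.sum_congr rfl fun g _ => ?_
    rw [Finset.mul_sum]
    symm
    refine Fintype.sum_bijective (g⁻¹ * ·) (Group.mulLeft_bijective g⁻¹) _ _ fun x => ?_
    rw [smul_mul_smul_comm, ← map_mul]
    simp
  obtain ⟨c, hc⟩ := Matrix.exists_natCast_trace_eq_of_isIdempotentElem hidem
  refine ⟨c, ?_⟩
  rw [← hc, Matrix.trace_sum, Finset.mul_sum]
  have h2 : ∀ g, (Fintype.card G : k) * (φ g • R g).trace =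
      ∑ j, (∑ h, (R h⁻¹).trace * I.χ j h) * (φ g * I.χ j g) := by
    intro g
    rw [Matrix.trace_smul, smul_eq_mul, mul_left_comm,
      I.complete (φ := fun g => (R g).trace) hclass g, Finset.mul_sum]
    exact Finset.sum_congr rfl fun _ _ => by ring
  simp_rw [h2]
  rw [Finset.sum_comm]
  have h3 : ∀ j, ∑ g, φ g * I.χ j g = if j = i then 1 else 0 := by
    intro j
    have := congrArg Matrix.trace (hφ j)
    rw [Matrix.trace_sum] at this
    simp only [Matrix.trace_smul, smul_eq_mul] at this
    change ∑ g, φ g * I.χ j g = _ at this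
    rw [this]
    split_ifs with h
    · subst h; simp
    · simp [Pi.single_eq_of_ne h]
  simp_rw [← Finset.mul_sum, h3]
  simp

end IrreducibleReps

end Characters

section Traces

variable {k ι : Type*} [Field k] [Fintype ι] [DecidableEq ι]

theorem Matrix.exists_natCast_sum_trace_pow [CharZero k] {X : Matrix ι ι k} {n : ℕ} (hn : 0 < n)
    (hX : X ^ n = 1) : ∃ c : ℕ, ∑ j ∈ Finset.range n, (X ^ j).trace = n * (c : k) := by
  have hn' : (n : k) ≠ 0 := Nat.cast_ne_zero.2 hn.ne'
  set S := ∑ j ∈ Finset.range n, X ^ j with hS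
  have h1 : X * S = S := by
    have := mul_geom_sum X n
    rw [hX, sub_self, sub_mul, one_mul, sub_eq_zero] at this
    exact this
  have h2 : ∀ j : ℕ, X ^ j * S = S := by
    intro j
    induction j with
    | zero => simp
    | succ j ih => rw [pow_succ, mul_assoc, h1, ih]
  have h3 : S * S = (n : k) • S := by
    conv_lhs => enter [1]; rw [hS]
    rw [Finset.sum_mul, Finset.sum_congr rfl (fun j _ => h2 j)]
    simp [Nat.cast_smul_eq_nsmul]
  have hidem : IsIdempotentElem ((n : k)⁻¹ • S) := by
    unfold IsIdempotentElem
    rw [smul_mul_smul_comm, h3, smul_smul]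
    congr 1
    field_simp
  obtain ⟨c, hc⟩ := Matrix.exists_natCast_trace_eq_of_isIdempotentElem hidem
  refine ⟨c, ?_⟩
  rw [← hc, Matrix.trace_smul, hS, Matrix.trace_sum, smul_eq_mul]
  field_simp

theorem IsPrimitiveRoot.sum_range_pow_mul {ω : k} {n : ℕ} (hω : IsPrimitiveRoot ω n)
    (j : ℕ) : ∑ l ∈ Finset.range n, ω ^ (j * l) = if n ∣ j then (n : k) else 0 := by
  simp_rw [pow_mul]
  split_ifs with h
  · rw [(hω.pow_eq_one_iff_dvd j).2 h]; simp
  · have h1 : ω ^ j ≠ 1 := fun h' => h ((hω.pow_eq_one_iff_dvd j).1 h')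
    have := mul_geom_sum (ω ^ j) n
    rw [← pow_mul, mul_comm j n, pow_mul, hω.pow_eq_one, one_pow, sub_self] at this
    exact (mul_eq_zero.1 this).resolve_left (sub_ne_zero.2 h1)

/-- Eigenvalue multiplicities of a matrix of finite order. -/
theorem Matrix.exists_multiplicities [CharZero k] {X : Matrix ι ι k} {n : ℕ} (hn : 0 < n)
    (hX : X ^ n = 1) {ω : k} (hω : IsPrimitiveRoot ω n) :
    ∃ μ : ℕ → ℕ, (∀ j, ∑ l ∈ Finset.range n, ω ^ (j * l) * (X ^ l).trace = n * (μ j : k)) ∧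
      ∀ l, (X ^ l).trace = ∑ j ∈ Finset.range n, μ j * (ω⁻¹) ^ (j * l) := by
  have hn' : (n : k) ≠ 0 := Nat.cast_ne_zero.2 hn.ne'
  have hω0 : ω ≠ 0 := hω.ne_zero hn.ne'
  have h1 : ∀ j : ℕ, ∃ c : ℕ, ∑ l ∈ Finset.range n, ω ^ (j * l) * (X ^ l).trace = n * (c : k) := by
    intro j
    obtain ⟨c, hc⟩ := Matrix.exists_natCast_sum_trace_pow (X := ω ^ j • X) hn
      (by rw [smul_pow, hX, ← pow_mul, mul_comm, pow_mul, hω.pow_eq_one]; simp)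
    refine ⟨c, hc ▸ Finset.sum_congr rfl fun l _ => ?_⟩
    rw [smul_pow, Matrix.trace_smul, smul_eq_mul, pow_mul]
  choose μ hμ using h1
  refine ⟨μ, hμ, fun l => ?_⟩
  apply mul_left_cancel₀ hn'
  rw [Finset.mul_sum]
  simp_rw [← mul_assoc, ← hμ, Finset.sum_mul]
  rw [Finset.sum_comm]
  have key : ∀ s ∈ Finset.range n, ∑ j ∈ Finset.range n,
      ω ^ (j * s) * (X ^ s).trace * ω⁻¹ ^ (j * l) =
      if s = l % n then n * (X ^ l).trace else 0 := by
    intro s hs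
    rw [Finset.mem_range] at hs
    have hln : l % n < n := Nat.mod_lt _ hn
    have : ∀ j, ω⁻¹ ^ (j * l) = ω ^ (j * (n - l % n)) := by
      intro j
      have h1 : ω ^ l = ω ^ (l % n) := by
        conv_lhs => rw [← Nat.mod_add_div l n, pow_add, pow_mul, hω.pow_eq_one, one_pow, mul_one]
      have h2 : ω⁻¹ ^ l = ω ^ (n - l % n) := by
        rw [inv_pow, h1]
        exact inv_eq_of_mul_eq_one_right
          (by rw [← pow_add, Nat.add_sub_cancel' hln.le, hω.pow_eq_one])
      rw [mul_comm, pow_mul, h2, ← pow_mul, mul_comm]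
    have h2 : ∀ j, ω ^ (j * s) * (X ^ s).trace * ω⁻¹ ^ (j * l) =
        (X ^ s).trace * ω ^ ((s + (n - l % n)) * j) := by
      intro j
      rw [this, add_mul, pow_add, mul_comm j s, mul_comm j (n - l % n)]
      ring
    simp_rw [h2]
    rw [← Finset.mul_sum, hω.sum_range_pow_mul]
    have h3 : n ∣ s + (n - l % n) ↔ s = l % n := by
      constructor
      · rintro ⟨c, hc⟩
        have hc1 : c = 1 := by
          have : c < 2 := by
            by_contra h
            have : n * 2 ≤ n * c := Nat.mul_le_mul_left _ (by omega)
            omega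
          have : c ≠ 0 := by rintro rfl; omega
          omega
        subst hc1; omega
      · intro h; rw [h]; exact ⟨1, by omega⟩
    simp only [h3]
    split_ifs with h
    · have : X ^ l = X ^ s := by
        conv_lhs => rw [← Nat.div_add_mod l n, pow_add, pow_mul, hX, one_pow, one_mul, ← h]
      rw [this]; ring
    · simp
  rw [Finset.sum_congr rfl key]
  simp [Nat.mod_lt _ hn]

theorem prime_dvd_sum_pow_sub {O κ : Type*} [CommRing O] {s : ℕ} (hs : s.Prime) (t : Finset κ)
    (f : κ → O) : (s : O) ∣ (∑ i ∈ t, f i) ^ s - ∑ i ∈ t, f i ^ s := by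
  classical
  induction t using Finset.induction_on with
  | empty => simp [hs.ne_zero]
  | insert a t ha ih =>
    rw [Finset.sum_insert ha, Finset.sum_insert ha]
    obtain ⟨r, hr⟩ := exists_add_pow_prime_eq hs (f a) (∑ i ∈ t, f i)
    obtain ⟨c, hc⟩ := ih
    refine ⟨f a * (∑ i ∈ t, f i) * r + c, ?_⟩
    rw [mul_add, ← hc, hr]; ring

theorem isIntegral_trace_of_pow_eq_one [CharZero k] [IsAlgClosed k] {X : Matrix ι ι k} {n : ℕ}
    (hn : 0 < n) (hX : X ^ n = 1) : IsIntegral ℤ X.trace := by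
  have : NeZero (n : k) := ⟨Nat.cast_ne_zero.2 hn.ne'⟩
  obtain ⟨ω, hω⟩ := (inferInstance : HasEnoughRootsOfUnity k n).prim
  obtain ⟨μ, -, hμ⟩ := Matrix.exists_multiplicities hn hX hω
  rw [← pow_one X, hμ 1]
  have hi : IsIntegral ℤ (ω⁻¹) := hω.inv.isIntegral hn
  exact IsIntegral.sum _ fun j _ => (isIntegral_natCast _).mul (hi.pow _)

theorem int_prime_dvd_trace_sub [CharZero k] [IsAlgClosed k] {X : Matrix ι ι k} {n : ℕ}
    (hn : 0 < n) (hX : X ^ n = 1) {s : ℕ} (hs : s.Prime) {a b : ℤ} (ha : X.trace = a)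
    (hb : (X ^ s).trace = b) : (s : ℤ) ∣ a - b := by
  have : NeZero (n : k) := ⟨Nat.cast_ne_zero.2 hn.ne'⟩
  have hs0 : (s : k) ≠ 0 := Nat.cast_ne_zero.2 hs.ne_zero
  obtain ⟨ω, hω⟩ := (inferInstance : HasEnoughRootsOfUnity k n).prim
  obtain ⟨μ, -, hμ⟩ := Matrix.exists_multiplicities hn hX hω
  have hi : IsIntegral ℤ (ω⁻¹) := hω.inv.isIntegral hn
  let w : integralClosure ℤ k := ⟨ω⁻¹, hi⟩
  let f : (Σ j : Fin n, Fin (μ j)) → integralClosure ℤ k := fun x => w ^ (x.1 : ℕ)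
  have hsum : ∀ l : ℕ, ((∑ x, f x ^ l : integralClosure ℤ k) : k) = (X ^ l).trace := by
    intro l
    rw [hμ l, ← Fin.sum_univ_eq_sum_range (fun j => (μ j : k) * ω⁻¹ ^ (j * l))]
    simp only [f, Fintype.sum_sigma, AddSubmonoidClass.coe_finsetSum, w,
      Finset.sum_const, Finset.card_univ, Fintype.card_fin, nsmul_eq_mul, ← pow_mul]
    simp
  obtain ⟨c, hc⟩ := prime_dvd_sum_pow_sub hs Finset.univ f
  have h1 : ((a ^ s - b : ℤ) : k) = s * (c : k) := by
    have := congrArg (Subtype.val) hc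
    have e1 := hsum 1
    have e2 := hsum s
    simp only [pow_one] at e1
    push_cast at this e1 e2 ⊢
    rw [e1, e2, ha, hb] at this
    exact this
  have h2 : (s : ℤ) ∣ a ^ s - b := by
    have hq : IsIntegral ℤ (algebraMap ℚ k (((a ^ s - b : ℤ) : ℚ) / s)) := by
      have : algebraMap ℚ k (((a ^ s - b : ℤ) : ℚ) / s) = c := by
        rw [map_div₀, map_intCast, map_natCast, h1]; field_simp
      rw [this]; exact c.2
    rw [isIntegral_algebraMap_iff (algebraMap ℚ k).injective] at hq
    obtain ⟨y, hy⟩ := IsIntegrallyClosed.isIntegral_iff.1 hq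
    refine ⟨y, ?_⟩
    have hs0' : (s : ℚ) ≠ 0 := Nat.cast_ne_zero.2 hs.ne_zero
    rw [eq_div_iff hs0'] at hy
    have : ((a ^ s - b : ℤ) : ℚ) = ((s * y : ℤ) : ℚ) := by
      rw [← hy]; push_cast; simp; ring
    exact_mod_cast this
  have h3 : (s : ℤ) ∣ a ^ s - a := by
    have := Fact.mk hs
    rw [← ZMod.intCast_zmod_eq_zero_iff_dvd]
    push_cast
    rw [ZMod.pow_card, sub_self]
  have : a - b = (a ^ s - b) - (a ^ s - a) := by ring
  rw [this]; exact dvd_sub h2 h3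

instance : Algebra.IsAlgebraic ℚ (AlgebraicClosure ℚ) := by
  have : (DivisionRing.toRatAlgebra : Algebra ℚ (AlgebraicClosure ℚ)) =
    AlgebraicClosure.instAlgebra ℚ := Subsingleton.elim _ _
  rw [this]; infer_instance

theorem exists_int_eq_of_isIntegral_of_fixed [CharZero k] [IsAlgClosed k]
    [Algebra.IsAlgebraic ℚ k] {x : k} (hx : IsIntegral ℤ x)
    (hfix : ∀ σ : k ≃ₐ[ℚ] k, σ x = x) : ∃ n : ℤ, x = n := by
  have : IsAlgClosure ℚ k := ⟨inferInstance, inferInstance⟩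
  have : IsGalois ℚ k := {}
  obtain ⟨q, rfl⟩ := (InfiniteGalois.mem_range_algebraMap_iff_fixed (k := ℚ) x).2 hfix
  rw [isIntegral_algebraMap_iff (algebraMap ℚ _).injective] at hx
  obtain ⟨y, rfl⟩ := IsIntegrallyClosed.isIntegral_iff.1 hx
  exact ⟨y, by simp⟩

end Traces

section Vectors

variable {ι : Type*} [Fintype ι] [DecidableEq ι]

theorem exists_eq_single_sub_single {d : ι → ℤ} (hd : ∀ i, 0 < d i) {u : ι → ℤ}
    (hu : ∑ i, u i ^ 2 = 2) (hud : ∑ i, u i * d i = -1) :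
    ∃ P Q, P ≠ Q ∧ u = Pi.single P 1 - Pi.single Q 1 := by
  have hle : ∀ i, u i ^ 2 ≤ 2 := fun i =>
    hu ▸ Finset.single_le_sum (f := fun i => u i ^ 2) (fun j _ => sq_nonneg _) (Finset.mem_univ i)
  have hQ : ∃ Q, u Q < 0 := by
    by_contra! h
    have : 0 ≤ ∑ i, u i * d i := Finset.sum_nonneg fun i _ => mul_nonneg (h i) (hd i).le
    omega
  obtain ⟨Q, hQ⟩ := hQ
  have hQ1 : u Q = -1 := by nlinarith [hle Q]
  have hs1 := Finset.add_sum_erase Finset.univ (fun i => u i ^ 2) (Finset.mem_univ Q)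
  have hs2 := Finset.add_sum_erase Finset.univ (fun i => u i * d i) (Finset.mem_univ Q)
  simp only [hQ1, hu, hud] at hs1 hs2
  have hP : ∃ P, 0 < u P := by
    by_contra! h
    have h1 : ∑ i ∈ Finset.univ.erase Q, u i ^ 2 ≤ - ∑ i ∈ Finset.univ.erase Q, u i * d i := by
      rw [← Finset.sum_neg_distrib]
      refine Finset.sum_le_sum fun i _ => ?_
      have := h i
      have := hd i
      have := hle i
      have h3 : u i = 0 ∨ u i = -1 := by
        have : -2 < u i := by nlinarith
        omega
      rcases h3 with h3 | h3 <;> rw [h3] <;> linarith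
    have := hd Q
    linarith
  obtain ⟨P, hP⟩ := hP
  have hP1 : u P = 1 := by nlinarith [hle P]
  have hPQ : P ≠ Q := by rintro rfl; omega
  have hs3 := Finset.add_sum_erase (Finset.univ.erase Q) (fun i => u i ^ 2)
    (Finset.mem_erase.2 ⟨hPQ, Finset.mem_univ P⟩)
  simp only [hP1] at hs3
  have hs4 : ∑ i ∈ (Finset.univ.erase Q).erase P, u i ^ 2 = 0 := by linarith
  rw [Finset.sum_eq_zero_iff_of_nonneg (fun i _ => sq_nonneg _)] at hs4
  refine ⟨P, Q, hPQ, ?_⟩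
  funext i
  by_cases h1 : i = P
  · subst h1; simp [hP1, Pi.single_eq_of_ne hPQ]
  by_cases h2 : i = Q
  · subst h2; simp [hQ1, Pi.single_eq_of_ne h1]
  · have := hs4 i (by simp [h1, h2])
    simp [Pi.single_eq_of_ne h1, Pi.single_eq_of_ne h2]
    exact pow_eq_zero_iff (two_ne_zero) |>.1 this

theorem sum_single_sub_single_mul (P Q : ι) (u : ι → ℤ) :
    ∑ i, (Pi.single P 1 - Pi.single Q 1 : ι → ℤ) i * u i = u P - u Q := by
  simp [sub_mul, Finset.sum_sub_distrib, Pi.single_apply]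

/-- Three vectors of norm two and pairwise inner product one, with negative degree, form a
sunflower. -/
theorem exists_sunflower {d : ι → ℤ} (hd : ∀ i, 0 < d i) {u : Fin 3 → ι → ℤ}
    (hu : ∀ a, ∑ i, u a i ^ 2 = 2) (hud : ∀ a, ∑ i, u a i * d i = -1)
    (huv : ∀ a b, a ≠ b → ∑ i, u a i * u b i = 1) :
    ∃ (δ : ℤ) (P : ι) (X : Fin 3 → ι), (δ = 1 ∨ δ = -1) ∧ Function.Injective X ∧
      (∀ a, X a ≠ P) ∧ ∀ a, u a = δ • (Pi.single P 1 - Pi.single (X a) 1) := by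
  choose P Q hPQ h using fun a => exists_eq_single_sub_single hd (hu a) (hud a)
  have hdeg : ∀ a, d (Q a) = d (P a) + 1 := by
    intro a
    have := hud a
    rw [h a, sum_single_sub_single_mul] at this
    linarith
  have hdich : ∀ a b, a ≠ b → (P a = P b ∧ Q a ≠ Q b) ∨ (P a ≠ P b ∧ Q a = Q b) := by
    intro a b hab
    have := huv a b hab
    rw [h a, sum_single_sub_single_mul, h b] at this
    simp only [Pi.sub_apply, Pi.single_apply] at this
    have h1 : ¬ (P a = P b ∧ Q a = Q b) := by
      rintro ⟨h1, h2⟩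
      rw [h1, h2] at this
      simp [hPQ b, (hPQ b).symm] at this
    by_cases hp : P a = P b
    · exact Or.inl ⟨hp, fun h2 => h1 ⟨hp, h2⟩⟩
    · refine Or.inr ⟨hp, ?_⟩
      by_contra hq
      simp only [hp, hq, if_false] at this
      split_ifs at this <;> omega
  have h01 := hdich 0 1 (by decide)
  have h02 := hdich 0 2 (by decide)
  have h12 := hdich 1 2 (by decide)
  have hall : (∀ a b, a ≠ b → P a = P b ∧ Q a ≠ Q b) ∨ (∀ a b, a ≠ b → P a ≠ P b ∧ Q a = Q b) := by
    have h3 : ∀ i : Fin 3, i = 0 ∨ i = 1 ∨ i = 2 := by decide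
    clear hdich hdeg h hPQ huv hud hu
    rcases h01 with h01 | h01 <;> rcases h02 with h02 | h02 <;> rcases h12 with h12 | h12
    · left; intro a b hab
      rcases h3 a with rfl | rfl | rfl <;> rcases h3 b with rfl | rfl | rfl <;> grind
    any_goals exfalso; grind
    · right; intro a b hab
      rcases h3 a with rfl | rfl | rfl <;> rcases h3 b with rfl | rfl | rfl <;> grind
  rcases hall with hall | hall
  · refine ⟨1, P 0, Q, Or.inl rfl, fun a b hab => ?_, fun a => ?_, fun a => ?_⟩
    · by_contra hne; exact (hall a b hne).2 hab
    · by_cases ha : a = 0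
      · subst ha; exact (hPQ 0).symm
      · rw [← (hall a 0 ha).1]; exact (hPQ a).symm
    · by_cases ha : a = 0
      · subst ha; rw [h 0]; simp
      · rw [h a, (hall a 0 ha).1]; simp
  · refine ⟨-1, Q 0, P, Or.inr rfl, fun a b hab => ?_, fun a => ?_, fun a => ?_⟩
    · by_contra hne; exact (hall a b hne).1 hab
    · by_cases ha : a = 0
      · subst ha; exact (hPQ 0)
      · rw [← (hall a 0 ha).2]; exact (hPQ a)
    · by_cases ha : a = 0
      · subst ha; rw [h 0]; simp
      · rw [h a, (hall a 0 ha).2]; simp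

theorem eq_of_inner_sunflower {d : ι → ℤ} {δ : ℤ} {P : ι} {X : Fin 3 → ι}
    (hδ : δ = 1 ∨ δ = -1) (hX : Function.Injective X) (hXP : ∀ a, X a ≠ P)
    (hdX : ∀ a, d (X a) = d (X 0)) {u : ι → ℤ} (hu : ∑ i, u i ^ 2 ≤ 3)
    (hud : ∑ i, u i * d i = -1)
    (h : ∀ a, ∑ i, (δ • (Pi.single P 1 - Pi.single (X a) 1) : ι → ℤ) i * u i = 1) :
    u P = δ := by
  have h' : ∀ a, δ * (u P - u (X a)) = 1 := by
    intro a
    rw [← sum_single_sub_single_mul, Finset.mul_sum]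
    refine Eq.trans (Finset.sum_congr rfl fun i _ => ?_) (h a)
    simp only [Pi.smul_apply, smul_eq_mul, mul_assoc]
  have hsub : (Finset.univ.image X ∪ {P} : Finset ι) ⊆ Finset.univ := Finset.subset_univ _
  have hdisj : Disjoint (Finset.univ.image X) {P} := by
    simp [hXP]
  have hsq := Finset.sum_union hdisj (f := fun i => u i ^ 2)
  rw [Finset.sum_image (fun a _ b _ hab => hX hab), Finset.sum_singleton, Fin.sum_univ_three]
    at hsq
  have hsum := Finset.sum_sdiff hsub (f := fun i => u i ^ 2)
  have hnn : 0 ≤ ∑ i ∈ Finset.univ \ (Finset.univ.image X ∪ {P}), u i ^ 2 :=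
    Finset.sum_nonneg fun i _ => sq_nonneg _
  have h0 := h' 0
  have h1 := h' 1
  have h2 := h' 2
  by_contra hne
  have hP0 : u P = 0 ∧ u (X 0) = -δ ∧ u (X 1) = -δ ∧ u (X 2) = -δ := by
    rcases hδ with rfl | rfl
    · have e0 : u (X 0) = u P - 1 := by linarith
      have e1 : u (X 1) = u P - 1 := by linarith
      have e2 : u (X 2) = u P - 1 := by linarith
      rw [e0, e1, e2] at hsq
      have : u P = 0 := by
        have : 3 * (u P - 1) ^ 2 + u P ^ 2 ≤ 3 := by linarith
        have : 0 ≤ u P := by nlinarith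
        have : u P < 2 := by nlinarith
        omega
      omega
    · have e0 : u (X 0) = u P + 1 := by linarith
      have e1 : u (X 1) = u P + 1 := by linarith
      have e2 : u (X 2) = u P + 1 := by linarith
      rw [e0, e1, e2] at hsq
      have : u P = 0 := by
        have : 3 * (u P + 1) ^ 2 + u P ^ 2 ≤ 3 := by linarith
        have : u P ≤ 0 := by nlinarith
        have : -2 < u P := by nlinarith
        omega
      omega
  obtain ⟨e, e0, e1, e2⟩ := hP0
  have hδ2 : δ ^ 2 = 1 := by rcases hδ with rfl | rfl <;> norm_num
  rw [e, e0, e1, e2, neg_sq, hδ2] at hsq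
  have hz : ∑ i ∈ Finset.univ \ (Finset.univ.image X ∪ {P}), u i ^ 2 = 0 := by linarith
  rw [Finset.sum_eq_zero_iff_of_nonneg (fun i _ => sq_nonneg _)] at hz
  have hdsum := Finset.sum_sdiff hsub (f := fun i => u i * d i)
  rw [Finset.sum_union hdisj, Finset.sum_image (fun a _ b _ hab => hX hab), Finset.sum_singleton,
    Fin.sum_univ_three, hud, e, e0, e1, e2, hdX 1, hdX 2, Finset.sum_eq_zero] at hdsum
  · rcases hδ with rfl | rfl <;> omega
  · intro i hi
    rw [pow_eq_zero_iff two_ne_zero |>.1 (hz i hi), zero_mul]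

end Vectors

/-- `⟨a, t⟩` is a dihedral subgroup of order `2 * m`, with `a` of order `m`, in which
the centralizers of nontrivial powers of `a` lie and which controls fusion in `⟨a⟩`. -/
structure DihedralTI {G : Type*} [Group G] (a t : G) (m : ℕ) : Prop where
  order : orderOf a = m
  eight_dvd : 8 ∣ m
  pos : 0 < m
  notMem : t ∉ Subgroup.zpowers a
  sq : t * t = 1
  inverts : t * a * t⁻¹ = a⁻¹
  ti : ∀ c ∈ Subgroup.zpowers a, c ≠ 1 → ∀ g, g * c * g⁻¹ ∈ Subgroup.zpowers a →
    g ∈ Subgroup.zpowers a ∨ g * t ∈ Subgroup.zpowers a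
  involution : ∀ u : G, u * u = 1 → u ≠ 1 → ∃ g, u = g * a ^ (m / 2) * g⁻¹

namespace DihedralTI

variable {G : Type*} [Group G] {a t : G} {m : ℕ} (D : DihedralTI a t m)

theorem pow_mem (l : ℕ) : a ^ l ∈ Subgroup.zpowers a := Subgroup.npow_mem_zpowers a l

include D

theorem t_inv : t⁻¹ = t := inv_eq_of_mul_eq_one_right D.sq

theorem conj_mem {c : G} (hc : c ∈ Subgroup.zpowers a) : t * c * t⁻¹ = c⁻¹ := by
  obtain ⟨i, rfl⟩ := Subgroup.mem_zpowers_iff.1 hc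
  rw [← conj_zpow, D.inverts, inv_zpow]

theorem conj_mem' {c : G} (hc : c ∈ Subgroup.zpowers a) : t⁻¹ * c * t = c⁻¹ := by
  have := D.conj_mem hc
  rwa [D.t_inv] at this ⊢

theorem mem_or {c g : G} (hc : c ∈ Subgroup.zpowers a) (h1 : c ≠ 1)
    (h : g⁻¹ * c * g ∈ Subgroup.zpowers a) :
    g ∈ Subgroup.zpowers a ∨ g * t ∈ Subgroup.zpowers a := by
  have := D.ti c hc h1 g⁻¹ (by simpa using h)
  rcases this with h | h
  · exact Or.inl (inv_mem_iff.1 h)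
  · right
    have h2 := inv_mem h
    rw [mul_inv_rev, inv_inv] at h2
    have h3 := D.conj_mem' h2
    have h4 : t⁻¹ * (t⁻¹ * g) * t = g * t := by
      rw [← mul_assoc, ← mul_inv_rev, D.sq]; simp
    rw [← h4, h3]; exact inv_mem h2

theorem conj_of_mem {c g : G} (hc : c ∈ Subgroup.zpowers a) (hg : g ∈ Subgroup.zpowers a) :
    g⁻¹ * c * g = c := by
  obtain ⟨i, rfl⟩ := Subgroup.mem_zpowers_iff.1 hc
  obtain ⟨j, rfl⟩ := Subgroup.mem_zpowers_iff.1 hg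
  rw [mul_assoc, ((Commute.refl a).zpow_zpow i j).eq, inv_mul_cancel_left]

theorem conj_of_mul_mem {c g : G} (hc : c ∈ Subgroup.zpowers a)
    (hg : g * t ∈ Subgroup.zpowers a) : g⁻¹ * c * g = c⁻¹ := by
  have h1 := D.conj_of_mem hc hg
  have h2 : g⁻¹ * c * g = t * ((g * t)⁻¹ * c * (g * t)) * t⁻¹ := by group
  rw [h2, h1, D.conj_mem hc]

theorem not_mem_and {g : G} (hg : g ∈ Subgroup.zpowers a) : g * t ∉ Subgroup.zpowers a := by
  intro h
  exact D.notMem (by simpa using mul_mem (inv_mem hg) h)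

theorem pow_m : a ^ m = 1 := D.order ▸ pow_orderOf_eq_one a

theorem pow_eq_one_iff {l : ℕ} : a ^ l = 1 ↔ m ∣ l := by
  rw [← D.order, orderOf_dvd_iff_pow_eq_one]

theorem pow_inj {i j : ℕ} (hi : i < m) (hj : j < m) (h : a ^ i = a ^ j) : i = j := by
  rw [pow_inj_mod, D.order, Nat.mod_eq_of_lt hi, Nat.mod_eq_of_lt hj] at h
  exact h

theorem exists_pow {c : G} (hc : c ∈ Subgroup.zpowers a) : ∃ l < m, c = a ^ l := by
  obtain ⟨i, rfl⟩ := Subgroup.mem_zpowers_iff.1 hc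
  have hm : (0 : ℤ) < m := by exact_mod_cast D.pos
  refine ⟨(i % m).toNat, ?_, ?_⟩
  · have := Int.emod_lt_of_pos i hm
    have := Int.emod_nonneg i hm.ne'
    omega
  · rw [← zpow_natCast, Int.toNat_of_nonneg (Int.emod_nonneg i hm.ne'), ← D.order,
      zpow_mod_orderOf]

theorem inv_pow {l : ℕ} (hl : l < m) : (a ^ l)⁻¹ = a ^ (m - l) :=
  inv_eq_of_mul_eq_one_right (by rw [← pow_add, Nat.add_sub_cancel' hl.le, D.pow_m])

theorem eq_of_sq {c : G} (hc : c ∈ Subgroup.zpowers a) (h : c * c = 1) :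
    c = 1 ∨ c = a ^ (m / 2) := by
  obtain ⟨l, hl, rfl⟩ := D.exists_pow hc
  rw [← pow_add, D.pow_eq_one_iff] at h
  obtain ⟨q, hq⟩ := h
  have h8 := D.eight_dvd
  have hq2 : q < 2 := by
    by_contra hh
    have : m * 2 ≤ m * q := Nat.mul_le_mul_left _ (by omega)
    omega
  interval_cases q
  · left; rw [show l = 0 by omega, pow_zero]
  · right; congr 1; omega

theorem z_ne : a ^ (m / 2) ≠ 1 := by
  rw [Ne, D.pow_eq_one_iff]
  intro h
  have := D.eight_dvd
  have := D.pos
  have := Nat.le_of_dvd (by omega) h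
  omega

theorem z_sq : a ^ (m / 2) * a ^ (m / 2) = 1 := by
  rw [← pow_add, D.pow_eq_one_iff]
  have := D.eight_dvd
  exact ⟨1, by omega⟩

variable [Fintype G] [DecidableEq G]

theorem card_mem [DecidablePred (· ∈ Subgroup.zpowers a)] :
    (Finset.univ.filter fun g : G => g ∈ Subgroup.zpowers a).card = m := by
  rw [← Fintype.card_subtype, ← Nat.card_eq_fintype_card, ← D.order]
  exact Nat.card_zpowers a

theorem card_mul_mem [DecidablePred (· ∈ Subgroup.zpowers a)] :
    (Finset.univ.filter fun g : G => g * t ∈ Subgroup.zpowers a).card = m := by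
  rw [← D.card_mem]
  refine Finset.card_bij (fun g _ => g * t) ?_ ?_ ?_
  · simp
  · simp
  · intro b hb
    refine ⟨b * t, ?_, ?_⟩ <;> simp [mul_assoc, D.sq] at *
    exact hb

/-- Summation over the cyclic subgroup. -/
theorem sum_conj_pow {k : Type*} [Field k] [DecidablePred (· ∈ Subgroup.zpowers a)]
    (f : ℕ → k) {s : ℕ} (hs0 : 0 < s) (hs : s < m) :
    ∑ h : G, ∑ l ∈ Finset.range m, (if h⁻¹ * a ^ s * h = a ^ l then f l else 0) =
      m * (f s + f (m - s)) := by
  have h1 : ∀ h : G, ∑ l ∈ Finset.range m, (if h⁻¹ * a ^ s * h = a ^ l then f l else 0) =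
      (if h ∈ Subgroup.zpowers a then f s else 0) +
      (if h * t ∈ Subgroup.zpowers a then f (m - s) else 0) := by
    intro h
    have hs1 : a ^ s ≠ 1 := by
      rw [Ne, D.pow_eq_one_iff]
      exact fun h => by have := Nat.le_of_dvd hs0 h; omega
    by_cases hA : h ∈ Subgroup.zpowers a
    · rw [if_pos hA, if_neg (D.not_mem_and hA), D.conj_of_mem (DihedralTI.pow_mem s) hA, add_zero,
        Finset.sum_eq_single_of_mem s (Finset.mem_range.2 hs), if_pos rfl]
      intro b hb hbs
      exact if_neg fun h => hbs (D.pow_inj hs (Finset.mem_range.1 hb) h).symm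
    by_cases hA' : h * t ∈ Subgroup.zpowers a
    · rw [if_neg hA, if_pos hA', D.conj_of_mul_mem (DihedralTI.pow_mem s) hA', zero_add, D.inv_pow hs,
        Finset.sum_eq_single_of_mem (m - s) (Finset.mem_range.2 (by omega)), if_pos rfl]
      intro b hb hbs
      exact if_neg fun h => hbs (D.pow_inj (by omega) (Finset.mem_range.1 hb) h).symm
    · rw [if_neg hA, if_neg hA', add_zero]
      refine Finset.sum_eq_zero fun l _ => if_neg fun h' => ?_
      rcases D.mem_or (DihedralTI.pow_mem s) hs1 (h' ▸ DihedralTI.pow_mem l) with h | h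
      · exact hA h
      · exact hA' h
  rw [Finset.sum_congr rfl fun h _ => h1 h, Finset.sum_add_distrib, ← Finset.sum_filter,
    ← Finset.sum_filter, Finset.sum_const, Finset.sum_const, D.card_mem, D.card_mul_mem]
  simp [mul_add]

/-- The number of involutions. -/
theorem card_involutions [DecidablePred (· ∈ Subgroup.zpowers a)] :
    2 * m * (Finset.univ.filter fun u : G => u * u = 1 ∧ u ≠ 1).card = Fintype.card G := by
  have h8 := D.eight_dvd
  have hpos := D.pos
  have h1 : ∀ g : G, ∀ h, h⁻¹ * (g * a ^ (m / 2) * g⁻¹) * h = a ^ (m / 2) ↔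
      g⁻¹ * h ∈ Subgroup.zpowers a ∨ g⁻¹ * h * t ∈ Subgroup.zpowers a := by
    intro g h
    have e : h⁻¹ * (g * a ^ (m / 2) * g⁻¹) * h = (g⁻¹ * h)⁻¹ * a ^ (m / 2) * (g⁻¹ * h) := by group
    rw [e]
    constructor
    · intro h'
      exact D.mem_or (DihedralTI.pow_mem _) D.z_ne (by rw [h']; exact DihedralTI.pow_mem _)
    · rintro (h' | h')
      · exact D.conj_of_mem (DihedralTI.pow_mem _) h'
      · rw [D.conj_of_mul_mem (DihedralTI.pow_mem _) h', D.inv_pow (by omega)]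
        congr 1; omega
  have h2 : ∀ u ∈ Finset.univ.filter fun u : G => u * u = 1 ∧ u ≠ 1,
      (Finset.univ.filter fun h : G => h⁻¹ * u * h = a ^ (m / 2)).card = 2 * m := by
    intro u hu
    simp only [Finset.mem_filter, Finset.mem_univ, true_and] at hu
    obtain ⟨g, rfl⟩ := D.involution u hu.1 hu.2
    simp_rw [h1]
    have : (Finset.univ.filter fun h : G => g⁻¹ * h ∈ Subgroup.zpowers a ∨
        g⁻¹ * h * t ∈ Subgroup.zpowers a).card =
        (Finset.univ.filter fun h : G => h ∈ Subgroup.zpowers a ∨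
        h * t ∈ Subgroup.zpowers a).card := by
      refine Finset.card_bij (fun h _ => g⁻¹ * h) ?_ ?_ ?_
      · simp
      · simp
      · intro b hb
        refine ⟨g * b, ?_, ?_⟩ <;> simp at *
        exact hb
    rw [this, Finset.filter_or, Finset.card_union_of_disjoint, D.card_mem, D.card_mul_mem, two_mul]
    rw [Finset.disjoint_filter]
    intro x _ hx
    exact D.not_mem_and hx
  have h3 : ∀ h ∈ (Finset.univ : Finset G),
      ((Finset.univ.filter fun u : G => u * u = 1 ∧ u ≠ 1).filter
        fun u => h⁻¹ * u * h = a ^ (m / 2)).card = 1 := by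
    intro h _
    rw [Finset.card_eq_one]
    refine ⟨h * a ^ (m / 2) * h⁻¹, ?_⟩
    ext u
    simp only [Finset.mem_filter, Finset.mem_univ, true_and, Finset.mem_singleton]
    constructor
    · rintro ⟨-, h'⟩
      rw [← h']; group
    · rintro rfl
      refine ⟨⟨?_, ?_⟩, by group⟩
      · have : h * a ^ (m / 2) * h⁻¹ * (h * a ^ (m / 2) * h⁻¹) =
          h * (a ^ (m / 2) * a ^ (m / 2)) * h⁻¹ := by group
        rw [this, D.z_sq]; simp
      · rw [Ne, conj_eq_one_iff]; exact D.z_ne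
  have h4 := Finset.sum_card_bipartiteAbove_eq_sum_card_bipartiteBelow
    (s := Finset.univ.filter fun u : G => u * u = 1 ∧ u ≠ 1) (t := (Finset.univ : Finset G))
    (r := fun u h => h⁻¹ * u * h = a ^ (m / 2))
  simp only [Finset.bipartiteAbove, Finset.bipartiteBelow] at h4
  rw [Finset.sum_congr rfl h2, Finset.sum_congr rfl h3, Finset.sum_const, Finset.sum_const,
    smul_eq_mul, smul_eq_mul, mul_one, Finset.card_univ] at h4
  rw [← h4, mul_comm]

/-- The number of ways to write a nontrivial power of `a` as a product of two involutions. -/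
theorem card_involution_pairs [DecidablePred (· ∈ Subgroup.zpowers a)] {c : G}
    (hc : c ∈ Subgroup.zpowers a) (hc1 : c ≠ 1) :
    (Finset.univ.filter fun u : G => (u * u = 1 ∧ u ≠ 1) ∧
      (u⁻¹ * c) * (u⁻¹ * c) = 1 ∧ u⁻¹ * c ≠ 1).card = m := by
  rw [← D.card_mul_mem]
  congr 1
  ext u
  simp only [Finset.mem_filter, Finset.mem_univ, true_and]
  constructor
  · rintro ⟨⟨h1, h2⟩, h3, h4⟩
    have h5 : u⁻¹ * c * u = c⁻¹ := by
      have hui : u⁻¹ = u := inv_eq_of_mul_eq_one_right h1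
      rw [eq_inv_iff_mul_eq_one, ← h3, hui]; simp only [mul_assoc]
    rcases D.mem_or hc hc1 (h5 ▸ inv_mem hc) with h | h
    · exfalso
      have hcc : c * c = 1 := by
        have h6 := D.conj_of_mem hc h
        rw [h6, eq_inv_iff_mul_eq_one] at h5
        exact h5
      have e1 := (D.eq_of_sq h h1).resolve_left h2
      have e2 := (D.eq_of_sq hc hcc).resolve_left hc1
      exact h4 (by rw [e1, e2]; simp)
    · exact h
  · intro h
    have hinv : u⁻¹ = u := by
      have h1 := D.conj_mem h
      rw [mul_assoc, mul_assoc, mul_inv_cancel, mul_one, mul_inv_rev, D.t_inv] at h1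
      exact (mul_left_cancel h1).symm
    have hu : u * u = 1 := by nth_rw 1 [← hinv]; simp
    have hcu := D.conj_of_mul_mem hc h
    refine ⟨⟨hu, ?_⟩, ?_, ?_⟩
    · rintro rfl
      exact D.notMem (by simpa using h)
    · rw [← mul_assoc, mul_assoc (u⁻¹ * c), hinv]
      rw [hinv] at hcu
      rw [← mul_assoc, hcu]; simp
    · intro h'
      have : c = u := by rw [inv_mul_eq_one] at h'; exact h'.symm
      rw [this] at hc
      exact D.not_mem_and hc h

end DihedralTI

section Induced

variable {G k : Type*} [Group G] [Fintype G] [DecidableEq G] [Field k]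

/-- The class function of `G` induced from `1 - λ ^ j`, where `λ` is the linear character of
`⟨a⟩` sending `a` to `ω`. -/
noncomputable def inducedDiff (a : G) (m : ℕ) (ω : k) (j : ℕ) (g : G) : k :=
  (m : k)⁻¹ * ∑ h : G, ∑ l ∈ Finset.range m, if h⁻¹ * g * h = a ^ l then 1 - ω ^ (j * l) else 0

theorem inducedDiff_conj (a : G) (m : ℕ) (ω : k) (j : ℕ) (g x : G) :
    inducedDiff a m ω j (x * g * x⁻¹) = inducedDiff a m ω j g := by
  unfold inducedDiff
  congr 1
  refine Fintype.sum_equiv (Equiv.mulLeft x⁻¹) _ _ fun h => ?_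
  have : h⁻¹ * (x * g * x⁻¹) * h = (x⁻¹ * h)⁻¹ * g * (x⁻¹ * h) := by group
  simp [this]

theorem inducedDiff_map {k' : Type*} [Field k'] (σ : k →+* k') (a : G) (m : ℕ) (ω : k) (j : ℕ)
    (g : G) : σ (inducedDiff a m ω j g) = inducedDiff a m (σ ω) j g := by
  unfold inducedDiff
  rw [map_mul, map_inv₀, map_natCast, map_sum]
  simp_rw [map_sum, apply_ite σ, map_sub, map_one, map_zero, map_pow]

theorem inducedDiff_pow (a : G) (m : ℕ) (ω : k) (s : ℕ) (g : G) :
    inducedDiff a m (ω ^ s) 1 g = inducedDiff a m ω s g := by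
  unfold inducedDiff
  simp_rw [one_mul, ← pow_mul]

theorem sum_mul_inducedDiff (a : G) (m : ℕ) (ω : k) (j : ℕ) {φ : G → k}
    (hφ : ∀ g h, φ (h * g * h⁻¹) = φ g) :
    ∑ g, φ g * inducedDiff a m ω j g =
      Fintype.card G * ((m : k)⁻¹ * ∑ l ∈ Finset.range m, φ (a ^ l) * (1 - ω ^ (j * l))) := by
  unfold inducedDiff
  simp_rw [mul_left_comm (φ _), Finset.mul_sum]
  rw [Finset.sum_comm]
  have : ∀ h : G, ∑ g, ∑ l ∈ Finset.range m, (m : k)⁻¹ * (φ g *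
      if h⁻¹ * g * h = a ^ l then 1 - ω ^ (j * l) else 0) =
      ∑ l ∈ Finset.range m, (m : k)⁻¹ * (φ (a ^ l) * (1 - ω ^ (j * l))) := by
    intro h
    rw [Finset.sum_comm]
    refine Finset.sum_congr rfl fun l _ => ?_
    rw [Finset.sum_eq_single (h * a ^ l * h⁻¹)]
    · rw [hφ, if_pos (by group)]
    · intro b _ hb
      rw [if_neg, mul_zero, mul_zero]
      intro h'
      exact hb (by rw [← h']; group)
    · simp
  rw [Finset.sum_congr rfl fun h _ => this h, Finset.sum_const, Finset.card_univ, nsmul_eq_mul,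
    Finset.mul_sum]

theorem sum_mul_eq_of_coeffs {ι : Type*} [Fintype ι] (a : G) (m : ℕ) (ω : k) (j : ℕ)
    {χ : ι → G → k} {n : ι → ℤ}
    (h : ∀ g, inducedDiff a m ω j g = ∑ i, (n i : k) * χ i g) (φ : G → k) :
    ∑ g, φ g * inducedDiff a m ω j g = ∑ i, (n i : k) * ∑ g, φ g * χ i g := by
  simp_rw [h, Finset.mul_sum]
  rw [Finset.sum_comm]
  exact Finset.sum_congr rfl fun i _ => Finset.sum_congr rfl fun g _ => by ring

namespace DihedralTI

variable {a t : G} {m : ℕ} (D : DihedralTI a t m) {ω : k} (hω : IsPrimitiveRoot ω m)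

include D

theorem inducedDiff_inv (ω : k) (j : ℕ) (g : G) :
    inducedDiff a m ω j g⁻¹ = inducedDiff a m ω j g := by
  unfold inducedDiff
  congr 1
  refine Fintype.sum_equiv (Equiv.mulRight t) _ _ fun h => ?_
  refine Finset.sum_congr rfl fun l _ => ?_
  have : h⁻¹ * g⁻¹ * h = a ^ l ↔ (h * t)⁻¹ * g * (h * t) = a ^ l := by
    have h1 := D.conj_mem (DihedralTI.pow_mem (a := a) l)
    have e1 : h⁻¹ * g⁻¹ * h = (h⁻¹ * g * h)⁻¹ := by group
    have e2 : (h * t)⁻¹ * g * (h * t) = t⁻¹ * (h⁻¹ * g * h) * t := by group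
    rw [e1, e2, inv_eq_iff_eq_inv, ← h1]
    constructor
    · intro h'; rw [h']; group
    · intro h'; rw [← h']; group
  simp [this]

include hω

theorem inducedDiff_apply_pow [CharZero k] {j : ℕ} (hj : j ≤ m) {s : ℕ} (hs : s < m) :
    inducedDiff a m ω j (a ^ s) = 2 - ω ^ (j * s) - ω ^ ((m - j) * s) := by
  classical
  have hm : (m : k) ≠ 0 := Nat.cast_ne_zero.2 D.pos.ne'
  unfold inducedDiff
  rcases Nat.eq_zero_or_pos s with rfl | h0
  · have : ∀ h : G, ∑ l ∈ Finset.range m,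
        (if h⁻¹ * a ^ 0 * h = a ^ l then 1 - ω ^ (j * l) else 0) = 0 := by
      intro h
      refine Finset.sum_eq_zero fun l hl => ?_
      split_ifs with h'
      · rw [pow_zero, mul_one, inv_mul_cancel, eq_comm, D.pow_eq_one_iff] at h'
        have := Nat.eq_zero_of_dvd_of_lt h' (Finset.mem_range.1 hl)
        simp [this]
      · rfl
    rw [Finset.sum_congr rfl fun h _ => this h]
    simp; norm_num
  · rw [D.sum_conj_pow _ h0 hs, inv_mul_cancel_left₀ hm]
    have e : ω ^ (j * (m - s)) = ω ^ ((m - j) * s) := by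
      have h1 : ω ^ (j * (m - s)) * ω ^ (j * s) = 1 := by
        rw [← pow_add, ← mul_add, Nat.sub_add_cancel hs.le, mul_comm, pow_mul, hω.pow_eq_one,
          one_pow]
      have h2 : ω ^ ((m - j) * s) * ω ^ (j * s) = 1 := by
        rw [← pow_add, ← add_mul, Nat.sub_add_cancel hj, pow_mul, hω.pow_eq_one,
          one_pow]
      exact mul_right_cancel₀ (pow_ne_zero _ (hω.ne_zero D.pos.ne')) (h1.trans h2.symm)
    rw [e]; ring

theorem inducedDiff_one [CharZero k] {j : ℕ} (hj : j ≤ m) : inducedDiff a m ω j 1 = 0 := by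
  rw [← pow_zero a, D.inducedDiff_apply_pow hω hj D.pos]; norm_num

theorem sum_inducedDiff_mul [CharZero k] {i j : ℕ} (hi0 : 0 < i) (hi : i < m) (hj0 : 0 < j)
    (hj : j < m) :
    ∑ g, inducedDiff a m ω i g * inducedDiff a m ω j g =
      Fintype.card G * (2 + (if i = j then 1 else 0) + (if i + j = m then 1 else 0)) := by
  have hm : (m : k) ≠ 0 := Nat.cast_ne_zero.2 D.pos.ne'
  rw [sum_mul_inducedDiff a m ω j (inducedDiff_conj a m ω i)]
  congr 1
  rw [inv_mul_eq_iff_eq_mul₀ hm]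
  have h1 : ∀ l ∈ Finset.range m, inducedDiff a m ω i (a ^ l) * (1 - ω ^ (j * l)) =
      2 - 2 * ω ^ (j * l) - ω ^ (i * l) - ω ^ ((m - i) * l) + ω ^ ((i + j) * l) +
        ω ^ ((m - i + j) * l) := by
    intro l hl
    rw [D.inducedDiff_apply_pow hω hi.le (Finset.mem_range.1 hl), add_mul, add_mul, pow_add,
      pow_add]
    ring
  have hnd : ∀ x, 0 < x → x < m → ¬ m ∣ x := fun x h0 h1 h => by
    have := Nat.le_of_dvd h0 h; omega
  have h3 : m ∣ i + j ↔ i + j = m := by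
    constructor
    · rintro ⟨q, hq⟩
      have : q < 2 := by
        by_contra hh
        have : m * 2 ≤ m * q := Nat.mul_le_mul_left _ (by omega)
        omega
      interval_cases q <;> omega
    · rintro h; rw [h]
  have h4 : m ∣ m - i + j ↔ i = j := by
    constructor
    · rintro ⟨q, hq⟩
      have : q < 2 := by
        by_contra hh
        have : m * 2 ≤ m * q := Nat.mul_le_mul_left _ (by omega)
        omega
      interval_cases q <;> omega
    · rintro rfl; rw [Nat.sub_add_cancel hi.le]
  rw [Finset.sum_congr rfl h1]
  simp only [Finset.sum_add_distrib, Finset.sum_sub_distrib, ← Finset.mul_sum,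
    hω.sum_range_pow_mul, h3, h4, hnd j hj0 hj, hnd i hi0 hi, hnd (m - i) (by omega) (by omega)]
  simp
  split_ifs <;> ring

/-- The coefficients of the induced class functions with respect to the irreducible characters. -/
theorem exists_coeffs [CharZero k] [IsAlgClosed k] (I : IrreducibleReps G k) :
    ∃ μ : Fin I.n → ℕ → ℕ,
      (∀ i l, I.χ i (a ^ l) = ∑ j ∈ Finset.range m, μ i j * (ω⁻¹) ^ (j * l)) ∧
      (∀ i j, ∑ g, I.χ i g * inducedDiff a m ω j g =
        Fintype.card G * ((μ i 0 : ℤ) - (μ i j : ℤ) : ℤ)) ∧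
      ∀ j g, inducedDiff a m ω j g = ∑ i, (((μ i 0 : ℤ) - (μ i j : ℤ) : ℤ) : k) * I.χ i g := by
  have hm : (m : k) ≠ 0 := Nat.cast_ne_zero.2 D.pos.ne'
  have hG : (Fintype.card G : k) ≠ 0 := Nat.cast_ne_zero.2 Fintype.card_ne_zero
  have h : ∀ i, ∃ μ : ℕ → ℕ,
      (∀ j, ∑ l ∈ Finset.range m, ω ^ (j * l) * (I.rep i a ^ l).trace = m * (μ j : k)) ∧
      ∀ l, (I.rep i a ^ l).trace = ∑ j ∈ Finset.range m, μ j * (ω⁻¹) ^ (j * l) :=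
    fun i => Matrix.exists_multiplicities D.pos (by rw [← map_pow, D.pow_m, map_one]) hω
  choose μ h1 h2 using h
  have h3 : ∀ i j, ∑ g, I.χ i g * inducedDiff a m ω j g =
        Fintype.card G * ((μ i 0 : ℤ) - (μ i j : ℤ) : ℤ) := by
    intro i j
    rw [sum_mul_inducedDiff a m ω j (fun g h => I.χ_conj i g h)]
    congr 1
    rw [inv_mul_eq_iff_eq_mul₀ hm]
    push_cast
    rw [mul_sub, ← h1, ← h1, ← Finset.sum_sub_distrib]
    refine Finset.sum_congr rfl fun l _ => ?_
    rw [IrreducibleReps.χ, map_pow]; simp; ring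
  refine ⟨μ, fun i l => by rw [← h2, IrreducibleReps.χ, map_pow], h3, fun j g => ?_⟩
  apply mul_left_cancel₀ hG
  rw [I.complete (inducedDiff_conj a m ω j), Finset.mul_sum]
  refine Finset.sum_congr rfl fun i _ => ?_
  rw [← mul_assoc, ← h3]
  congr 1
  refine Finset.sum_congr rfl fun x _ => ?_
  rw [D.inducedDiff_inv]; ring

end DihedralTI

end Induced

namespace IrreducibleReps

variable {G k : Type*} [Group G] [Fintype G] [Field k] [CharZero k] (I : IrreducibleReps G k)

/-- A character of norm one is irreducible. -/
theorem exists_eq_of_norm_one {ι : Type*} [Fintype ι] [DecidableEq ι] (R : G →* Matrix ι ι k)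
    (hR : ∑ g, (R g⁻¹).trace * (R g).trace = Fintype.card G) :
    ∃ i, ∀ g, (R g).trace = I.χ i g := by
  have hG : (Fintype.card G : k) ≠ 0 := Nat.cast_ne_zero.2 Fintype.card_ne_zero
  choose c hc using I.decomp R
  have hclass : ∀ g h, (R (h * g * h⁻¹)).trace = (R g).trace := by
    intro g h
    rw [map_mul, Matrix.trace_mul_comm, ← map_mul]
    simp
  have h1 : ∀ g, (R g).trace = ∑ i, (c i : k) * I.χ i g := by
    intro g
    apply mul_left_cancel₀ hG
    rw [I.complete (φ := fun g => (R g).trace) hclass, Finset.mul_sum]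
    exact Finset.sum_congr rfl fun i _ => by rw [hc, mul_assoc]
  have h2 : ∑ i, c i ^ 2 = 1 := by
    have : (Fintype.card G : k) * ∑ i, (c i : k) ^ 2 = Fintype.card G * 1 := by
      have e : ∀ i, (Fintype.card G : k) * (c i : k) ^ 2 =
          ∑ g, (R g⁻¹).trace * (c i * I.χ i g) := by
        intro i
        rw [sq, ← mul_assoc, ← hc, Finset.sum_mul]
        exact Finset.sum_congr rfl fun g _ => by ring
      rw [mul_one, Finset.mul_sum, Finset.sum_congr rfl fun i _ => e i, Finset.sum_comm]
      refine Eq.trans (Finset.sum_congr rfl fun g _ => ?_) hR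
      rw [← Finset.mul_sum, ← h1]
    have := mul_left_cancel₀ hG this
    exact_mod_cast this
  obtain ⟨i, hi⟩ : ∃ i, c i ≠ 0 := by
    by_contra! h
    simp [h] at h2
  have h3 := Finset.add_sum_erase Finset.univ (fun i => c i ^ 2) (Finset.mem_univ i)
  simp only [h2] at h3
  have h4 : 0 < c i ^ 2 := by positivity
  have h5 : ∑ j ∈ Finset.univ.erase i, c j ^ 2 = 0 := by omega
  have h6 : c i = 1 := by
    have : c i ^ 2 = 1 := by omega
    simpa using this
  refine ⟨i, fun g => ?_⟩
  rw [h1, Finset.sum_eq_single i, h6, Nat.cast_one, one_mul]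
  · intro j _ hj
    have := Finset.sum_eq_zero_iff.1 h5 j (by simp [hj])
    rw [pow_eq_zero_iff two_ne_zero] at this
    simp [this]
  · simp

theorem exists_trivial : ∃ i, ∀ g, I.χ i g = 1 := by
  obtain ⟨i, hi⟩ := I.exists_eq_of_norm_one (ι := Unit) (1 : G →* Matrix Unit Unit k)
    (by simp)
  exact ⟨i, fun g => by rw [← hi]; simp⟩

end IrreducibleReps

namespace DihedralTI

variable {G k : Type*} [Group G] [Fintype G] [DecidableEq G] [Field k] [CharZero k]
  [IsAlgClosed k] {a t : G} {m : ℕ} {ω : k}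

/-- The family of induced class functions is coherent. -/
theorem exists_coherent (D : DihedralTI a t m) (hω : IsPrimitiveRoot ω m)
    (I : IrreducibleReps G k) :
    ∃ (δ : ℤ) (P X i₀ : Fin I.n) (r : ℕ), (δ = 1 ∨ δ = -1) ∧ P ≠ i₀ ∧ P ≠ X ∧
      (∀ g, I.χ i₀ g = 1) ∧ ((I.d P : ℤ) = r * m + δ) ∧ ((I.d X : ℤ) = r * m + 2 * δ) ∧
      (∀ l, ¬ m ∣ l → I.χ P (a ^ l) = δ) ∧
      (∀ g, inducedDiff a m ω 1 g = 1 + δ * (I.χ P g - I.χ X g)) ∧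
      (∀ s i j, 0 < s → s < m →
        (∀ g, inducedDiff a m ω s g = 1 + δ * (I.χ i g - I.χ j g)) → i = P) := by
  obtain ⟨μ, hμ, h1, h2⟩ := D.exists_coeffs hω I
  obtain ⟨i₀, hi₀⟩ := I.exists_trivial
  have hG : (Fintype.card G : k) ≠ 0 := Nat.cast_ne_zero.2 Fintype.card_ne_zero
  have hm : (m : k) ≠ 0 := Nat.cast_ne_zero.2 D.pos.ne'
  have hm8 : 8 ≤ m := Nat.le_of_dvd D.pos D.eight_dvd
  set n : ℕ → Fin I.n → ℤ := fun j i => (μ i 0 : ℤ) - (μ i j : ℤ) with hn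
  have hinner : ∀ i j, 0 < i → i < m → 0 < j → j < m → ∑ x, n i x * n j x =
      2 + (if i = j then 1 else 0) + (if i + j = m then 1 else 0) := by
    intro i j hi0 hi hj0 hj
    have e1 := D.sum_inducedDiff_mul hω hi0 hi hj0 hj
    rw [sum_mul_eq_of_coeffs a m ω j (h2 j)] at e1
    have e2 : ∀ x, ∑ g, inducedDiff a m ω i g * I.χ x g = Fintype.card G * (n i x : k) := by
      intro x
      rw [← h1]; exact Finset.sum_congr rfl fun g _ => mul_comm _ _
    simp_rw [e2, mul_left_comm _ (Fintype.card G : k)] at e1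
    rw [← Finset.mul_sum] at e1
    have e3 := mul_left_cancel₀ hG e1
    have e4 : ((∑ x, n i x * n j x : ℤ) : k) =
        ((2 + (if i = j then 1 else 0) + (if i + j = m then 1 else 0) : ℤ) : k) := by
      push_cast
      rw [← e3]
      exact Finset.sum_congr rfl fun x _ => mul_comm _ _
    exact_mod_cast e4
  have hn0 : ∀ j, 0 < j → j < m → n j i₀ = 1 := by
    intro j hj0 hj
    have e1 := h1 i₀ j
    rw [sum_mul_inducedDiff a m ω j (fun g h => I.χ_conj i₀ g h)] at e1
    have e2 := mul_left_cancel₀ hG e1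
    simp_rw [hi₀, one_mul, Finset.sum_sub_distrib, hω.sum_range_pow_mul] at e2
    rw [if_neg (fun h => by have := Nat.le_of_dvd hj0 h; omega)] at e2
    simp [hm] at e2
    have e3 : ((1 : ℤ) : k) = ((n j i₀ : ℤ) : k) := by simp [hn, ← e2]
    exact_mod_cast e3.symm
  have hdeg : ∀ j, j < m → ∑ x, n j x * (I.d x : ℤ) = 0 := by
    intro j hj
    have e1 := h2 j 1
    rw [D.inducedDiff_one hω hj.le] at e1
    simp_rw [I.χ_one] at e1
    have e2 : ((∑ x, n j x * (I.d x : ℤ) : ℤ) : k) = ((0 : ℤ) : k) := by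
      push_cast; rw [e1]
    exact_mod_cast e2
  have hd0 : I.d i₀ = 1 := by
    have := hi₀ 1
    rw [I.χ_one] at this
    exact_mod_cast this
  set u : ℕ → Fin I.n → ℤ := fun j => n j - Pi.single i₀ 1 with hu
  have huinner : ∀ i j, 0 < i → i < m → 0 < j → j < m → ∑ x, u i x * u j x =
      1 + (if i = j then 1 else 0) + (if i + j = m then 1 else 0) := by
    intro i j hi0 hi hj0 hj
    have e1 := hinner i j hi0 hi hj0 hj
    simp only [hu, Pi.sub_apply, sub_mul, mul_sub, Finset.sum_sub_distrib, e1]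
    simp [Pi.single_apply, hn0 i hi0 hi, hn0 j hj0 hj]
    ring
  have hudeg : ∀ j, j < m → ∑ x, u j x * (I.d x : ℤ) = -1 := by
    intro j hj
    simp only [hu, Pi.sub_apply, sub_mul, Finset.sum_sub_distrib, hdeg j hj]
    simp [Pi.single_apply, hd0]
  obtain ⟨δ, P, X, hδ, hX, hXP, hs⟩ := exists_sunflower (d := fun i => (I.d i : ℤ))
    (fun i => by exact_mod_cast I.pos i) (u := fun b : Fin 3 => u (b + 1))
    (fun b => by
      simp only [pow_two]
      rw [huinner _ _ (by omega) (by omega) (by omega) (by omega), if_pos rfl,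
        if_neg (by omega)]; norm_num)
    (fun b => hudeg _ (by omega))
    (fun b c hbc => by
      rw [huinner _ _ (by omega) (by omega) (by omega) (by omega), if_neg (by omega),
        if_neg (by omega)]; norm_num)
  have hδ2 : δ * δ = 1 := by rcases hδ with rfl | rfl <;> norm_num
  have hdX : ∀ b, (I.d (X b) : ℤ) = I.d P + δ := by
    intro b
    have e1 := hudeg (b + 1) (by omega)
    rw [show u (b + 1) = _ from hs b] at e1
    simp only [Pi.smul_apply, smul_eq_mul, mul_assoc] at e1
    rw [← Finset.mul_sum, sum_single_sub_single_mul] at e1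
    rcases hδ with rfl | rfl <;> linarith
  have huP3 : ∀ b : Fin 3, u (b + 1) P = δ := by
    intro b
    rw [show u (b + 1) = _ from hs b]
    simp [Pi.single_eq_of_ne (hXP b).symm]
  have huP : ∀ j, 0 < j → j < m → u j P = δ := by
    intro j hj0 hj
    by_cases hj3 : j ≤ 3
    · have := huP3 ⟨j - 1, by omega⟩
      simpa [Nat.sub_add_cancel hj0] using this
    by_cases hj4 : m - j ≤ 3
    · have e1 : n j = n (m - j) := by
        have e2 : ∑ x, (n j x - n (m - j) x) ^ 2 = 0 := by
          have e3 := hinner j j hj0 hj hj0 hj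
          have e4 := hinner (m - j) (m - j) (by omega) (by omega) (by omega) (by omega)
          have e5 := hinner j (m - j) (by omega) (by omega) (by omega) (by omega)
          rw [if_pos rfl, if_neg (by omega)] at e3 e4
          rw [if_neg (by omega), if_pos (by omega)] at e5
          have : ∀ x, (n j x - n (m - j) x) ^ 2 = n j x * n j x - 2 * (n j x * n (m - j) x) +
            n (m - j) x * n (m - j) x := fun x => by ring
          simp_rw [this]
          rw [Finset.sum_add_distrib, Finset.sum_sub_distrib, ← Finset.mul_sum, e3, e4, e5]
          norm_num
        rw [Finset.sum_eq_zero_iff_of_nonneg (fun i _ => sq_nonneg _)] at e2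
        funext x
        have := e2 x (Finset.mem_univ x)
        rw [pow_eq_zero_iff two_ne_zero] at this
        linarith
      have := huP3 ⟨m - j - 1, by omega⟩
      simp only [Nat.sub_add_cancel (show 1 ≤ m - j by omega)] at this
      rw [← this]
      simp only [hu, e1]
    · refine eq_of_inner_sunflower (d := fun i => (I.d i : ℤ)) hδ hX hXP
        (fun b => by rw [hdX, hdX]) ?_ (hudeg j hj) ?_
      · simp only [pow_two]
        rw [huinner _ _ hj0 hj hj0 hj, if_pos rfl]
        split_ifs <;> norm_num
      · intro b
        rw [← hs b, huinner _ _ (by omega) (by omega) hj0 hj, if_neg (by omega),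
          if_neg (by omega)]; norm_num
  have hPi₀ : P ≠ i₀ := by
    rintro rfl
    have := huP 1 (by omega) (by omega)
    simp only [hu, Pi.sub_apply, hn0 1 (by omega) (by omega), Pi.single_eq_same] at this
    rcases hδ with rfl | rfl <;> omega
  have hμP : ∀ j, 0 < j → j < m → (μ P 0 : ℤ) - μ P j = δ := by
    intro j hj0 hj
    have := huP j hj0 hj
    simpa [hu, hn, Pi.single_eq_of_ne hPi₀] using this
  have hval : ∀ l, I.χ P (a ^ l) = δ + if m ∣ l then ((μ P 1 * m : ℕ) : k) else 0 := by
    intro l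
    rw [hμ]
    have e0 : ∀ j ∈ Finset.range m, (μ P j : k) * ω⁻¹ ^ (j * l) =
        μ P 1 * ω⁻¹ ^ (l * j) + if j = 0 then (δ : k) else 0 := by
      intro j hj
      split_ifs with h0
      · subst h0
        have e1 := hμP 1 (by omega) (by omega)
        have : ((μ P 0 : ℤ) : k) = ((μ P 1 + δ : ℤ) : k) := by rw [← e1]; push_cast; ring
        push_cast at this
        simp [this]
      · have e1 := hμP 1 (by omega) (by omega)
        have e2 := hμP j (by omega) (Finset.mem_range.1 hj)
        have e3 : μ P j = μ P 1 := by omega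
        rw [e3, add_zero, mul_comm j l]
    rw [Finset.sum_congr rfl e0, Finset.sum_add_distrib, ← Finset.mul_sum,
      hω.inv.sum_range_pow_mul]
    have : (0 : ℕ) ∈ Finset.range m := Finset.mem_range.2 D.pos
    simp [D.pos]
    ring
  have hdP : (I.d P : ℤ) = μ P 1 * m + δ := by
    have := hval 0
    rw [pow_zero, I.χ_one, if_pos (dvd_zero m)] at this
    have : ((I.d P : ℤ) : k) = ((μ P 1 * m + δ : ℤ) : k) := by push_cast at this ⊢; rw [this]; ring
    exact_mod_cast this
  refine ⟨δ, P, X 0, i₀, μ P 1, hδ, hPi₀, (hXP 0).symm, hi₀, hdP,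
    by rw [hdX, hdP]; ring, fun l hl => by rw [hval, if_neg hl, add_zero], ?_, ?_⟩
  · intro g
    rw [h2]
    have e1 : ∀ x, ((n 1 x : ℤ) : k) = (if x = i₀ then 1 else 0) +
        δ * ((if x = P then 1 else 0) - (if x = X 0 then 1 else 0)) := by
      intro x
      have e2 := congrFun (show u ((0 : Fin 3) + 1) = _ from hs 0) x
      have e3 : n 1 x = (if x = i₀ then 1 else 0) +
        δ * ((if x = P then 1 else 0) - (if x = X 0 then 1 else 0)) := by
        simp [hu, Pi.single_apply] at e2
        linarith
      rw [e3]; push_cast; rfl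
    simp_rw [show ∀ x, (((μ x 0 : ℤ) - (μ x 1 : ℤ) : ℤ) : k) = _ from e1, add_mul, mul_assoc, sub_mul, mul_sub, ite_mul]
    rw [Finset.sum_add_distrib]
    simp [hi₀, Finset.sum_sub_distrib, mul_sub]
  · intro s i j hs0 hs h
    have e1 := huP s hs0 hs
    have e2 : n s P = δ := by simpa [hu, Pi.single_eq_of_ne hPi₀] using e1
    have e3 : ∑ g, I.χ P g⁻¹ * inducedDiff a m ω s g = Fintype.card G * (δ : k) := by
      rw [← e2, ← h1]
      exact Fintype.sum_equiv (Equiv.inv G) _ _ fun g => by simp [D.inducedDiff_inv]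
    have e4 : ∀ g, I.χ P g⁻¹ * inducedDiff a m ω s g = I.χ P g⁻¹ * I.χ i₀ g +
        δ * (I.χ P g⁻¹ * I.χ i g - I.χ P g⁻¹ * I.χ j g) := by
      intro g; rw [h, hi₀]; ring
    rw [Finset.sum_congr rfl fun g _ => e4 g, Finset.sum_add_distrib, ← Finset.mul_sum,
      Finset.sum_sub_distrib, I.orth, I.orth, I.orth, if_neg hPi₀] at e3
    by_contra hne
    rw [if_neg (Ne.symm hne)] at e3
    have e5 : (δ : k) ≠ 0 := by
      rcases hδ with rfl | rfl <;> simp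
    have e6 : (Fintype.card G : k) * (δ * (1 + if P = j then 1 else 0)) = Fintype.card G * 0 := by
      split_ifs at e3 ⊢ <;> linear_combination -e3
    have e7 := (mul_eq_zero.1 (mul_left_cancel₀ hG e6)).resolve_left e5
    split_ifs at e7 <;> norm_num at e7

end DihedralTI

namespace DihedralTI

variable {G k : Type*} [Group G] [Fintype G] [DecidableEq G] [Field k] [CharZero k]
  [IsAlgClosed k] {a t : G} {m : ℕ} {ω : k}

theorem order_identity (D : DihedralTI a t m) (hω : IsPrimitiveRoot ω m)
    (I : IrreducibleReps G k) {δ : ℤ} {P X i₀ : Fin I.n} {r : ℕ} (hδ : δ = 1 ∨ δ = -1)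
    (hi₀ : ∀ g, I.χ i₀ g = 1) (hdP : (I.d P : ℤ) = r * m + δ)
    (hdX : (I.d X : ℤ) = r * m + 2 * δ)
    (hP : ∀ l, ¬ m ∣ l → I.χ P (a ^ l) = δ)
    (hα : ∀ g, inducedDiff a m ω 1 g = 1 + δ * (I.χ P g - I.χ X g)) :
    2 * (r * m + δ) * (r * m + 2 * δ) =
      ((Finset.univ.filter fun u : G => u * u = 1 ∧ u ≠ 1).card : ℤ) * r ^ 2 := by
  classical
  set K := (Finset.univ.filter fun u : G => u * u = 1 ∧ u ≠ 1).card with hK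
  have hKG : 2 * m * K = Fintype.card G := D.card_involutions
  have hG : (Fintype.card G : k) ≠ 0 := Nat.cast_ne_zero.2 Fintype.card_ne_zero
  have hm : (m : k) ≠ 0 := Nat.cast_ne_zero.2 D.pos.ne'
  have hm8 : 8 ≤ m := Nat.le_of_dvd D.pos D.eight_dvd
  let φ : G → k := fun u => if u * u = 1 ∧ u ≠ 1 then 1 else 0
  have hinv : ∀ g h : G, (h * g * h⁻¹ * (h * g * h⁻¹) = 1 ∧ h * g * h⁻¹ ≠ 1) ↔
      (g * g = 1 ∧ g ≠ 1) := by
    intro g h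
    have : h * g * h⁻¹ * (h * g * h⁻¹) = h * (g * g) * h⁻¹ := by group
    rw [this, conj_eq_one_iff, Ne, Ne, conj_eq_one_iff]
  have hφ : ∀ g h, φ (h * g * h⁻¹) = φ g := by
    intro g h
    simp only [φ, hinv]
  have hz : ∀ i, ∑ g, φ g * I.χ i g = K * I.χ i (a ^ (m / 2)) := by
    intro i
    simp only [φ, ite_mul, one_mul, zero_mul]
    rw [← Finset.sum_filter, hK, ← nsmul_eq_mul, ← Finset.sum_const]
    refine Finset.sum_congr rfl fun u hu => ?_
    simp only [Finset.mem_filter, Finset.mem_univ, true_and] at hu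
    obtain ⟨g, rfl⟩ := D.involution u hu.1 hu.2
    rw [I.χ_conj]
  let N : G → k := fun y => ∑ g, φ g * φ (g⁻¹ * y)
  have hN : ∀ g h, N (h * g * h⁻¹) = N g := by
    intro g h
    refine Fintype.sum_equiv (MulAut.conj h⁻¹).toEquiv _ _ fun x => ?_
    have e1 : φ ((MulAut.conj h⁻¹).toEquiv x) = φ x := by
      simp only [MulEquiv.toEquiv_eq_coe, MulEquiv.coe_toEquiv, MulAut.conj_apply, hφ]
    have e2 : φ (((MulAut.conj h⁻¹).toEquiv x)⁻¹ * g) = φ (x⁻¹ * (h * g * h⁻¹)) := by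
      rw [← hφ (((MulAut.conj h⁻¹).toEquiv x)⁻¹ * g) h]
      congr 1
      simp only [MulEquiv.toEquiv_eq_coe, MulEquiv.coe_toEquiv, MulAut.conj_apply]
      group
    rw [e1, e2]
  have hNsum : ∀ i, ∑ y, N y * I.χ i y = ∑ g, ∑ h, φ g * φ h * I.χ i (g * h) := by
    intro i
    simp only [N, Finset.sum_mul]
    rw [Finset.sum_comm]
    refine Finset.sum_congr rfl fun g _ => ?_
    refine Fintype.sum_equiv (Equiv.mulLeft g⁻¹) _ _ fun y => ?_
    simp
  have hcent : ∀ i, (I.d i : k) * ∑ y, N y * I.χ i y = (K * I.χ i (a ^ (m / 2))) ^ 2 := by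
    intro i
    rw [hNsum, I.central i hφ, hz]
  have hNa : ∀ l ∈ Finset.range m, N (a ^ l) * (1 - ω ^ (1 * l)) = m * (1 - ω ^ (1 * l)) := by
    intro l hl
    rcases Nat.eq_zero_or_pos l with rfl | hl0
    · simp
    · congr 1
      have hne : a ^ l ≠ 1 := by
        rw [Ne, D.pow_eq_one_iff]
        intro h
        have := Nat.le_of_dvd hl0 h
        have := Finset.mem_range.1 hl
        omega
      rw [← D.card_involution_pairs (DihedralTI.pow_mem l) hne, Finset.card_filter]
      push_cast
      refine Finset.sum_congr rfl fun u _ => ?_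
      simp only [φ, ite_and]
      split_ifs <;> simp_all
  have h1 := sum_mul_inducedDiff a m ω 1 hN
  rw [Finset.sum_congr rfl hNa, ← Finset.mul_sum, inv_mul_cancel_left₀ hm, Finset.sum_sub_distrib,
    hω.sum_range_pow_mul, if_neg (fun h => by have := Nat.le_of_dvd one_pos h; omega)] at h1
  simp only [Finset.sum_const, Finset.card_range, nsmul_eq_mul, mul_one, sub_zero] at h1
  have h2 : ∀ g, N g * inducedDiff a m ω 1 g = N g * I.χ i₀ g + δ * (N g * I.χ P g - N g * I.χ X g) := by
    intro g; rw [hα, hi₀]; ring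
  rw [Finset.sum_congr rfl fun g _ => h2 g, Finset.sum_add_distrib, ← Finset.mul_sum,
    Finset.sum_sub_distrib] at h1
  have hd0 : (I.d i₀ : k) = 1 := by rw [← I.χ_one, hi₀]
  have c0 := hcent i₀
  have cP := hcent P
  have cX := hcent X
  have hzm : ¬ m ∣ m / 2 := by rw [← D.pow_eq_one_iff]; exact D.z_ne
  have hωz : ω ^ (m / 2) = -1 := by
    have e1 : ω ^ (m / 2) * ω ^ (m / 2) = 1 := by
      rw [← pow_add, show m / 2 + m / 2 = m by have := D.eight_dvd; omega, hω.pow_eq_one]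
    rcases mul_self_eq_one_iff.1 e1 with h | h
    · exact absurd ((hω.pow_eq_one_iff_dvd _).1 h) hzm
    · exact h
  have hXz : I.χ X (a ^ (m / 2)) = -2 * δ := by
    have e1 := hα (a ^ (m / 2))
    rw [D.inducedDiff_apply_pow hω (by omega) (by omega), hP _ hzm, one_mul, hωz, mul_comm,
      pow_mul, hωz, Odd.neg_one_pow (by have := D.eight_dvd; rw [Nat.odd_iff]; omega)] at e1
    have e2 : (δ : k) * δ = 1 := by
      rcases hδ with rfl | rfl <;> simp
    linear_combination (δ : k) * e1 + ((δ : k) - I.χ X (a ^ (m / 2))) * e2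
  rw [hi₀, hd0, one_mul] at c0
  rw [hP _ hzm] at cP
  rw [hXz] at cX
  have hdP' : (I.d P : k) = r * m + δ := by exact_mod_cast congrArg (Int.cast (R := k)) hdP
  have hdX' : (I.d X : k) = r * m + 2 * δ := by exact_mod_cast congrArg (Int.cast (R := k)) hdX
  rw [hdP'] at cP
  rw [hdX'] at cX
  have hKG' : (Fintype.card G : k) = 2 * m * K := by rw [← hKG]; push_cast; ring
  have hK0 : (K : k) ≠ 0 := by
    intro h; rw [h, mul_zero] at hKG'; exact hG hKG'
  rw [hKG', c0] at h1
  have hgoal : (2 * (r * m + δ) * (r * m + 2 * δ) : k) = K * r ^ 2 := by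
    apply mul_left_cancel₀ (mul_ne_zero (mul_ne_zero hm hm) hK0)
    generalize (∑ y, N y * I.χ P y) = SP at *
    generalize (∑ y, N y * I.χ X y) = SX at *
    rcases hδ with rfl | rfl
    · push_cast at *
      linear_combination (-(r * m + 1) * (r * m + 2) : k) * h1 + (r * m + 2 : k) * cP -
        (r * m + 1 : k) * cX
    · push_cast at *
      linear_combination (-(r * m - 1) * (r * m - 2) : k) * h1 - (r * m - 2 : k) * cP +
        (r * m - 1 : k) * cX
  have : ((2 * (r * m + δ) * (r * m + 2 * δ) : ℤ) : k) = ((K * r ^ 2 : ℤ) : k) := by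
    push_cast; exact hgoal
  exact_mod_cast this

theorem order_eq {m r K : ℕ} {δ : ℤ} (hδ : δ = 1 ∨ δ = -1) (hK : Odd K)
    (h : 2 * (r * m + δ) * (r * m + 2 * δ) = (K : ℤ) * r ^ 2) :
    r = 2 ∧ (K : ℤ) = (2 * m + δ) * (m + δ) := by
  have hr : Even r := by
    by_contra hr
    rw [Nat.not_even_iff_odd] at hr
    have h1 : Odd ((K : ℤ) * r ^ 2) := by exact_mod_cast hK.mul hr.pow
    rw [← h, mul_assoc] at h1
    exact (Int.not_odd_iff_even.2 (even_two_mul _)) h1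
  obtain ⟨s, rfl⟩ := hr
  have h1 : (2 * s * m + δ) * (s * m + δ) = (K : ℤ) * s ^ 2 := by
    push_cast at h
    linarith
  have hs : (s : ℤ) ∣ 1 := by
    refine ⟨K * s - 2 * s * m * m - 3 * m * δ, ?_⟩
    rcases hδ with rfl | rfl <;> linarith
  have hs1 : s = 1 := by exact_mod_cast Int.eq_one_of_dvd_one (by positivity) hs
  subst hs1
  refine ⟨rfl, ?_⟩
  push_cast at h1
  linarith

end DihedralTI

namespace DihedralTI

/-- The integral character of degree `2 * m ± 1` of a simple group with dihedral Sylow subgroups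
of order `2 * m` which are centralizers of involutions. -/
theorem exists_character_of_field {G : Type*} [Group G] [Fintype G] (k : Type*) [Field k] [CharZero k]
    [IsAlgClosed k] [Algebra.IsAlgebraic ℚ k] {a t : G} {m g₀ : ℕ}
    (D : DihedralTI a t m) (hcard : Fintype.card G = 2 * m * g₀) (hg₀ : Odd g₀) :
    ∃ δ : ℤ, (δ = 1 ∨ δ = -1) ∧ (Fintype.card G : ℤ) = 2 * m * ((2 * m + δ) * (m + δ)) ∧
      ∃ v : G → ℤ, (∀ g h, v (h * g * h⁻¹) = v g) ∧ v 1 = 2 * m + δ ∧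
        (∀ l, ¬ m ∣ l → v (a ^ l) = δ) ∧ ∑ g, v g = 0 ∧ ∑ g, v g ^ 2 = Fintype.card G ∧
        ∀ s : ℕ, s.Prime → ∀ g, (s : ℤ) ∣ v g - v (g ^ s) := by
  classical
  have : NeZero m := ⟨D.pos.ne'⟩
  have : NeZero (m : k) := ⟨Nat.cast_ne_zero.2 D.pos.ne'⟩
  obtain ⟨ω, hω⟩ := (inferInstance : HasEnoughRootsOfUnity k m).prim
  obtain ⟨I⟩ := nonempty_irreducibleReps G k
  obtain ⟨δ, P, X, i₀, r, hδ, hPi₀, hPX, hi₀, hdP, hdX, hP, hα, huniq⟩ := D.exists_coherent hω I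
  have hKG := D.card_involutions
  have hm8 : 8 ≤ m := Nat.le_of_dvd D.pos D.eight_dvd
  have hK := D.order_identity hω I hδ hi₀ hdP hdX hP hα
  rw [hcard] at hKG
  rw [mul_left_cancel₀ (by omega) hKG] at hK
  obtain ⟨rfl, hg⟩ := order_eq hδ hg₀ hK
  have hsum1 : ∀ i, ∑ g, I.χ i g⁻¹ * I.χ i g = Fintype.card G := fun i => by
    rw [I.orth, if_pos rfl]
  have hpow : ∀ (i : Fin I.n) (g : G), I.rep i g ^ orderOf g = 1 := fun i g => by
    rw [← map_pow, pow_orderOf_eq_one, map_one]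
  -- rationality
  have hgal : ∀ σ : k ≃ₐ[ℚ] k, ∀ g, σ (I.χ P g) = I.χ P g := by
    intro σ
    have hrep : ∀ i, ∃ j, ∀ g, σ (I.χ i g) = I.χ j g := by
      intro i
      let R : G →* Matrix (Fin (I.d i)) (Fin (I.d i)) k :=
        (σ.toAlgHom.toRingHom.mapMatrix : _ →+* _).toMonoidHom.comp (I.rep i)
      have hR : ∀ g, (R g).trace = σ (I.χ i g) := by
        intro g
        simp [R, IrreducibleReps.χ, Matrix.trace]
      obtain ⟨j, hj⟩ := I.exists_eq_of_norm_one R (by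
        rw [← map_natCast σ, ← hsum1 i, map_sum]
        exact Finset.sum_congr rfl fun g _ => by rw [hR, hR, map_mul])
      exact ⟨j, fun g => by rw [← hR, hj]⟩
    obtain ⟨i, hi⟩ := hrep P
    obtain ⟨j, hj⟩ := hrep X
    obtain ⟨s, hs, hsω⟩ := hω.eq_pow_of_pow_eq_one (ξ := σ ω)
      (by rw [← map_pow, hω.pow_eq_one, map_one])
    have hs0 : 0 < s := by
      by_contra h
      have : s = 0 := by omega
      rw [this, pow_zero, eq_comm, map_eq_one_iff σ σ.injective] at hsω
      exact hω.ne_one (by omega) hsω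
    have := huniq s i j hs0 hs (fun g => by
      rw [← hi, ← hj, ← inducedDiff_pow, hsω]
      have e1 := inducedDiff_map (σ : k →+* k) a m ω 1 g
      rw [hα] at e1
      simpa [map_intCast] using e1.symm)
    intro g
    rw [hi, this]
  have hdual : ∀ g, I.χ P g⁻¹ = I.χ P g := by
    have hrep : ∀ i, ∃ j, ∀ g, I.χ i g⁻¹ = I.χ j g := by
      intro i
      let R : G →* Matrix (Fin (I.d i)) (Fin (I.d i)) k :=
        { toFun := fun g => (I.rep i g⁻¹).transpose
          map_one' := by simp
          map_mul' := fun g h => by simp [Matrix.transpose_mul] }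
      have hR : ∀ g, (R g).trace = I.χ i g⁻¹ := by
        intro g
        simp [R, IrreducibleReps.χ, Matrix.trace_transpose]
      obtain ⟨j, hj⟩ := I.exists_eq_of_norm_one R (by
        simp_rw [hR, inv_inv, ← hsum1 i, mul_comm])
      exact ⟨j, fun g => by rw [← hR, hj]⟩
    obtain ⟨i, hi⟩ := hrep P
    obtain ⟨j, hj⟩ := hrep X
    have := huniq 1 i j one_pos (by omega) (fun g => by
      rw [← hi, ← hj, ← hα, D.inducedDiff_inv])
    intro g
    rw [hi, this]
  have hval : ∀ g, ∃ n : ℤ, I.χ P g = n := fun g =>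
    exists_int_eq_of_isIntegral_of_fixed
      (isIntegral_trace_of_pow_eq_one (orderOf_pos g) (hpow P g)) fun σ => hgal σ g
  choose v hv using hval
  refine ⟨δ, hδ, ?_, v, ?_, ?_, ?_, ?_, ?_, ?_⟩
  · rw [hcard]; push_cast; rw [hg]
  · intro g h
    have := I.χ_conj P g h
    rw [hv, hv] at this
    exact_mod_cast this
  · have := I.χ_one P
    rw [hv] at this
    have : v 1 = I.d P := by exact_mod_cast this
    rw [this, hdP]; push_cast; ring
  · intro l hl
    have := hP l hl
    rw [hv] at this
    exact_mod_cast this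
  · have := I.orth i₀ P
    rw [if_neg (Ne.symm hPi₀)] at this
    simp_rw [hi₀, one_mul, hv] at this
    have h' : ((∑ g, v g : ℤ) : k) = ((0 : ℤ) : k) := by push_cast; exact this
    exact_mod_cast h'
  · have := hsum1 P
    simp_rw [hdual, hv, ← pow_two] at this
    have h' : ((∑ g, v g ^ 2 : ℤ) : k) = ((Fintype.card G : ℤ) : k) := by push_cast; exact this
    exact_mod_cast h'
  · intro s hs g
    exact int_prime_dvd_trace_sub (orderOf_pos g) (hpow P g) hs (hv g)
      (by rw [← map_pow]; exact hv (g ^ s))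

/-- The integral character of degree `2 * m ± 1` of a simple group with dihedral Sylow subgroups
of order `2 * m` which are centralizers of involutions. -/
theorem exists_character {G : Type*} [Group G] [Fintype G] {a t : G} {m g₀ : ℕ}
    (D : DihedralTI a t m) (hcard : Fintype.card G = 2 * m * g₀) (hg₀ : Odd g₀) :
    ∃ δ : ℤ, (δ = 1 ∨ δ = -1) ∧ (Fintype.card G : ℤ) = 2 * m * ((2 * m + δ) * (m + δ)) ∧
      ∃ v : G → ℤ, (∀ g h, v (h * g * h⁻¹) = v g) ∧ v 1 = 2 * m + δ ∧
        (∀ l, ¬ m ∣ l → v (a ^ l) = δ) ∧ ∑ g, v g = 0 ∧ ∑ g, v g ^ 2 = Fintype.card G ∧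
        ∀ s : ℕ, s.Prime → ∀ g, (s : ℤ) ∣ v g - v (g ^ s) :=
  D.exists_character_of_field (AlgebraicClosure ℚ) hcard hg₀

end DihedralTI

namespace DihedralTI

variable {G : Type*} [Group G] {a t : G} {m : ℕ}

theorem inv_conj_eq_one_iff {g h : G} : h⁻¹ * g * h = 1 ↔ g = 1 := by
  have := conj_eq_one_iff (a := h⁻¹) (b := g)
  rwa [inv_inv] at this

/-- An element is regular if it has no conjugate in the cyclic group generated by `a`. -/
def Regular (a y : G) : Prop := ∀ h : G, h⁻¹ * y * h ∉ Subgroup.zpowers a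

theorem Regular.ne_one {y : G} (hy : Regular a y) : y ≠ 1 := by
  rintro rfl
  exact hy 1 (by simp)

theorem Regular.conj {y : G} (hy : Regular a y) (g : G) : Regular a (g * y * g⁻¹) := by
  intro h hh
  apply hy (g⁻¹ * h)
  convert hh using 1
  group

theorem Regular.not_mem_or (D : DihedralTI a t m) {w : G} (hw : Regular a w) :
    ¬ (w ∈ Subgroup.zpowers a ∨ w * t ∈ Subgroup.zpowers a) := by
  rintro (h | h)
  · exact hw 1 (by simpa using h)
  · have h1 := D.conj_mem h
    have h2 : w * w = 1 := by
      have : w * w = w * t * (t * (w * t) * t⁻¹) := by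
        rw [D.t_inv]
        have e : w * t * (t * (w * t) * t) = w * (t * t) * w * (t * t) := by group
        rw [e, D.sq]; simp
      rw [this, h1]; simp
    obtain ⟨g, hg⟩ := D.involution w h2 hw.ne_one
    apply hw g
    rw [hg]
    have : g⁻¹ * (g * a ^ (m / 2) * g⁻¹) * g = a ^ (m / 2) := by group
    rw [this]
    exact DihedralTI.pow_mem _

theorem Regular.of_commute (D : DihedralTI a t m) {y c : G} (hy : Regular a y) (hc : c ≠ 1)
    (h : Commute c y) : Regular a c := by
  intro g hg
  refine (hy.conj g⁻¹).not_mem_or D (D.ti _ hg ?_ _ ?_)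
  · rw [Ne, inv_conj_eq_one_iff]
    exact hc
  · convert hg using 1
    have e : g⁻¹ * y * g⁻¹⁻¹ * (g⁻¹ * c * g) * (g⁻¹ * y * g⁻¹⁻¹)⁻¹ = g⁻¹ * (y * c) * y⁻¹ * g := by
      group
    rw [e, ← h.eq]; group

theorem Regular.pow (D : DihedralTI a t m) {y : G} (hy : Regular a y) {k : ℕ} (hk : y ^ k ≠ 1) :
    Regular a (y ^ k) := hy.of_commute D hk (Commute.pow_self y k)

theorem Regular.odd_centralizer [Finite G] (D : DihedralTI a t m) {y : G} (hy : Regular a y) :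
    Odd (Nat.card (Subgroup.centralizer {y})) := by
  rw [← Nat.not_even_iff_odd, even_iff_two_dvd]
  intro h
  obtain ⟨⟨u, hu⟩, hu2⟩ := exists_prime_orderOf_dvd_card' 2 h
  rw [Subgroup.orderOf_mk] at hu2
  have hu1 : u ≠ 1 := by
    rintro rfl
    simp at hu2
  have hc : Commute u y := by
    have := Subgroup.mem_centralizer_iff.1 hu y rfl
    exact this.symm
  have hR := hy.of_commute D hu1 hc
  have := pow_orderOf_eq_one u
  rw [hu2, pow_two] at this
  obtain ⟨g, hg⟩ := D.involution u this hu1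
  apply hR g
  rw [hg]
  have : g⁻¹ * (g * a ^ (m / 2) * g⁻¹) * g = a ^ (m / 2) := by group
  rw [this]
  exact DihedralTI.pow_mem _

theorem Regular.orderOf_dvd [Finite G] {y : G} :
    orderOf y ∣ Nat.card (Subgroup.centralizer {y}) := by
  have := orderOf_dvd_natCard (⟨y, by simp [Subgroup.mem_centralizer_iff]⟩ : Subgroup.centralizer {y})
  rwa [Subgroup.orderOf_mk] at this

/-- The set of elements with a nontrivial conjugate in the cyclic group. -/
theorem card_conj_cyclic [Fintype G] (D : DihedralTI a t m) [DecidableEq G]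
    [DecidablePred (Regular a)] :
    2 * m * (Finset.univ.filter fun u : G => ¬ Regular a u ∧ u ≠ 1).card =
      Fintype.card G * (m - 1) := by
  classical
  have h2 : ∀ u ∈ Finset.univ.filter fun u : G => ¬ Regular a u ∧ u ≠ 1,
      (Finset.univ.filter fun h : G => h⁻¹ * u * h ∈ Subgroup.zpowers a).card = 2 * m := by
    intro u hu
    simp only [Finset.mem_filter, Finset.mem_univ, true_and, Regular, not_forall, not_not] at hu
    obtain ⟨⟨g, hg⟩, hu1⟩ := hu
    have h1 : ∀ h, h⁻¹ * u * h ∈ Subgroup.zpowers a ↔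
        g⁻¹ * h ∈ Subgroup.zpowers a ∨ g⁻¹ * h * t ∈ Subgroup.zpowers a := by
      intro h
      have e : h⁻¹ * u * h = (g⁻¹ * h)⁻¹ * (g⁻¹ * u * g) * (g⁻¹ * h) := by group
      rw [e]
      constructor
      · exact D.mem_or hg (by rwa [Ne, inv_conj_eq_one_iff])
      · rintro (h' | h')
        · rwa [D.conj_of_mem hg h']
        · rw [D.conj_of_mul_mem hg h']
          exact inv_mem hg
    simp_rw [h1]
    have : (Finset.univ.filter fun h : G => g⁻¹ * h ∈ Subgroup.zpowers a ∨
        g⁻¹ * h * t ∈ Subgroup.zpowers a).card =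
        (Finset.univ.filter fun h : G => h ∈ Subgroup.zpowers a ∨
        h * t ∈ Subgroup.zpowers a).card := by
      refine Finset.card_bij (fun h _ => g⁻¹ * h) ?_ ?_ ?_
      · simp
      · simp
      · intro b hb
        refine ⟨g * b, ?_, ?_⟩ <;> simp at *
        exact hb
    rw [this, Finset.filter_or, Finset.card_union_of_disjoint, D.card_mem, D.card_mul_mem, two_mul]
    rw [Finset.disjoint_filter]
    intro x _ hx
    exact D.not_mem_and hx
  have h3 : ∀ h ∈ (Finset.univ : Finset G),
      ((Finset.univ.filter fun u : G => ¬ Regular a u ∧ u ≠ 1).filter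
        fun u => h⁻¹ * u * h ∈ Subgroup.zpowers a).card = m - 1 := by
    intro h _
    rw [← D.card_mem, ← Finset.card_erase_of_mem (a := (1 : G)) (by simp)]
    refine Finset.card_bij (fun u _ => h⁻¹ * u * h) ?_ ?_ ?_
    · intro u hu
      simp only [Finset.mem_filter, Finset.mem_univ, true_and] at hu
      simp only [Finset.mem_erase, Finset.mem_filter, Finset.mem_univ, true_and]
      exact ⟨by rw [Ne, inv_conj_eq_one_iff]; exact hu.1.2, hu.2⟩
    · simp
    · intro b hb
      simp only [Finset.mem_erase, Finset.mem_filter, Finset.mem_univ, true_and] at hb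
      have e : h⁻¹ * (h * b * h⁻¹) * h = b := by group
      refine ⟨h * b * h⁻¹, ?_, e⟩
      simp only [Finset.mem_filter, Finset.mem_univ, true_and]
      refine ⟨⟨fun hR => hR h (e.symm ▸ hb.2), by rw [Ne, conj_eq_one_iff]; exact hb.1⟩, e.symm ▸ hb.2⟩
  have h4 := Finset.sum_card_bipartiteAbove_eq_sum_card_bipartiteBelow
    (s := Finset.univ.filter fun u : G => ¬ Regular a u ∧ u ≠ 1) (t := (Finset.univ : Finset G))
    (r := fun u h => h⁻¹ * u * h ∈ Subgroup.zpowers a)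
  simp only [Finset.bipartiteAbove, Finset.bipartiteBelow] at h4
  rw [Finset.sum_congr rfl h2, Finset.sum_congr rfl h3, Finset.sum_const, Finset.sum_const,
    smul_eq_mul, smul_eq_mul, Finset.card_univ] at h4
  rw [← h4, mul_comm]

/-- The numerical and character data attached to the dihedral configuration. -/
structure CharData [Fintype G] (a : G) (m : ℕ) (δ : ℤ) (q k : ℕ) (v : G → ℤ) : Prop where
  sign : δ = 1 ∨ δ = -1
  q_eq : (q : ℤ) = 2 * m + δ
  k_eq : (k : ℤ) = m + δ
  card : Fintype.card G = 2 * m * (q * k)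
  conj : ∀ g h, v (h * g * h⁻¹) = v g
  one : v 1 = q
  pow : ∀ l, ¬ m ∣ l → v (a ^ l) = δ
  sum : ∑ g, v g = 0
  sum_sq : ∑ g, v g ^ 2 = Fintype.card G
  prime_dvd : ∀ s : ℕ, s.Prime → ∀ g, (s : ℤ) ∣ v g - v (g ^ s)

theorem exists_charData [Fintype G] (D : DihedralTI a t m) {g₀ : ℕ}
    (hcard : Fintype.card G = 2 * m * g₀) (hg₀ : Odd g₀) :
    ∃ δ q k v, CharData a m δ q k v := by
  obtain ⟨δ, hδ, hc, v, h1, h2, h3, h4, h5, h6⟩ := D.exists_character hcard hg₀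
  have h8 := D.eight_dvd
  have hpos := D.pos
  obtain ⟨q, hq⟩ : ∃ q : ℕ, (q : ℤ) = 2 * m + δ :=
    ⟨(2 * m + δ).toNat, Int.toNat_of_nonneg (by omega)⟩
  obtain ⟨k, hk⟩ : ∃ k : ℕ, (k : ℤ) = m + δ :=
    ⟨(m + δ).toNat, Int.toNat_of_nonneg (by omega)⟩
  refine ⟨δ, q, k, v, hδ, hq, hk, ?_, h1, h2.trans hq.symm, h3, h4, h5, h6⟩
  rw [← hq, ← hk] at hc
  exact_mod_cast hc

namespace CharData

variable [Fintype G] {δ : ℤ} {q k : ℕ} {v : G → ℤ}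

theorem sum_split (C : CharData a m δ q k v) (D : DihedralTI a t m) [DecidableEq G]
    [DecidablePred (Regular a)] (f : ℤ → ℤ) :
    ∑ g, f (v g) = f q + (q * k * (m - 1) : ℤ) * f δ +
      ∑ g ∈ Finset.univ.filter (Regular a), f (v g) := by
  have hpos := D.pos
  have h1 : (Finset.univ : Finset G) = insert 1 (Finset.univ.filter fun u => ¬ Regular a u ∧ u ≠ 1)
      ∪ Finset.univ.filter (Regular a) := by
    ext g
    simp
    tauto
  have h2 : ((Finset.univ.filter fun u : G => ¬ Regular a u ∧ u ≠ 1).card : ℤ) =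
      q * k * (m - 1) := by
    have := D.card_conj_cyclic
    rw [C.card] at this
    have h3 : (2 * m : ℤ) ≠ 0 := by positivity
    apply mul_left_cancel₀ h3
    have h4 : ((m - 1 : ℕ) : ℤ) = m - 1 := by push_cast [Nat.cast_sub hpos]; ring
    rw [← h4]
    exact_mod_cast (by rw [this]; ring)
  conv_lhs => rw [h1]
  rw [Finset.sum_union, Finset.sum_insert (by simp), C.one]
  · congr 2
    rw [← h2, ← nsmul_eq_mul]
    rw [← Finset.sum_const]
    refine Finset.sum_congr rfl fun u hu => ?_
    simp only [Finset.mem_filter, Finset.mem_univ, true_and, Regular, not_forall, not_not] at hu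
    obtain ⟨⟨g, hg⟩, hu1⟩ := hu
    obtain ⟨l, hl, hl2⟩ := D.exists_pow hg
    have : u = g * a ^ l * g⁻¹ := by rw [← hl2]; group
    rw [this, C.conj, C.pow]
    rw [← D.pow_eq_one_iff, ← hl2, inv_conj_eq_one_iff]
    exact hu1
  · rw [Finset.disjoint_left]
    intro u hu hu'
    simp only [Finset.mem_insert, Finset.mem_filter, Finset.mem_univ, true_and] at hu hu'
    rcases hu with rfl | hu
    · exact hu'.ne_one rfl
    · exact hu.1 hu'

theorem sq_sign (C : CharData a m δ q k v) : δ * δ = 1 := by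
  rcases C.sign with h | h <;> simp [h]

theorem value (C : CharData a m δ q k v) (D : DihedralTI a t m) {y : G} (hy : Regular a y) :
    v y = 0 ∨ v y = -δ := by
  classical
  have hδ := C.sq_sign
  have h1 := C.sum_split D (fun x => x ^ 2 + δ * x)
  have hL : ∑ g, (v g ^ 2 + δ * v g) = Fintype.card G := by
    rw [Finset.sum_add_distrib, ← Finset.mul_sum, C.sum, C.sum_sq, mul_zero, add_zero]
  rw [hL, C.card] at h1
  have h2 : ∑ g ∈ Finset.univ.filter (Regular a), (v g ^ 2 + δ * v g) = 0 := by
    push_cast at h1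
    rw [C.q_eq, C.k_eq] at h1
    have : ∀ x, x = (2 * m * ((2 * m + δ) * (m + δ)) + δ * 0) - ((2 * m + δ) ^ 2 + δ * (2 * m + δ) +
        (2 * m + δ) * (m + δ) * (m - 1) * (δ ^ 2 + δ * δ)) → x = (0:ℤ) := by
      intro x hx
      rw [hx]
      linear_combination (-2 * (2 * m + δ) * (m + δ) * (m - 1)) * hδ
    apply this
    linear_combination - h1
  rw [Finset.sum_eq_zero_iff_of_nonneg] at h2
  · have := h2 y (by simpa using hy)
    have h3 : v y * (v y + δ) = 0 := by linear_combination this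
    rcases mul_eq_zero.1 h3 with h | h
    · exact Or.inl h
    · right; linarith
  · intro g _
    rcases C.sign with h | h <;> rw [h]
    · rcases le_or_gt 0 (v g) with h | h <;> nlinarith
    · rcases le_or_gt (v g) 0 with h | h <;> nlinarith

theorem card_zero (C : CharData a m δ q k v) (D : DihedralTI a t m)
    [DecidablePred (Regular a)] :
    (Finset.univ.filter fun y => Regular a y ∧ v y = 0).card = 4 * m * k := by
  classical
  have hδ := C.sq_sign
  have h1 := C.sum_split D (fun x => x)
  have h0 := C.sum_split D (fun x => 1)
  have h2 : ∑ g ∈ Finset.univ.filter (Regular a), v g =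
      ∑ g ∈ Finset.univ.filter (Regular a), (-δ + δ * if v g = 0 then 1 else 0) := by
    refine Finset.sum_congr rfl fun y hy => ?_
    simp only [Finset.mem_filter, Finset.mem_univ, true_and] at hy
    rcases C.value D hy with h | h
    · simp [h]
    · have : δ ≠ 0 := by rintro rfl; simp at hδ
      simp [h, this]
  rw [h2, Finset.sum_add_distrib, ← Finset.mul_sum, Finset.sum_boole, Finset.filter_filter,
    C.sum] at h1
  simp only [Finset.sum_const, nsmul_eq_mul, Finset.card_univ, C.card] at h0 h1
  set Z := ((Finset.univ.filter fun y => Regular a y ∧ v y = 0).card : ℤ)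
  set R := ((Finset.univ.filter fun y => Regular a y).card : ℤ)
  have : Z = 4 * m * k := by
    push_cast at h0
    rw [C.q_eq, C.k_eq] at h0 h1
    rw [C.k_eq]
    have h5 : R = 2 * ↑m * ((2 * ↑m + δ) * (↑m + δ)) - 1 - (2 * ↑m + δ) * (↑m + δ) * (↑m - 1) := by
      linear_combination -h0
    rw [h5] at h1
    have h6 : Z = δ * (δ * Z) := by rw [← mul_assoc, hδ, one_mul]
    rw [h6]
    linear_combination (exp := 1) (-δ) * h1 + (4 * m ^ 2 + 6 * m * δ + 2 * δ ^ 2) * hδ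
  have h7 : ((Finset.univ.filter fun y => Regular a y ∧ v y = 0).card : ℤ) = ((4 * m * k : ℕ) : ℤ) := by
    push_cast
    exact this
  exact Int.ofNat_inj.1 h7

end CharData

end DihedralTI

namespace DihedralTI

variable {G : Type*} [Group G] {a t : G} {m : ℕ}

theorem Regular.odd_orderOf [Finite G] (D : DihedralTI a t m) {y : G} (hy : Regular a y) :
    Odd (orderOf y) := (hy.odd_centralizer D).of_dvd_nat Regular.orderOf_dvd

theorem card_conjClass_mul [Fintype G] [DecidableEq G] (y : G) [DecidablePred (IsConj y)] :
    (Finset.univ.filter (IsConj y)).card * Nat.card (Subgroup.centralizer {y}) =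
      Fintype.card G := by
  have h1 : (Finset.univ.filter (IsConj y)).card = (MulAction.orbit (ConjAct G) y).ncard := by
    rw [← Set.ncard_coe_finset]
    congr 1
    ext g
    rw [ConjAct.mem_orbit_conjAct, isConj_comm]
    simp
  rw [h1, Subgroup.nat_card_centralizer_nat_card_stabilizer, ← MulAction.index_stabilizer,
    mul_comm, Subgroup.card_mul_index, Nat.card_eq_fintype_card, ConjAct.card]

namespace CharData

variable [Fintype G] {δ : ℤ} {q k : ℕ} {v : G → ℤ}

theorem q_pos (C : CharData a m δ q k v) (D : DihedralTI a t m) : 15 ≤ q := by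
  have h1 := C.q_eq
  have h8 := D.eight_dvd
  have hpos := D.pos
  rcases C.sign with h | h <;> omega

theorem q_odd (C : CharData a m δ q k v) : Odd q := by
  have h1 := C.q_eq
  rw [Nat.odd_iff]
  rcases C.sign with h | h <;> omega

theorem k_pos (C : CharData a m δ q k v) (D : DihedralTI a t m) : 0 < k := by
  have h1 := C.k_eq
  have h8 := D.eight_dvd
  have hpos := D.pos
  rcases C.sign with h | h <;> omega

theorem coprime_m (C : CharData a m δ q k v) : Nat.Coprime q (2 * m) := by
  rw [← Nat.isCoprime_iff_coprime]
  refine ⟨δ, -δ, ?_⟩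
  rw [C.q_eq]
  push_cast
  linear_combination C.sq_sign

theorem coprime_k (C : CharData a m δ q k v) : Nat.Coprime q (2 * k) := by
  rw [← Nat.isCoprime_iff_coprime]
  refine ⟨-δ, δ, ?_⟩
  push_cast
  rw [C.q_eq, C.k_eq]
  linear_combination C.sq_sign

theorem coprime_cofactor (C : CharData a m δ q k v) : Nat.Coprime q (2 * m * k) :=
  C.coprime_m.mul_right (C.coprime_k.coprime_dvd_right (Dvd.intro_left _ rfl))

theorem value_pow (C : CharData a m δ q k v) (D : DihedralTI a t m) {n : ℕ} :
    ∀ {y : G}, Regular a y → Odd n → y ^ n ≠ 1 → v (y ^ n) = v y := by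
  induction n using Nat.recOnMul with
  | zero => intro y _ h; simp at h
  | one => simp
  | prime s hs =>
    intro y hy hodd hn
    have h1 := C.prime_dvd s hs y
    have h3 : 3 ≤ s := by
      have := hs.two_le
      rw [Nat.odd_iff] at hodd
      omega
    have h4 : |v y - v (y ^ s)| < s := by
      rw [abs_lt]
      rcases C.value D hy with h | h <;> rcases C.value D (hy.pow D hn) with h' | h' <;>
        rcases C.sign with h2 | h2 <;> omega
    have h5 := Int.eq_zero_of_abs_lt_dvd h1 h4
    linarith
  | mul i j hi hj =>
    intro y hy hodd hn
    rw [Nat.odd_mul] at hodd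
    have h1 : y ^ i ≠ 1 := by
      intro h
      rw [pow_mul, h, one_pow] at hn
      exact hn rfl
    rw [pow_mul] at hn ⊢
    rw [hj (hy.pow D h1) hodd.2 hn, hi hy hodd.1 h1]

theorem value_modEq (C : CharData a m δ q k v) (D : DihedralTI a t m) {y : G} (hy : Regular a y)
    {r : ℕ} (hr : r.Prime) (h : r ∣ orderOf y) : (r : ℤ) ∣ v y - q := by
  obtain ⟨n, hn⟩ := h
  have hodd := hy.odd_orderOf D
  rw [hn, Nat.odd_mul] at hodd
  have h1 : y ^ n ≠ 1 := by
    intro h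
    have := orderOf_dvd_of_pow_eq_one h
    rw [hn] at this
    have h2 : 0 < n := hodd.2.pos
    have := Nat.le_of_dvd h2 this
    have := hr.two_le
    nlinarith
  have h2 := C.prime_dvd r hr (y ^ n)
  rwa [C.value_pow D hy hodd.2 h1, ← pow_mul, mul_comm, ← hn, pow_orderOf_eq_one, C.one] at h2

theorem dvd_q_of_zero (C : CharData a m δ q k v) (D : DihedralTI a t m) {y : G} (hy : Regular a y)
    (h0 : v y = 0) {r : ℕ} (hr : r.Prime) (h : r ∣ orderOf y) : r ∣ q := by
  have := C.value_modEq D hy hr h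
  rw [h0, zero_sub, dvd_neg] at this
  exact_mod_cast this

theorem zero_of_dvd_q (C : CharData a m δ q k v) (D : DihedralTI a t m) {y : G} (hy : Regular a y)
    {r : ℕ} (hr : r.Prime) (h : r ∣ orderOf y) (hq : r ∣ q) : v y = 0 := by
  rcases C.value D hy with h1 | h1
  · exact h1
  exfalso
  have h2 := C.value_modEq D hy hr h
  have h3 : (r : ℤ) ∣ q := by exact_mod_cast hq
  have h4 : (r : ℤ) ∣ v y := by
    have := dvd_add h2 h3
    simpa using this
  rw [h1, dvd_neg] at h4
  have h5 : (r : ℤ) ∣ 1 := by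
    rw [← C.sq_sign]
    exact h4.mul_left _
  have := Int.le_of_dvd one_pos h5
  have := hr.two_le
  omega

theorem regular_of_prime (C : CharData a m δ q k v) (D : DihedralTI a t m) {y : G}
    {r : ℕ} (hr : r.Prime) (h : orderOf y = r) (hq : r ∣ q) : Regular a y := by
  intro g hg
  obtain ⟨l, hl, hl2⟩ := D.exists_pow hg
  have h1 : (g⁻¹ * y * g) ^ m = 1 := by rw [hl2, ← pow_mul, mul_comm, pow_mul, D.pow_m, one_pow]
  have h2 : orderOf (g⁻¹ * y * g) = r := by
    rw [← h]
    have := orderOf_injective (MulAut.conj g⁻¹).toMonoidHom (MulAut.conj g⁻¹).injective y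
    simpa using this
  have h3 : r ∣ m := h2 ▸ orderOf_dvd_of_pow_eq_one h1
  have h4 := Nat.dvd_gcd hq (h3.mul_left 2)
  rw [C.coprime_m] at h4
  exact hr.one_lt.ne' (Nat.dvd_one.1 h4)

theorem class_subset_zero (C : CharData a m δ q k v) {y : G} [DecidablePred (Regular a)]
    [DecidablePred (IsConj y)] (hy : Regular a y) (h0 : v y = 0) :
    Finset.univ.filter (IsConj y) ⊆ Finset.univ.filter fun y => Regular a y ∧ v y = 0 := by
  intro g hg
  simp only [Finset.mem_filter, Finset.mem_univ, true_and] at hg ⊢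
  obtain ⟨h, rfl⟩ := isConj_iff.1 hg
  exact ⟨hy.conj h, by rw [C.conj, h0]⟩

theorem card_centralizer (C : CharData a m δ q k v) (D : DihedralTI a t m) {y : G}
    (hy : Regular a y) (h0 : v y = 0) : Nat.card (Subgroup.centralizer {y}) = q := by
  classical
  have hp : ∀ s : ℕ, s.Prime → s ∣ Nat.card (Subgroup.centralizer {y}) → s ∣ q := by
    intro s hs hd
    by_contra hsq
    have := Fact.mk hs
    obtain ⟨⟨c, hc⟩, hc2⟩ := exists_prime_orderOf_dvd_card' s hd
    rw [Subgroup.orderOf_mk] at hc2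
    have hcy : Commute c y := (Subgroup.mem_centralizer_iff.1 hc y rfl).symm
    have hco : (orderOf c).Coprime (orderOf y) := by
      rw [hc2, hs.coprime_iff_not_dvd]
      exact fun h => hsq (C.dvd_q_of_zero D hy h0 hs h)
    have ho := hcy.orderOf_mul_eq_mul_orderOf_of_coprime hco
    have hy1 : orderOf y ≠ 1 := by rw [Ne, orderOf_eq_one_iff]; exact hy.ne_one
    obtain ⟨r, hr, hry⟩ := Nat.exists_prime_and_dvd hy1
    have hcy1 : c * y ≠ 1 := by
      intro h
      rw [h, orderOf_one, hc2] at ho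
      have := Nat.eq_one_of_mul_eq_one_right ho.symm
      exact hs.one_lt.ne' this
    have hR : Regular a (c * y) := hy.of_commute D hcy1 (hcy.mul_left (Commute.refl y))
    have h1 := C.zero_of_dvd_q D hR hr (ho ▸ hry.mul_left _) (C.dvd_q_of_zero D hy h0 hr hry)
    exact hsq (C.dvd_q_of_zero D hR h1 hs (ho ▸ hc2 ▸ dvd_mul_right _ _))
  have hco : (Nat.card (Subgroup.centralizer {y})).Coprime (2 * m * k) := by
    rw [Nat.coprime_iff_gcd_eq_one]
    by_contra hne
    obtain ⟨s, hs, hsd⟩ := Nat.exists_prime_and_dvd hne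
    have h1 := hp s hs (hsd.trans (Nat.gcd_dvd_left _ _))
    have h2 := Nat.dvd_gcd h1 (hsd.trans (Nat.gcd_dvd_right _ _))
    rw [C.coprime_cofactor] at h2
    exact hs.one_lt.ne' (Nat.dvd_one.1 h2)
  have hdvd : Nat.card (Subgroup.centralizer {y}) ∣ q := by
    have := Subgroup.card_subgroup_dvd_card (Subgroup.centralizer {y})
    rw [Nat.card_eq_fintype_card (α := G), C.card] at this
    refine Nat.Coprime.dvd_of_dvd_mul_right hco ?_
    convert this using 1; ring
  obtain ⟨d, hd⟩ := hdvd
  have hcl := card_conjClass_mul y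
  have hle : (Finset.univ.filter (IsConj y)).card ≤ 4 * m * k := by
    rw [← C.card_zero D]
    exact Finset.card_le_card (C.class_subset_zero hy h0)
  have hpos : 0 < Nat.card (Subgroup.centralizer {y}) := Nat.card_pos
  have h1 : (Finset.univ.filter (IsConj y)).card = 2 * m * k * d := by
    apply Nat.eq_of_mul_eq_mul_right hpos
    rw [hcl, C.card, hd]
    ring
  have h2 : 0 < 2 * m * k := by have := D.pos; have := C.k_pos D; positivity
  have h3 : d ≤ 2 := by
    apply Nat.le_of_mul_le_mul_left _ h2
    rw [← h1]
    linarith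
  have h4 := C.q_odd
  rw [hd, Nat.odd_mul, Nat.odd_iff (n := d)] at h4
  have h5 : d = 1 := by omega
  rw [hd, h5, mul_one]

theorem card_class (C : CharData a m δ q k v) (D : DihedralTI a t m) {y : G}
    [DecidablePred (IsConj y)]
    (hy : Regular a y) (h0 : v y = 0) : (Finset.univ.filter (IsConj y)).card = 2 * m * k := by
  classical
  have hcl := card_conjClass_mul y
  rw [C.card_centralizer D hy h0, C.card] at hcl
  have := C.q_pos D
  apply Nat.eq_of_mul_eq_mul_right (show 0 < q by omega)
  rw [hcl]; ring

theorem isPrimePow_q (C : CharData a m δ q k v) (D : DihedralTI a t m) : IsPrimePow q := by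
  classical
  have hq := C.q_pos D
  by_contra hnp
  obtain ⟨r, hr, hrq⟩ := Nat.exists_prime_and_dvd (n := q) (by omega)
  obtain ⟨s, hs, hsq, hrs⟩ : ∃ s : ℕ, s.Prime ∧ s ∣ q ∧ s ≠ r := by
    by_contra! h
    apply hnp
    rw [isPrimePow_iff_unique_prime_dvd]
    exact ⟨r, ⟨hr, hrq⟩, fun s hs => h s hs.1 hs.2⟩
  have := Fact.mk hr
  have := Fact.mk hs
  have hG : q ∣ Fintype.card G := ⟨2 * m * k, by rw [C.card]; ring⟩
  obtain ⟨x, hx⟩ := exists_prime_orderOf_dvd_card r (hrq.trans hG)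
  have hxR := C.regular_of_prime D hr hx hrq
  have hx0 := C.zero_of_dvd_q D hxR hr (hx ▸ dvd_rfl) hrq
  have hcx := C.card_centralizer D hxR hx0
  obtain ⟨⟨c, hc⟩, hc2⟩ := exists_prime_orderOf_dvd_card' (G := Subgroup.centralizer {x}) s
    (hcx ▸ hsq)
  rw [Subgroup.orderOf_mk] at hc2
  have hcR := C.regular_of_prime D hs hc2 hsq
  have hc0 := C.zero_of_dvd_q D hcR hs (hc2 ▸ dvd_rfl) hsq
  have hcy : Commute c x := (Subgroup.mem_centralizer_iff.1 hc x rfl).symm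
  have ho := hcy.orderOf_mul_eq_mul_orderOf_of_coprime
    (by rw [hc2, hx]; exact (Nat.coprime_primes hs hr).2 hrs)
  rw [hx, hc2] at ho
  have hr2 := hr.two_le
  have hs2 := hs.two_le
  have h1 : c * x ≠ 1 := by
    intro h
    rw [h, orderOf_one] at ho
    nlinarith
  have hR := hcR.of_commute D h1 ((Commute.refl c).mul_left hcy.symm)
  have h0 := C.zero_of_dvd_q D hR hs (ho ▸ dvd_mul_right _ _) hsq
  have hcard := C.card_zero D
  have hsub : Finset.univ.filter (IsConj x) ∪ (Finset.univ.filter (IsConj c) ∪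
      Finset.univ.filter (IsConj (c * x))) ⊆ Finset.univ.filter fun y => Regular a y ∧ v y = 0 :=
    Finset.union_subset (C.class_subset_zero hxR hx0) (Finset.union_subset
      (C.class_subset_zero hcR hc0) (C.class_subset_zero hR h0))
  have hdis : ∀ y z : G, orderOf y ≠ orderOf z →
      Disjoint (Finset.univ.filter (IsConj y)) (Finset.univ.filter (IsConj z)) := by
    intro y z hyz
    rw [Finset.disjoint_filter]
    intro g _ h1 h2
    obtain ⟨h, hh⟩ := isConj_iff.1 (h1.trans h2.symm)
    apply hyz
    rw [← hh]
    have := orderOf_injective (MulAut.conj h).toMonoidHom (MulAut.conj h).injective y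
    simpa using this.symm
  have hle := Finset.card_le_card hsub
  rw [Finset.card_union_of_disjoint, Finset.card_union_of_disjoint, C.card_class D hxR hx0,
    C.card_class D hcR hc0, C.card_class D hR h0, hcard] at hle
  · have h2 : 0 < m * k := by have := D.pos; have := C.k_pos D; positivity
    linarith
  · apply hdis
    rw [hc2, ho]
    intro h
    nlinarith
  · rw [Finset.disjoint_union_right]
    constructor
    · apply hdis
      rw [hx, hc2]; exact hrs.symm
    · apply hdis
      rw [hx, ho]
      intro h
      nlinarith

end CharData

end DihedralTI

theorem eq_one_of_two_pow_add_sign_eq_pow {n r j : ℕ} {δ : ℤ} (hδ : δ = 1 ∨ δ = -1) (hn : 4 ≤ n)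
    (h : (r : ℤ) ^ j = 2 ^ n + δ) : j = 1 := by
  have h16 : (2 : ℤ) ^ 4 ≤ 2 ^ n := pow_le_pow_right₀ (by norm_num) hn
  obtain ⟨n', rfl⟩ : ∃ n', n = n' + 4 := ⟨n - 4, by omega⟩
  have hj0 : j ≠ 0 := by rintro rfl; simp at h; rcases hδ with h2 | h2 <;> omega
  rcases Nat.even_or_odd j with ⟨i, hi⟩ | hj
  · exfalso
    have hs : (r : ℤ) ^ i * (r : ℤ) ^ i = 2 ^ (n' + 4) + δ := by rw [← pow_add, ← hi, h]
    have hs' : ((r ^ i : ℕ) : ℤ) = (r : ℤ) ^ i := by push_cast; rfl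
    rw [← hs'] at hs
    generalize r ^ i = s at hs
    rcases hδ with rfl | rfl
    · have h1 : (s + 1) * (s - 1) = 2 ^ (n' + 4) := by
        have : 1 ≤ s := by
          rcases Nat.eq_zero_or_pos s with rfl | h
          · simp at hs; omega
          · exact h
        zify [this]
        linear_combination hs
      obtain ⟨b, -, hb⟩ := (Nat.dvd_prime_pow Nat.prime_two).1 (Dvd.intro _ h1)
      obtain ⟨c, -, hc⟩ := (Nat.dvd_prime_pow Nat.prime_two).1 (Dvd.intro_left _ h1)
      have h2 : 16 ≤ (s + 1) * (s - 1) := by rw [h1]; exact_mod_cast h16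
      have hs3 : 4 ≤ s := by
        by_contra hlt
        interval_cases s <;> omega
      have hb2 : 2 ≤ b := by
        by_contra hlt
        interval_cases b <;> omega
      have hc2 : 2 ≤ c := by
        by_contra hlt
        interval_cases c <;> omega
      obtain ⟨b', rfl⟩ : ∃ b', b = b' + 2 := ⟨b - 2, by omega⟩
      obtain ⟨c', rfl⟩ : ∃ c', c = c' + 2 := ⟨c - 2, by omega⟩
      rw [pow_add] at hb hc
      omega
    · rcases Int.emod_two_eq_zero_or_one s with h0 | h0
      · obtain ⟨d, hd⟩ := Int.dvd_of_emod_eq_zero h0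
        rw [hd, pow_add] at hs
        ring_nf at hs
        omega
      · obtain ⟨d, hd⟩ : ∃ d, (s : ℤ) = 2 * d + 1 := ⟨s / 2, by omega⟩
        rw [hd, pow_add] at hs
        ring_nf at hs
        omega
  · have hδ2 : δ * δ = 1 := by rcases hδ with h | h <;> simp [h]
    have hδj : δ ^ j = δ := by
      obtain ⟨i, rfl⟩ := hj
      rw [pow_succ, pow_mul, pow_two, hδ2, one_pow, one_mul]
    have h1 : (∑ i ∈ Finset.range j, (δ * r) ^ i) * (δ * r - 1) = δ * 2 ^ (n' + 4) := by
      rw [geom_sum_mul, mul_pow, hδj, h]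
      linear_combination hδ2
    have hrodd : Odd (δ * r) := by
      rw [← Int.not_even_iff_odd]
      intro he
      have h2 : Even ((δ * r) ^ j) := he.pow_of_ne_zero hj0
      rw [mul_pow, hδj, h, mul_add, hδ2] at h2
      rw [pow_add] at h2
      obtain ⟨d, hd⟩ := h2
      have : (2 : ℤ) ∣ 1 := ⟨d - δ * 2 ^ n' * 8, by linear_combination hd⟩
      omega
    have hS : Odd (∑ i ∈ Finset.range j, (δ * r) ^ i) := by
      rw [← ZMod.intCast_eq_one_iff_odd]
      have := ZMod.intCast_eq_one_iff_odd.2 hrodd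
      rw [Int.cast_sum]
      simp_rw [Int.cast_pow, this]
      simpa using ZMod.natCast_eq_one_iff_odd.2 hj
    have hunit : IsUnit (∑ i ∈ Finset.range j, (δ * r) ^ i) := by
      have hc : IsCoprime (∑ i ∈ Finset.range j, (δ * r) ^ i) (δ * 2 ^ (n' + 4)) := by
        refine IsCoprime.mul_right ⟨0, δ, by rw [hδ2]; ring⟩ (IsCoprime.pow_right ?_)
        obtain ⟨d, hd⟩ := hS
        exact ⟨1, -d, by rw [hd]; ring⟩
      exact hc.isUnit_of_dvd' dvd_rfl (Dvd.intro _ h1)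
    by_contra hj1
    have hr : (15 : ℤ) ≤ r ∧ (2 : ℤ) ^ (n' + 4) - 1 ≤ r := by
      rcases Int.isUnit_iff.1 hunit with h2 | h2 <;> rcases hδ with h3 | h3 <;>
        rw [h2, h3] at h1 <;> omega
    have h3 : (r : ℤ) ^ 2 ≤ r ^ j := pow_le_pow_right₀ (by linarith) (by omega)
    rcases hδ with h4 | h4 <;> nlinarith

namespace DihedralTI

variable {G : Type*} [Group G] {a t : G} {m : ℕ}

namespace CharData

variable [Fintype G] {δ : ℤ} {q k : ℕ} {v : G → ℤ}

theorem q_prime (C : CharData a m δ q k v) (D : DihedralTI a t m) {e : ℕ} (he : m = 2 ^ e) :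
    q.Prime := by
  obtain ⟨r, j, hr, hj, hq⟩ := C.isPrimePow_q D
  have h1 := C.q_eq
  have he3 : 4 ≤ e + 1 := by
    have h8 := Nat.le_of_dvd D.pos D.eight_dvd
    rw [he, show 8 = 2 ^ 3 from rfl] at h8
    have := (Nat.pow_le_pow_iff_right (by norm_num)).1 h8
    omega
  rw [← hq, he] at h1
  push_cast at h1
  rw [mul_comm, ← pow_succ] at h1
  have := eq_one_of_two_pow_add_sign_eq_pow C.sign he3 h1
  rw [← hq, this, pow_one]
  exact hr.nat_prime

theorem sq_eq (C : CharData a m δ q k v) : q ^ 2 = 4 * m * k + 1 := by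
  have : (q : ℤ) ^ 2 = 4 * m * k + 1 := by
    rw [C.q_eq, C.k_eq]
    linear_combination C.sq_sign
  exact_mod_cast this

theorem card_centralizer_of_order (C : CharData a m δ q k v) (D : DihedralTI a t m)
    (hq : q.Prime) {y : G} (hy : orderOf y = q) : Nat.card (Subgroup.centralizer {y}) = q := by
  have hR := C.regular_of_prime D hq hy dvd_rfl
  exact C.card_centralizer D hR (C.zero_of_dvd_q D hR hq (hy ▸ dvd_rfl) dvd_rfl)

theorem mem_zpowers_of_commute (C : CharData a m δ q k v) (D : DihedralTI a t m)
    (hq : q.Prime) {y c : G} (hy : orderOf y = q) (h : Commute c y) :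
    c ∈ Subgroup.zpowers y := by
  have h1 := C.card_centralizer_of_order D hq hy
  have h2 : Subgroup.zpowers y = Subgroup.centralizer {y} := by
    apply Subgroup.eq_of_le_of_card_ge
    · rw [Subgroup.zpowers_le, Subgroup.mem_centralizer_iff]
      simp
    · rw [h1, Nat.card_zpowers, hy]
  rw [h2, Subgroup.mem_centralizer_iff]
  rintro _ rfl
  exact h.symm

theorem orderOf_eq_iff (C : CharData a m δ q k v) (D : DihedralTI a t m)
    (hq : q.Prime) {y : G} : orderOf y = q ↔ Regular a y ∧ v y = 0 := by
  constructor
  · intro hy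
    have hR := C.regular_of_prime D hq hy dvd_rfl
    exact ⟨hR, C.zero_of_dvd_q D hR hq (hy ▸ dvd_rfl) dvd_rfl⟩
  · rintro ⟨hR, h0⟩
    have h1 := C.card_centralizer D hR h0
    have h2 := Regular.orderOf_dvd (y := y)
    rw [h1] at h2
    rcases (Nat.dvd_prime hq).1 h2 with h | h
    · exact absurd (orderOf_eq_one_iff.1 h) hR.ne_one
    · exact h

theorem factorization_eq_one (C : CharData a m δ q k v) (hq : q.Prime) :
    (Nat.card G).factorization q = 1 := by
  have h := C.coprime_cofactor
  have h0 : 2 * m * k ≠ 0 := by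
    intro h0
    rw [h0] at h
    exact hq.one_lt.ne' (by simpa using h)
  rw [Nat.card_eq_fintype_card, C.card, show 2 * m * (q * k) = q * (2 * m * k) by ring,
    Nat.factorization_mul hq.ne_zero h0, Finsupp.add_apply, hq.factorization_self,
    Nat.factorization_eq_zero_of_not_dvd ((Nat.Prime.coprime_iff_not_dvd hq).1 h)]

theorem card_sylow (C : CharData a m δ q k v) (D : DihedralTI a t m)
    [Fact q.Prime] : Nat.card (Sylow q G) = q + 1 := by
  classical
  have hq : q.Prime := Fact.out
  have hP : ∀ P : Sylow q G, Nat.card P = q := by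
    intro P
    rw [P.card_eq_multiplicity, C.factorization_eq_one hq, pow_one]
  have : Fintype (Sylow q G) := Fintype.ofFinite _
  have h4 := Finset.sum_card_bipartiteAbove_eq_sum_card_bipartiteBelow
    (s := Finset.univ.filter fun y : G => orderOf y = q) (t := (Finset.univ : Finset (Sylow q G)))
    (r := fun y P => y ∈ P)
  simp only [Finset.bipartiteAbove, Finset.bipartiteBelow] at h4
  have h2 : ∀ y ∈ Finset.univ.filter fun y : G => orderOf y = q,
      (Finset.univ.filter fun P : Sylow q G => y ∈ P).card = 1 := by
    intro y hy
    simp only [Finset.mem_filter, Finset.mem_univ, true_and] at hy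
    rw [Finset.card_eq_one]
    refine ⟨Sylow.ofCard (Subgroup.zpowers y)
      (by rw [Nat.card_zpowers, hy, C.factorization_eq_one hq, pow_one]), ?_⟩
    ext P
    simp only [Finset.mem_filter, Finset.mem_univ, true_and, Finset.mem_singleton]
    constructor
    · intro h
      apply Sylow.ext
      rw [Sylow.coe_ofCard]
      symm
      apply Subgroup.eq_of_le_of_card_ge
      · rw [Subgroup.zpowers_le]; exact h
      · rw [Nat.card_zpowers, hy, hP]
    · rintro rfl
      exact Subgroup.mem_zpowers y
  have h3 : ∀ P ∈ (Finset.univ : Finset (Sylow q G)),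
      ((Finset.univ.filter fun y : G => orderOf y = q).filter fun y => y ∈ P).card = q - 1 := by
    intro P _
    have h5 : ((Finset.univ.filter fun y : G => orderOf y = q).filter fun y => y ∈ P) =
        (Finset.univ.filter fun y => y ∈ P).erase 1 := by
      ext y
      simp only [Finset.mem_filter, Finset.mem_univ, true_and, Finset.mem_erase]
      refine and_congr_left fun h => ?_
      constructor
      · rintro h1 rfl
        rw [orderOf_one] at h1
        exact hq.one_lt.ne h1
      · intro h1
        have h6 : orderOf y ∣ q := by
          rw [← hP P]
          exact Subgroup.orderOf_dvd_natCard _ h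
        rcases (Nat.dvd_prime hq).1 h6 with h | h
        · exact absurd (orderOf_eq_one_iff.1 h) h1
        · exact h
    rw [h5, Finset.card_erase_of_mem (by simp)]
    congr 1
    refine Eq.trans ?_ (hP P)
    rw [Nat.card_eq_fintype_card, Fintype.card_subtype]
    rfl
  rw [Finset.sum_congr rfl h2, Finset.sum_congr rfl h3, Finset.sum_const, Finset.sum_const,
    smul_eq_mul, smul_eq_mul, Finset.card_univ, mul_one] at h4
  simp_rw [C.orderOf_eq_iff D hq] at h4
  rw [C.card_zero D] at h4
  rw [Nat.card_eq_fintype_card]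
  have h5 := C.sq_eq
  have h6 := C.q_pos D
  apply Nat.eq_of_mul_eq_mul_right (show 0 < q - 1 by omega)
  rw [← h4]
  zify [show 1 ≤ q by omega] at h5 ⊢
  linear_combination -h5

theorem card_normalizer (C : CharData a m δ q k v) (D : DihedralTI a t m)
    [Fact q.Prime] (P : Sylow q G) :
    Nat.card (Subgroup.normalizer (P : Set G)) * (q + 1) = Fintype.card G := by
  rw [← C.card_sylow D, P.card_eq_index_normalizer, Subgroup.card_mul_index,
    Nat.card_eq_fintype_card]

end CharData

end DihedralTI

open scoped OnePoint

section ProjectiveLine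

variable {K : Type*} [Field K]

/-- Unipotent upper triangular matrices. -/
def slTranslation (u : K) : SL(2, K) := ⟨!![1, u; 0, 1], by simp⟩

/-- Diagonal matrices. -/
def slDiagonal (u : K) (hu : u ≠ 0) : SL(2, K) := ⟨!![u, 0; 0, u⁻¹], by simp [hu]⟩

/-- The Weyl element. -/
def slWeyl (K : Type*) [Field K] : SL(2, K) := ⟨!![0, -1; 1, 0], by simp⟩

theorem coe_slTranslation (u : K) :
    (slTranslation u : Matrix (Fin 2) (Fin 2) K) = !![1, u; 0, 1] := rfl

theorem coe_slDiagonal (u : K) (hu : u ≠ 0) :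
    (slDiagonal u hu : Matrix (Fin 2) (Fin 2) K) = !![u, 0; 0, u⁻¹] := rfl

theorem coe_slWeyl : (slWeyl K : Matrix (Fin 2) (Fin 2) K) = !![0, -1; 1, 0] := rfl

variable [DecidableEq K]

/-- The permutation representation of `SL(2, K)` by Möbius transformations. -/
def moebius (K : Type*) [Field K] [DecidableEq K] : SL(2, K) →* Equiv.Perm (OnePoint K) :=
  (MulAction.toPermHom (GL (Fin 2) K) (OnePoint K)).comp Matrix.SpecialLinearGroup.toGL

theorem moebius_infty (A : SL(2, K)) :
    moebius K A ∞ = if A 1 0 = 0 then ∞ else ((A 0 0 / A 1 0 : K) : OnePoint K) :=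
  OnePoint.smul_infty_eq_ite _

theorem moebius_coe (A : SL(2, K)) (x : K) :
    moebius K A x = if A 1 0 * x + A 1 1 = 0 then ∞ else
      (((A 0 0 * x + A 0 1) / (A 1 0 * x + A 1 1) : K) : OnePoint K) :=
  OnePoint.smul_some_eq_ite

theorem moebius_ker : (moebius K).ker = Subgroup.center SL(2, K) := by
  ext A
  rw [MonoidHom.mem_ker, Matrix.SpecialLinearGroup.mem_center_iff]
  constructor
  · intro h
    have h1 : A 1 0 = 0 := by
      have := moebius_infty A
      rw [h] at this
      by_contra h0
      simp [h0] at this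
    have hdet := A.det_coe
    rw [Matrix.det_fin_two, h1, mul_zero, sub_zero] at hdet
    have h11 : A 1 1 ≠ 0 := right_ne_zero_of_mul_eq_one hdet
    have h2 : A 0 1 = 0 := by
      have := moebius_coe A 0
      rw [h] at this
      have h4 : A 0 1 / A 1 1 = 0 := by simpa [h11, eq_comm] using this
      simpa [h11] using h4
    have h3 : A 0 0 = A 1 1 := by
      have := moebius_coe A 1
      rw [h, h1, h2] at this
      simp only [Equiv.Perm.coe_one, id_eq, zero_add, h11, if_false, mul_one, add_zero,
        OnePoint.coe_eq_coe] at this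
      field_simp at this
      exact this.symm
    refine ⟨A 0 0, ?_, ?_⟩
    · rw [Fintype.card_fin, pow_two]
      nth_rw 2 [h3]
      exact hdet
    · ext i j
      fin_cases i <;> fin_cases j <;> simp [h1, h2, h3]
  · rintro ⟨r, hr, hA⟩
    rw [Fintype.card_fin] at hr
    have hr0 : r ≠ 0 := by rintro rfl; simp at hr
    have e : ∀ i j, A i j = (Matrix.scalar (Fin 2) r) i j := fun i j => by rw [hA]
    ext x
    cases x with
    | infty => rw [moebius_infty]; simp [e]
    | coe x => rw [moebius_coe]; simp [e, hr0]

theorem sl_mem_of_generators (L : Subgroup SL(2, K)) (hT : ∀ u, slTranslation u ∈ L)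
    (hD : ∀ u hu, slDiagonal u hu ∈ L) (hW : slWeyl K ∈ L) : L = ⊤ := by
  rw [eq_top_iff]
  intro A _
  have hdet := A.det_coe
  rw [Matrix.det_fin_two] at hdet
  by_cases hc : A 1 0 = 0
  · rw [hc, mul_zero, sub_zero] at hdet
    have h0 : A 0 0 ≠ 0 := left_ne_zero_of_mul_eq_one hdet
    have : A = slDiagonal (A 0 0) h0 * slTranslation (A 0 1 / A 0 0) := by
      ext i j
      fin_cases i <;> fin_cases j <;>
        simp [coe_slDiagonal, coe_slTranslation, hc]
      · field_simp
      · field_simp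
        rw [mul_comm]; exact hdet
    rw [this]
    exact L.mul_mem (hD _ _) (hT _)
  · have : A = slTranslation (A 0 0 / A 1 0) * (slWeyl K * (slDiagonal (A 1 0) hc *
        slTranslation (A 1 1 / A 1 0))) := by
      ext i j
      fin_cases i <;> fin_cases j <;>
        simp [coe_slDiagonal, coe_slTranslation, coe_slWeyl]
      · field_simp
      · field_simp
        linear_combination -hdet
      · field_simp
    rw [this]
    exact L.mul_mem (hT _) (L.mul_mem hW (L.mul_mem (hD _ _) (hT _)))

theorem moebius_slTranslation (u : K) (σ : Equiv.Perm (OnePoint K)) (h1 : σ ∞ = ∞)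
    (h2 : ∀ x : K, σ x = ((x + u : K) : OnePoint K)) : moebius K (slTranslation u) = σ := by
  ext x
  cases x with
  | infty => rw [moebius_infty, h1]; simp [slTranslation]
  | coe x => rw [moebius_coe, h2]; simp [slTranslation]

theorem moebius_slDiagonal (u : K) (hu : u ≠ 0) (σ : Equiv.Perm (OnePoint K)) (h1 : σ ∞ = ∞)
    (h2 : ∀ x : K, σ x = ((u ^ 2 * x : K) : OnePoint K)) : moebius K (slDiagonal u hu) = σ := by
  ext x
  cases x with
  | infty => rw [moebius_infty, h1]; simp [slDiagonal]
  | coe x =>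
    rw [moebius_coe, h2]
    simp only [slDiagonal, Matrix.of_apply, Matrix.cons_val', Matrix.cons_val_zero,
      Matrix.cons_val_one, Matrix.cons_val_fin_one, zero_mul, zero_add, inv_eq_zero, hu, if_false,
      add_zero, OnePoint.coe_eq_coe]
    field_simp

theorem moebius_slWeyl (σ : Equiv.Perm (OnePoint K)) (h1 : σ ∞ = ((0 : K) : OnePoint K))
    (h0 : σ ((0 : K) : OnePoint K) = ∞)
    (h2 : ∀ x : K, x ≠ 0 → σ x = ((-1 / x : K) : OnePoint K)) : moebius K (slWeyl K) = σ := by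
  ext x
  cases x with
  | infty => rw [moebius_infty, h1]; simp [slWeyl]
  | coe x =>
    rw [moebius_coe]
    by_cases hx : x = 0
    · rw [hx, h0]; simp [slWeyl]
    · rw [h2 x hx]
      simp [slWeyl, hx]

/-- Recognition of `PSL(2, K)` among simple groups acting on the projective line. -/
theorem nonempty_mulEquiv_psl {G : Type*} [Group G] [IsSimpleGroup G]
    (ρ : G →* Equiv.Perm (OnePoint K))
    (hT : ∀ u : K, ∃ g, ρ g ∞ = ∞ ∧ ∀ x : K, ρ g x = ((x + u : K) : OnePoint K))
    (hD : ∀ u : K, u ≠ 0 → ∃ g, ρ g ∞ = ∞ ∧ ∀ x : K, ρ g x = ((u ^ 2 * x : K) : OnePoint K))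
    (hW : ∃ g, ρ g ∞ = ((0 : K) : OnePoint K) ∧ ρ g ((0 : K) : OnePoint K) = ∞ ∧
      ∀ x : K, x ≠ 0 → ρ g x = ((-1 / x : K) : OnePoint K))
    (hU : ∃ y, y ≠ 1 ∧ ∀ g, ρ g ∞ = ∞ → ∃ u : K, ρ (g * y * g⁻¹) ∞ = ∞ ∧
      ∀ x : K, ρ (g * y * g⁻¹) x = ((x + u : K) : OnePoint K)) :
    Nonempty (G ≃* PSL(2, K)) := by
  have hle : (moebius K).range ≤ ρ.range := by
    rw [MonoidHom.range_eq_map, Subgroup.map_le_iff_le_comap,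
      sl_mem_of_generators (ρ.range.comap (moebius K))]
    · intro u
      obtain ⟨g, h1, h2⟩ := hT u
      exact ⟨g, (moebius_slTranslation u _ h1 h2).symm⟩
    · intro u hu
      obtain ⟨g, h1, h2⟩ := hD u hu
      exact ⟨g, (moebius_slDiagonal u hu _ h1 h2).symm⟩
    · obtain ⟨g, h1, h0, h2⟩ := hW
      exact ⟨g, (moebius_slWeyl _ h1 h0 h2).symm⟩
  obtain ⟨y, hy1, hy⟩ := hU
  have hinj : Function.Injective ρ := by
    rw [← MonoidHom.ker_eq_bot_iff]
    rcases Subgroup.Normal.eq_bot_or_eq_top (H := ρ.ker) inferInstance with h | h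
    · exact h
    · exfalso
      obtain ⟨g, h1, -⟩ := hW
      have : ρ g = 1 := by rw [← MonoidHom.mem_ker, h]; trivial
      rw [this] at h1
      simp at h1
  have htrans : ∀ x : OnePoint K, ∃ A, moebius K A ∞ = x := by
    intro x
    cases x with
    | infty => exact ⟨1, by simp⟩
    | coe x =>
      refine ⟨slTranslation x * slWeyl K, ?_⟩
      rw [moebius_infty]
      simp [coe_slTranslation, coe_slWeyl]
  have hge : ρ.range ≤ (moebius K).range := by
    have hK : (moebius K).range.comap ρ = ⊤ := by
      rw [eq_top_iff]
      have hn : Subgroup.normalClosure {y} = ⊤ := by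
        rcases Subgroup.Normal.eq_bot_or_eq_top (H := Subgroup.normalClosure {y}) inferInstance
          with h | h
        · exact absurd (Subgroup.mem_bot.1 (h ▸ Subgroup.subset_normalClosure rfl)) hy1
        · exact h
      rw [← hn, Subgroup.normalClosure, Subgroup.closure_le]
      intro z hz
      obtain ⟨y', rfl, hyz⟩ := Group.mem_conjugatesOfSet_iff.1 hz
      obtain ⟨g, rfl⟩ := isConj_iff.1 hyz
      obtain ⟨A, hA⟩ := htrans (ρ g ∞)
      obtain ⟨k, hk⟩ := hle ⟨A, rfl⟩
      have h1 : ρ (k⁻¹ * g) ∞ = ∞ := by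
        rw [map_mul, map_inv, hk, Equiv.Perm.mul_apply, ← hA, Equiv.Perm.inv_eq_iff_eq]
      obtain ⟨u, h2, h3⟩ := hy _ h1
      refine ⟨A * slTranslation u * A⁻¹, ?_⟩
      rw [map_mul, map_mul, moebius_slTranslation u _ h2 h3, map_inv, ← hk, ← map_inv, ← map_mul,
        ← map_mul]
      congr 1
      group
    rw [MonoidHom.range_eq_map, Subgroup.map_le_iff_le_comap, hK]
  have heq := le_antisymm hge hle
  exact ⟨(MonoidHom.ofInjective hinj).trans ((MulEquiv.subgroupCongr heq).trans
    ((QuotientGroup.quotientMulEquivOfEq (moebius_ker (K := K)).symm).trans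
      (QuotientGroup.quotientKerEquivRange (moebius K))).symm)⟩

end ProjectiveLine

section ZModPow

variable {G : Type*} [Group G] {p : ℕ} [NeZero p]

/-- The power of `y` with exponent a residue modulo `p`. -/
def zmodPow (y : G) (c : ZMod p) : G := y ^ c.val

theorem zmodPow_natCast {y : G} (hy : orderOf y = p) (k : ℕ) :
    zmodPow y (k : ZMod p) = y ^ k := by
  rw [zmodPow, ZMod.val_natCast, ← hy, pow_mod_orderOf]

theorem zmodPow_zero (y : G) : zmodPow y (0 : ZMod p) = 1 := by
  simp [zmodPow]

theorem zmodPow_add {y : G} (hy : orderOf y = p) (c d : ZMod p) :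
    zmodPow y (c + d) = zmodPow y c * zmodPow y d := by
  rw [← ZMod.natCast_zmod_val c, ← ZMod.natCast_zmod_val d, ← Nat.cast_add,
    zmodPow_natCast hy, zmodPow_natCast hy, zmodPow_natCast hy, pow_add]

theorem zmodPow_neg {y : G} (hy : orderOf y = p) (c : ZMod p) :
    zmodPow y (-c) = (zmodPow y c)⁻¹ := by
  rw [eq_inv_iff_mul_eq_one, ← zmodPow_add hy, neg_add_cancel, zmodPow_zero]

theorem zmodPow_eq_one {y : G} (hy : orderOf y = p) {c : ZMod p} (h : zmodPow y c = 1) :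
    c = 0 := by
  rw [zmodPow, ← orderOf_dvd_iff_pow_eq_one, hy] at h
  rw [← ZMod.natCast_zmod_val c]
  exact (ZMod.natCast_eq_zero_iff _ _).2 h

theorem zmodPow_injective {y : G} (hy : orderOf y = p) :
    Function.Injective (zmodPow (p := p) y) := by
  intro c d h
  rw [← sub_eq_zero]
  apply zmodPow_eq_one hy
  rw [sub_eq_add_neg, zmodPow_add hy, zmodPow_neg hy, h, mul_inv_cancel]

theorem zmodPow_mem_zpowers (y : G) (c : ZMod p) : zmodPow y c ∈ Subgroup.zpowers y :=
  Subgroup.pow_mem _ (Subgroup.mem_zpowers y) _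

theorem exists_eq_zmodPow [Finite G] {y : G} (hy : orderOf y = p) {c : G}
    (h : c ∈ Subgroup.zpowers y) : ∃ d : ZMod p, c = zmodPow y d := by
  obtain ⟨k, rfl⟩ := (mem_powers_iff_mem_zpowers.2 h)
  exact ⟨(k : ZMod p), (zmodPow_natCast hy k).symm⟩

theorem conj_zmodPow {y : G} (hy : orderOf y = p) {n : G} {s : ZMod p}
    (h : n * y * n⁻¹ = zmodPow y s) (c : ZMod p) :
    n * zmodPow y c * n⁻¹ = zmodPow y (s * c) := by
  rw [← ZMod.natCast_zmod_val s, ← ZMod.natCast_zmod_val c, ← Nat.cast_mul,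
    zmodPow_natCast hy, zmodPow_natCast hy, pow_mul, ← conj_pow, h, zmodPow]

end ZModPow

/-- An element of a group acting on the projective line over `ZMod p` in coordinates
given by a base point `O`, a point `P` at infinity and a generator `y` of the translations. -/
structure LineAction (p : ℕ) [Fact p.Prime] {G Ω : Type*} [Group G] [MulAction G Ω]
    (y : G) (P O : Ω) : Prop where
  order : orderOf y = p
  fix : y • P = P
  ne : O ≠ P
  free : ∀ c : ZMod p, zmodPow y c • O = O → c = 0
  surj : ∀ R, R ≠ P → ∃ c : ZMod p, zmodPow y c • O = R
  odd : ∀ (g : G) (R : Ω), g • R = R → Odd (orderOf g)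
  norm : ∀ g : G, g • P = P → ∃ s : ZMod p, g * y * g⁻¹ = zmodPow y s
  cent : ∀ c : G, Commute c y → c ∈ Subgroup.zpowers y
  inv : ∀ w c : G, orderOf w = 2 → Commute c w → Odd (orderOf c) → c = 1
  scale : ∀ u : ZMod p, u ≠ 0 → ∃ h : G, h • P = P ∧ h • O = O ∧
    ∀ c : ZMod p, h * zmodPow y c * h⁻¹ = zmodPow y (u ^ 2 * c)
  swap : ∃ g : G, g • P = O

theorem ZMod.isSquare_or_isSquare_neg {p : ℕ} [Fact p.Prime] (hp : p % 4 = 3) (x : ZMod p) :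
    IsSquare x ∨ IsSquare (-x) := by
  by_cases hx : IsSquare x
  · exact Or.inl hx
  right
  have hp2 : p ≠ 2 := by rintro rfl; omega
  have hr : ringChar (ZMod p) ≠ 2 := by rwa [ZMod.ringChar_zmod_n]
  have hx0 : x ≠ 0 := by rintro rfl; exact hx (IsSquare.zero)
  have h1 : ¬ IsSquare (-1 : ZMod p) := by
    rw [ZMod.exists_sq_eq_neg_one_iff]; simp [hp]
  have e1 := (quadraticChar_neg_one_iff_not_isSquare (F := ZMod p)).2 hx
  have e2 := (quadraticChar_neg_one_iff_not_isSquare (F := ZMod p)).2 h1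
  rw [← quadraticChar_one_iff_isSquare (neg_ne_zero.2 hx0), ← neg_one_mul, map_mul, e1, e2]
  norm_num

namespace LineAction

variable {p : ℕ} [Fact p.Prime] {G Ω : Type*} [Group G] [MulAction G Ω] [Finite G]
  {y : G} {P O : Ω}

theorem fix_zmodPow (A : LineAction p y P O) (c : ZMod p) : zmodPow y c • P = P := by
  have : y ∈ MulAction.stabilizer G P := A.fix
  exact Subgroup.pow_mem _ this c.val

theorem smul_inj (A : LineAction p y P O) {c d : ZMod p}
    (h : zmodPow y c • O = zmodPow y d • O) : c = d := by
  rw [← sub_eq_zero]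
  apply A.free
  rw [sub_eq_add_neg, add_comm, zmodPow_add A.order, mul_smul, h, ← mul_smul,
    ← zmodPow_add A.order, neg_add_cancel, zmodPow_zero, one_smul]

theorem smul_ne (A : LineAction p y P O) (c : ZMod p) : zmodPow y c • O ≠ P := by
  intro h
  exact A.ne (MulAction.injective (zmodPow y c) (h.trans (A.fix_zmodPow c).symm))

/-- The value of the involution exchanging the two base points. -/
theorem exists_involution (A : LineAction p y P O) :
    ∃ w : G, orderOf w = 2 ∧ w • P = O ∧ w • O = P := by
  obtain ⟨g, hg⟩ := A.swap
  have hne : g⁻¹ • P ≠ P := by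
    intro h
    rw [inv_smul_eq_iff, hg] at h
    exact A.ne h.symm
  obtain ⟨c, hc⟩ := A.surj _ hne
  set w₀ := g * zmodPow y c with hw₀
  have h1 : w₀ • P = O := by rw [hw₀, mul_smul, A.fix_zmodPow, hg]
  have h2 : w₀ • O = P := by rw [hw₀, mul_smul, hc, smul_inv_smul]
  have h3 : (w₀ ^ 2) • P = P := by rw [pow_two, mul_smul, h1, h2]
  have h3' : (w₀ ^ 2) • O = O := by rw [pow_two, mul_smul, h2, h1]
  obtain ⟨k, hk⟩ := A.odd _ _ h3
  have h4 : w₀ ^ orderOf (w₀ ^ 2) • P = O := by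
    rw [hk, pow_succ', mul_smul, pow_mul]
    have : w₀ ^ 2 ∈ MulAction.stabilizer G P := h3
    rw [(Subgroup.pow_mem _ this k : (w₀ ^ 2) ^ k • P = P), h1]
  have h5 : w₀ ^ orderOf (w₀ ^ 2) • O = P := by
    rw [hk, pow_succ', mul_smul, pow_mul]
    have : w₀ ^ 2 ∈ MulAction.stabilizer G O := h3'
    rw [(Subgroup.pow_mem _ this k : (w₀ ^ 2) ^ k • O = O), h2]
  refine ⟨_, ?_, h4, h5⟩
  apply orderOf_eq_prime
  · rw [← pow_mul, mul_comm, pow_mul, pow_orderOf_eq_one]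
  · intro h
    rw [h, one_smul] at h4
    exact A.ne h4.symm

theorem eq_one_of_commute (A : LineAction p y P O) {c : G} (h : Commute c y) (hO : c • O = O) :
    c = 1 := by
  obtain ⟨d, rfl⟩ := exists_eq_zmodPow A.order (A.cent c h)
  rw [A.free d hO, zmodPow_zero]

/-- Elements fixing both base points commute with each other. -/
theorem commute_of_fix (A : LineAction p y P O) {g h : G} (hgP : g • P = P) (hgO : g • O = O)
    (hhP : h • P = P) (hhO : h • O = O) : Commute g h := by
  obtain ⟨s, hs⟩ := A.norm g hgP
  obtain ⟨r, hr⟩ := A.norm h hhP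
  have e1 : ∀ c : ZMod p, g * zmodPow y c * g⁻¹ = zmodPow y (s * c) := conj_zmodPow A.order hs
  have e2 : ∀ c : ZMod p, h * zmodPow y c * h⁻¹ = zmodPow y (r * c) := conj_zmodPow A.order hr
  have hy1 : zmodPow y (1 : ZMod p) = y := by
    have := zmodPow_natCast A.order 1
    simpa using this
  have k1 : (g * h) * y * (g * h)⁻¹ = zmodPow y (s * r) := by
    rw [← e1, ← hr]; group
  have k2 : (h * g) * y * (h * g)⁻¹ = zmodPow y (s * r) := by
    rw [mul_comm s r, ← e2, ← hs]; group
  have : (h * g)⁻¹ * (g * h) = 1 := by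
    apply A.eq_one_of_commute
    · have k3 : (h * g)⁻¹ * ((g * h) * y * (g * h)⁻¹) * (h * g) = y := by
        rw [k1, ← k2]; group
      change (h * g)⁻¹ * (g * h) * y = y * ((h * g)⁻¹ * (g * h))
      nth_rewrite 2 [← k3]
      group
    · have f1 : (h * g) • O = O := by rw [mul_smul, hgO, hhO]
      rw [mul_smul, mul_smul, hhO, hgO, inv_smul_eq_iff, f1]
  rw [inv_mul_eq_one] at this
  exact this.symm

theorem conj_eq_inv (A : LineAction p y P O) {w h : G} (hw : orderOf w = 2) (hwP : w • P = O)
    (hwO : w • O = P) (hhP : h • P = P) (hhO : h • O = O) : w * h * w⁻¹ = h⁻¹ := by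
  have hww : w⁻¹ = w := by
    rw [inv_eq_iff_mul_eq_one, ← pow_two, ← hw, pow_orderOf_eq_one]
  have hww' : w * w = 1 := by rw [← pow_two, ← hw, pow_orderOf_eq_one]
  set k := w * h * w with hk
  have kP : k • P = P := by rw [hk, mul_smul, mul_smul, hwP, hhO, hwO]
  have kO : k • O = O := by rw [hk, mul_smul, mul_smul, hwO, hhP, hwP]
  have hc := A.commute_of_fix hhP hhO kP kO
  have : h * k = 1 := by
    apply A.inv w _ hw
    · change h * k * w = w * (h * k)
      calc h * k * w = h * w * h * (w * w) := by rw [hk]; group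
        _ = (w * w) * h * w * h := by rw [hww', mul_one, one_mul]
        _ = w * (k * h) := by rw [hk]; group
        _ = w * (h * k) := by rw [hc.eq]
    · apply A.odd _ P
      rw [mul_smul, kP, hhP]
  rw [hww, ← hk, eq_inv_iff_mul_eq_one, ← hc.eq, this]

/-- An element whose action in coordinates is `x ↦ -1 / x`. -/
theorem exists_weyl (A : LineAction p y P O) (hp : p % 4 = 3) :
    ∃ g : G, g • P = O ∧ g • O = P ∧ ∀ c : ZMod p, c ≠ 0 →
      g • zmodPow y c • O = zmodPow y (-1 / c) • O := by
  obtain ⟨w, hw, hwP, hwO⟩ := A.exists_involution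
  have hww' : w * w = 1 := by rw [← pow_two, ← hw, pow_orderOf_eq_one]
  have hscale : ∀ u : ZMod p, u ≠ 0 → ∀ c d : ZMod p,
      w • zmodPow y c • O = zmodPow y d • O →
      w • zmodPow y (u ^ 2 * c) • O = zmodPow y ((u⁻¹) ^ 2 * d) • O := by
    intro u hu c d h
    obtain ⟨g, gP, gO, hg⟩ := A.scale u hu
    have gO' : g⁻¹ • O = O := by rw [inv_smul_eq_iff, gO]
    have hinv := A.conj_eq_inv hw hwP hwO gP gO
    have hg' : g⁻¹ * zmodPow y d * g = zmodPow y ((u⁻¹) ^ 2 * d) := by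
      have := hg ((u⁻¹) ^ 2 * d)
      rw [← mul_assoc, ← mul_pow, mul_inv_cancel₀ hu, one_pow, one_mul] at this
      rw [← this]; group
    rw [← hg, ← hg', mul_smul, mul_smul, gO', mul_smul, mul_smul, gO, ← h, ← mul_smul w g]
    rw [mul_inv_eq_iff_eq_mul] at hinv
    rw [hinv, mul_smul]
  have hsymm : ∀ c d : ZMod p, w • zmodPow y c • O = zmodPow y d • O →
      w • zmodPow y d • O = zmodPow y c • O := by
    intro c d h
    rw [← h, ← mul_smul w w, hww', one_smul]
  have hfix : ∀ c : ZMod p, w • zmodPow y c • O ≠ zmodPow y c • O := by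
    intro c h
    have := A.odd _ _ h
    rw [hw] at this
    exact absurd this (by decide)
  have hex : ∀ c : ZMod p, c ≠ 0 → ∃ d : ZMod p, d ≠ 0 ∧ w • zmodPow y c • O = zmodPow y d • O := by
    intro c hc
    have : w • zmodPow y c • O ≠ P := by
      intro h
      rw [← hwO] at h
      exact hc (A.free c (MulAction.injective w h))
    obtain ⟨d, hd⟩ := A.surj _ this
    refine ⟨d, ?_, hd.symm⟩
    rintro rfl
    rw [zmodPow_zero, one_smul] at hd
    exact A.smul_ne c (MulAction.injective w (hd.symm.trans hwP.symm))
  obtain ⟨b, hb0, hb⟩ := hex 1 one_ne_zero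
  have hbs : ¬ IsSquare b := by
    rintro ⟨f, hf⟩
    have hf0 : f ≠ 0 := by rintro rfl; simp at hf; exact hb0 hf
    have : ∃ e : ZMod p, e * e = f ∨ e * e = -f := by
      rcases ZMod.isSquare_or_isSquare_neg hp f with ⟨e, he⟩ | ⟨e, he⟩
      · exact ⟨e, Or.inl he.symm⟩
      · exact ⟨e, Or.inr he.symm⟩
    obtain ⟨e, he⟩ := this
    have he0 : e ≠ 0 := by
      rintro rfl
      rcases he with he | he <;> simp at he <;> exact hf0 (by simp [he])
    have hb2 : b = e ^ 4 := by
      rcases he with he | he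
      · rw [hf, ← he]; ring
      · rw [hf, ← neg_mul_neg, ← he]; ring
    have := hscale e he0 1 b hb
    apply hfix (e ^ 2)
    rw [mul_one] at this
    rw [this]
    congr 2
    rw [hb2]; field_simp
  obtain ⟨e, he⟩ := (ZMod.isSquare_or_isSquare_neg hp b).resolve_left hbs
  have he0 : e ≠ 0 := by
    rintro rfl
    simp at he; exact hb0 he
  have hall : ∀ c : ZMod p, c ≠ 0 → w • zmodPow y c • O = zmodPow y (b / c) • O := by
    intro c hc
    rcases ZMod.isSquare_or_isSquare_neg hp c with ⟨u, hu⟩ | ⟨u, hu⟩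
    · have hu0 : u ≠ 0 := by rintro rfl; simp at hu; exact hc hu
      have := hscale u hu0 1 b hb
      rw [mul_one, pow_two, ← hu] at this
      rw [this]
      congr 2
      rw [hu]; field_simp
    · have hu0 : u ≠ 0 := by rintro rfl; simp at hu; exact hc hu
      have := hscale (u / e) (div_ne_zero hu0 he0) b 1 (hsymm _ _ hb)
      have hc' : (u / e) ^ 2 * b = c := by
        have hb' : b = -(e * e) := by rw [← he, neg_neg]
        have hc' : c = -(u * u) := by rw [← hu, neg_neg]
        rw [hb', hc']; field_simp
      rw [hc'] at this
      rw [this]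
      congr 2
      rw [← hc']; field_simp
  obtain ⟨g, gP, gO, hg⟩ := A.scale e⁻¹ (inv_ne_zero he0)
  have gO' : g⁻¹ • O = O := by rw [inv_smul_eq_iff, gO]
  refine ⟨g * w, by rw [mul_smul, hwP, gO], by rw [mul_smul, hwO, gP], ?_⟩
  intro c hc
  rw [mul_smul, hall c hc]
  have := hg (b / c)
  have e3 : g • zmodPow y (b / c) • O = (g * zmodPow y (b / c) * g⁻¹) • O := by
    rw [mul_smul, mul_smul, gO']
  rw [e3, this]
  congr 2
  have hb' : b = -(e * e) := by rw [← he, neg_neg]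
  rw [hb']; field_simp

end LineAction

namespace LineAction

variable {p : ℕ} [Fact p.Prime] {G Ω : Type*} [Group G] [MulAction G Ω] [Finite G]
  {y : G} {P O : Ω}

/-- The point with a given projective coordinate. -/
def point (y : G) (P O : Ω) : OnePoint (ZMod p) → Ω
  | none => P
  | some c => zmodPow y c • O

theorem point_infty (y : G) (P O : Ω) : point (p := p) y P O ∞ = P := rfl

theorem point_coe (y : G) (P O : Ω) (c : ZMod p) :
    point y P O (c : OnePoint (ZMod p)) = zmodPow y c • O := rfl

theorem point_bijective (A : LineAction p y P O) :
    Function.Bijective (point (p := p) y P O) := by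
  constructor
  · rintro (_ | c) (_ | d) h
    · rfl
    · exact absurd h.symm (A.smul_ne d)
    · exact absurd h (A.smul_ne c)
    · exact congrArg _ (A.smul_inj h)
  · intro R
    by_cases hR : R = P
    · exact ⟨∞, hR.symm⟩
    · obtain ⟨c, hc⟩ := A.surj R hR
      exact ⟨(c : OnePoint (ZMod p)), hc⟩

/-- The action in coordinates. -/
noncomputable def coordHom (A : LineAction p y P O) : G →* Equiv.Perm (OnePoint (ZMod p)) :=
  ((Equiv.ofBijective _ A.point_bijective).symm.permCongrHom : _ →* _).comp
    (MulAction.toPermHom G Ω)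

theorem coordHom_eq_iff (A : LineAction p y P O) (g : G) (a b : OnePoint (ZMod p)) :
    A.coordHom g a = b ↔ g • point y P O a = point y P O b := by
  change (Equiv.ofBijective _ A.point_bijective).symm
    (g • Equiv.ofBijective _ A.point_bijective a) = b ↔ _
  rw [Equiv.symm_apply_eq]
  rfl

theorem nonempty_mulEquiv_psl [IsSimpleGroup G] (A : LineAction p y P O) (hp : p % 4 = 3) :
    Nonempty (G ≃* PSL(2, ZMod p)) := by
  have htrans : ∀ u : ZMod p, A.coordHom (zmodPow y u) ∞ = ∞ ∧
      ∀ x : ZMod p, A.coordHom (zmodPow y u) x = ((x + u : ZMod p) : OnePoint (ZMod p)) := by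
    intro u
    refine ⟨?_, fun x => ?_⟩
    · rw [coordHom_eq_iff, point_infty, A.fix_zmodPow]
    · rw [coordHom_eq_iff, point_coe, point_coe, ← mul_smul, ← zmodPow_add A.order, add_comm]
  apply _root_.nonempty_mulEquiv_psl A.coordHom
  · intro u
    exact ⟨_, htrans u⟩
  · intro u hu
    obtain ⟨h, hP, hO, hh⟩ := A.scale u hu
    refine ⟨h, ?_, fun x => ?_⟩
    · rw [coordHom_eq_iff, point_infty, hP]
    · rw [coordHom_eq_iff, point_coe, point_coe, ← hh, mul_smul, mul_smul,
        inv_smul_eq_iff.2 hO.symm]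
  · obtain ⟨g, gP, gO, hg⟩ := A.exists_weyl hp
    have h0 : point y P O ((0 : ZMod p) : OnePoint (ZMod p)) = O := by
      rw [point_coe, zmodPow_zero, one_smul]
    refine ⟨g, ?_, ?_, fun x hx => ?_⟩
    · rw [coordHom_eq_iff, h0, point_infty, gP]
    · rw [coordHom_eq_iff, h0, point_infty, gO]
    · rw [coordHom_eq_iff, point_coe, point_coe, hg x hx]
  · refine ⟨y, ?_, ?_⟩
    · intro h
      have := A.order
      rw [h, orderOf_one] at this
      exact (Fact.out : p.Prime).one_lt.ne this
    · intro g hg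
      rw [coordHom_eq_iff, point_infty] at hg
      obtain ⟨s, hs⟩ := A.norm g hg
      exact ⟨s, hs ▸ htrans s⟩

end LineAction

section Sylow

variable {G : Type*} [Group G] [Finite G] {p : ℕ} [Fact p.Prime]

/-- The index two subgroup of the multiplicative group consists of the squares: a subgroup
acting on `⟨y⟩` realises multiplication by all squares. -/
theorem exists_conj_eq_zmodPow_sq {y : G} (hy : orderOf y = p)
    (hc : ∀ c : G, Commute c y → c ∈ Subgroup.zpowers y) (T : Subgroup G) (hyT : y ∈ T)
    (hT : ∀ g ∈ T, ∃ s : ZMod p, g * y * g⁻¹ = zmodPow y s)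
    (hcard : Nat.card T * 2 = p * (p - 1)) (u : ZMod p) (hu : u ≠ 0) :
    ∃ g ∈ T, g * y * g⁻¹ = zmodPow y (u ^ 2) := by
  have hy1 : zmodPow y (1 : ZMod p) = y := by
    have := zmodPow_natCast hy 1
    simpa using this
  choose s hs using fun g : T => hT g g.2
  let f : T →* ZMod p :=
    { toFun := s
      map_one' := by
        apply zmodPow_injective hy
        rw [← hs, hy1]; simp
      map_mul' := by
        intro g h
        apply zmodPow_injective hy
        rw [← conj_zmodPow hy (hs g), ← hs h, ← hs]
        simp [mul_assoc] }
  let F : T →* (ZMod p)ˣ := f.toHomUnits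
  have hF : ∀ g, (F g : ZMod p) = s g := fun g => rfl
  have hker : Nat.card F.ker = p := by
    have : F.ker.map T.subtype = Subgroup.zpowers y := by
      ext g
      constructor
      · rintro ⟨g, hg, rfl⟩
        have h1 : s g = 1 := by rw [← hF, MonoidHom.mem_ker.1 hg]; rfl
        have := hs g
        rw [h1, hy1, mul_inv_eq_iff_eq_mul] at this
        exact hc _ this
      · intro hg
        have hgT : g ∈ T := (Subgroup.zpowers_le.2 hyT) hg
        refine ⟨⟨g, hgT⟩, ?_, rfl⟩
        rw [SetLike.mem_coe, MonoidHom.mem_ker]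
        ext
        rw [hF]
        apply zmodPow_injective hy
        rw [← hs, Units.val_one, hy1]
        obtain ⟨k, rfl⟩ := hg
        simp only
        group
    have e : Nat.card (F.ker.map T.subtype) = Nat.card F.ker := Subgroup.card_map_of_injective
      T.subtype_injective
    rw [this, Nat.card_zpowers] at e
    exact e.symm.trans hy
  have hp := (Fact.out : p.Prime)
  have hrange : F.range.index = 2 := by
    have e1 : Nat.card F.range * p = Nat.card T := by
      have e := Subgroup.card_mul_index F.ker
      rwa [hker, Subgroup.index_ker, mul_comm] at e
    have e2 : Nat.card F.range * F.range.index = p - 1 := by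
      rw [Subgroup.card_mul_index, Nat.card_eq_fintype_card, ZMod.card_units]
    have e3 : Nat.card F.range * 2 = p - 1 := by
      apply Nat.eq_of_mul_eq_mul_left hp.pos
      rw [← hcard, ← e1]; ring
    exact Nat.eq_of_mul_eq_mul_left Nat.card_pos (e2.trans e3.symm)
  obtain ⟨g, hg⟩ := Subgroup.sq_mem_of_index_two hrange (Units.mk0 u hu)
  refine ⟨g, g.2, ?_⟩
  rw [hs, ← hF, hg]
  simp

theorem Sylow.eq_of_mem_of_mem (hP : ∀ P : Sylow p G, Nat.card P = p) {P R : Sylow p G} {z : G}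
    (hz : z ≠ 1) (h1 : z ∈ P) (h2 : z ∈ R) : P = R := by
  have key : ∀ S : Sylow p G, z ∈ S → Subgroup.zpowers z = (S : Subgroup G) := by
    intro S hS
    have hle : Subgroup.zpowers z ≤ (S : Subgroup G) := Subgroup.zpowers_le.2 hS
    apply Subgroup.eq_of_le_of_card_ge hle
    have hd : orderOf z ∣ p := by
      rw [← hP S, ← Nat.card_zpowers]
      exact Subgroup.card_dvd_of_le hle
    rw [Nat.card_zpowers]
    rcases (Nat.dvd_prime Fact.out).1 hd with h | h
    · exact absurd (orderOf_eq_one_iff.1 h) hz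
    · rw [h]; exact (hP S).le
  exact Sylow.ext ((key P h1).symm.trans (key R h2))

theorem exists_lineAction (hp4 : p % 4 = 3) (hΩ : Nat.card (Sylow p G) = p + 1)
    (hcard : ∀ P : Sylow p G,
      Nat.card (Subgroup.normalizer (P : Set G)) * 2 = p * (p - 1))
    (hP : ∀ P : Sylow p G, Nat.card P = p)
    (hc : ∀ y c : G, orderOf y = p → Commute c y → c ∈ Subgroup.zpowers y)
    (hinv : ∀ w c : G, orderOf w = 2 → Commute c w → Odd (orderOf c) → c = 1) :
    ∃ (y : G) (P O : Sylow p G), LineAction p y P O := by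
  have hp := (Fact.out : p.Prime)
  have hnt : Nontrivial (Sylow p G) := by
    rw [← Finite.one_lt_card_iff_nontrivial, hΩ]
    have := hp.pos
    omega
  obtain ⟨P, O, hne⟩ := exists_pair_ne (Sylow p G)
  obtain ⟨⟨y, hyP⟩, hy⟩ := exists_prime_orderOf_dvd_card' (G := P) p (by rw [hP])
  rw [Subgroup.orderOf_mk] at hy
  have hy1 : y ≠ 1 := by rintro rfl; rw [orderOf_one] at hy; exact hp.one_lt.ne hy
  have hPy : Subgroup.zpowers y = (P : Subgroup G) := by
    apply Subgroup.eq_of_le_of_card_ge (Subgroup.zpowers_le.2 hyP)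
    rw [Nat.card_zpowers, hy]
    exact (hP P).le
  have hfix : ∀ g : G, ∀ R : Sylow p G, g ∈ R → g • R = R := by
    intro g R h
    rw [Sylow.smul_eq_iff_mem_normalizer]
    exact Subgroup.le_normalizer h
  have hfree : ∀ c : ZMod p, zmodPow y c • O = O → c = 0 := by
    intro c h
    rw [Sylow.smul_eq_iff_mem_normalizer] at h
    have hmP : zmodPow y c ∈ P := by
      have := zmodPow_mem_zpowers y c
      rw [hPy] at this
      exact this
    have hmO : zmodPow y c ∈ O := by
      have := IsPGroup.inf_normalizer_sylow P.2 O
      have h3 : zmodPow y c ∈ (P : Subgroup G) ⊓ Subgroup.normalizer (O : Set G) := ⟨hmP, h⟩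
      rw [this] at h3
      exact h3.2
    by_contra hc0
    exact hne (Sylow.eq_of_mem_of_mem hP (fun h1 => hc0 (zmodPow_eq_one hy h1)) hmP hmO)
  have hfixP : ∀ c : ZMod p, zmodPow y c • P = P := by
    intro c
    apply hfix
    have := zmodPow_mem_zpowers y c
    rw [hPy] at this
    exact this
  have hsurj : ∀ R, R ≠ P → ∃ c : ZMod p, zmodPow y c • O = R := by
    have hbij : Function.Bijective (LineAction.point (p := p) y P O) := by
      have : Finite (OnePoint (ZMod p)) := inferInstanceAs (Finite (Option (ZMod p)))
      rw [Nat.bijective_iff_injective_and_card]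
      constructor
      · have hn : ∀ c : ZMod p, zmodPow y c • O ≠ P := by
          intro c h
          exact hne.symm (MulAction.injective (zmodPow y c) (h.trans (hfixP c).symm))
        rintro (_ | c) (_ | d) h
        · rfl
        · exact absurd h.symm (hn d)
        · exact absurd h (hn c)
        · have h' : zmodPow y c • O = zmodPow y d • O := h
          refine congrArg some ?_
          rw [← sub_eq_zero]
          apply hfree
          rw [sub_eq_add_neg, add_comm, zmodPow_add hy, mul_smul, h', ← mul_smul,
            ← zmodPow_add hy, neg_add_cancel, zmodPow_zero, one_smul]
      · rw [hΩ]
        change Nat.card (Option (ZMod p)) = _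
        rw [Finite.card_option, Nat.card_zmod]
    intro R hR
    obtain ⟨c, rfl⟩ := hbij.2 R
    rcases c with _ | c
    · exact absurd rfl hR
    · exact ⟨c, rfl⟩
  have hnorm : ∀ g : G, g • P = P → ∃ s : ZMod p, g * y * g⁻¹ = zmodPow y s := by
    intro g hg
    apply exists_eq_zmodPow hy
    rw [Sylow.smul_eq_iff_mem_normalizer] at hg
    rw [hPy]
    exact (Subgroup.mem_normalizer_iff.1 hg y).1 hyP
  have hmem : ∀ g : G, g ∈ Subgroup.normalizer (P : Set G) ↔ g • P = P := fun g =>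
    (Sylow.smul_eq_iff_mem_normalizer).symm
  have hscale : ∀ u : ZMod p, u ≠ 0 → ∃ h : G, h • P = P ∧ h • O = O ∧
      ∀ c : ZMod p, h * zmodPow y c * h⁻¹ = zmodPow y (u ^ 2 * c) := by
    intro u hu
    obtain ⟨g, hgT, hg⟩ := exists_conj_eq_zmodPow_sq hy (fun c => hc y c hy)
      (Subgroup.normalizer (P : Set G)) (Subgroup.le_normalizer hyP)
      (fun g hg => hnorm g ((hmem g).1 hg)) (hcard P) u hu
    have hgP := (hmem g).1 hgT
    have hgO : g • O ≠ P := by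
      intro h
      exact hne.symm (MulAction.injective g (h.trans hgP.symm))
    obtain ⟨d, hd⟩ := hsurj _ hgO
    refine ⟨zmodPow y (-d) * g, ?_, ?_, ?_⟩
    · rw [mul_smul, hgP, hfixP]
    · rw [mul_smul, ← hd, ← mul_smul, ← zmodPow_add hy, neg_add_cancel, zmodPow_zero, one_smul]
    · intro c
      have := conj_zmodPow hy hg c
      calc zmodPow y (-d) * g * zmodPow y c * (zmodPow y (-d) * g)⁻¹
          = zmodPow y (-d) * (g * zmodPow y c * g⁻¹) * (zmodPow y (-d))⁻¹ := by group
        _ = zmodPow y (u ^ 2 * c) := by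
          rw [this, ← zmodPow_neg hy, ← zmodPow_add hy, ← zmodPow_add hy]
          congr 1; ring
  refine ⟨y, P, O, ⟨hy, hfix y P hyP, hne.symm, hfree, hsurj, ?_, hnorm,
    fun c => hc y c hy, hinv, hscale, MulAction.exists_smul_eq G P O⟩⟩
  intro g R hg
  rw [Sylow.smul_eq_iff_mem_normalizer] at hg
  have h1 : orderOf g ∣ Nat.card (Subgroup.normalizer (R : Set G)) :=
    Subgroup.orderOf_dvd_natCard _ hg
  have h2 : Odd (Nat.card (Subgroup.normalizer (R : Set G))) := by
    rw [← Nat.not_even_iff_odd]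
    rintro ⟨k, hk⟩
    have h3 := hcard R
    obtain ⟨j, hj⟩ : ∃ j, p = 4 * j + 3 := ⟨p / 4, by omega⟩
    rw [hk, hj, Nat.add_sub_assoc (by norm_num)] at h3
    have h4 : (4 * j + 3) * (4 * j + (3 - 1)) = 2 * (2 * (4 * j * j + 5 * j + 1) + 1) := by ring
    rw [h4] at h3
    omega
  exact h2.of_dvd_nat h1

theorem nonempty_mulEquiv_psl_of_sylow [IsSimpleGroup G]
    (hp4 : p % 4 = 3) (hΩ : Nat.card (Sylow p G) = p + 1)
    (hcard : ∀ P : Sylow p G,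
      Nat.card (Subgroup.normalizer (P : Set G)) * 2 = p * (p - 1))
    (hP : ∀ P : Sylow p G, Nat.card P = p)
    (hc : ∀ y c : G, orderOf y = p → Commute c y → c ∈ Subgroup.zpowers y)
    (hinv : ∀ w c : G, orderOf w = 2 → Commute c w → Odd (orderOf c) → c = 1) :
    Nonempty (G ≃* PSL(2, ZMod p)) := by
  obtain ⟨y, P, O, A⟩ := exists_lineAction hp4 hΩ hcard hP hc hinv
  exact A.nonempty_mulEquiv_psl hp4

end Sylow

theorem Subgroup.isSolvable_normalizer_of_isCyclic {G : Type*} [Group G] [Finite G]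
    {P : Subgroup G} [IsCyclic P] (hc : Subgroup.centralizer (P : Set G) ≤ P) :
    Group.IsSolvable (Subgroup.normalizer (P : Set G)) := by
  have h1 : Group.IsSolvable (MulAut P) := by
    apply Group.isSolvable_of_comm
    intro f g
    let e := IsCyclic.mulAutMulEquiv P
    apply e.injective
    rw [map_mul, map_mul, mul_comm]
  have h2 : Group.IsSolvable P :=
    Group.isSolvable_of_comm fun a b => (IsCyclic.commGroup (α := P)).mul_comm a b
  refine Group.isSolvable_of_ker_le_range (Subgroup.inclusion (Subgroup.le_normalizer (H := P)))
    P.normalizerMonoidHom ?_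
  rw [Subgroup.normalizerMonoidHom_ker]
  intro g hg
  rw [Subgroup.mem_subgroupOf] at hg
  exact ⟨⟨g, hc hg⟩, rfl⟩

namespace DihedralTI

variable {G : Type*} [Group G] {a t : G} {m : ℕ}

theorem not_regular_of_involution (D : DihedralTI a t m) {w : G} (h1 : w * w = 1) (h2 : w ≠ 1) :
    ¬ Regular a w := by
  obtain ⟨g, rfl⟩ := D.involution w h1 h2
  intro h
  apply h g
  have : g⁻¹ * (g * a ^ (m / 2) * g⁻¹) * g = a ^ (m / 2) := by group
  rw [this]
  exact Subgroup.pow_mem _ (Subgroup.mem_zpowers a) _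

theorem eq_one_of_commute_involution [Finite G] (D : DihedralTI a t m) {e : ℕ} (he : m = 2 ^ e)
    {w c : G} (hw : orderOf w = 2) (h : Commute c w) (hc : Odd (orderOf c)) : c = 1 := by
  have h1 : w * w = 1 := by rw [← pow_two, ← hw, pow_orderOf_eq_one]
  have h2 : w ≠ 1 := by rintro rfl; simp at hw
  by_cases hr : Regular a c
  · exact absurd (hr.of_commute D h2 h.symm) (D.not_regular_of_involution h1 h2)
  · rw [Regular] at hr
    push Not at hr
    obtain ⟨g, hg⟩ := hr
    have h3 : orderOf c ∣ m := by
      have h4 := orderOf_dvd_of_mem_zpowers hg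
      have h5 : orderOf (g⁻¹ * c * g) = orderOf c := by
        have := (MulAut.conj g⁻¹ : G ≃* G).orderOf_eq c
        simpa using this
      rwa [h5, D.order] at h4
    rw [he] at h3
    have : Nat.Coprime (orderOf c) (2 ^ e) := Nat.Coprime.pow_right _ hc.coprime_two_right
    rw [← orderOf_eq_one_iff]
    exact this.eq_one_of_dvd h3

end DihedralTI

namespace DihedralTI

variable {G : Type*} [Group G] [Fintype G] {a t : G} {m q k : ℕ} {δ : ℤ} {v : G → ℤ}

theorem CharData.inverts_of_normalizes (C : CharData a m δ q k v) (D : DihedralTI a t m)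
    (hq : q.Prime) {y w : G} (hy : orderOf y = q) (h1 : w * w = 1) (h2 : w ≠ 1)
    (hw : w * y * w⁻¹ ∈ Subgroup.zpowers y) : w * y * w⁻¹ = y⁻¹ := by
  have := Fact.mk hq
  obtain ⟨s, hs⟩ := exists_eq_zmodPow hy hw
  have h3 := conj_zmodPow hy hs s
  rw [← hs] at h3
  have hy1 : zmodPow y (1 : ZMod q) = y := by
    have := zmodPow_natCast hy 1
    simpa using this
  have h4 : zmodPow y (s * s) = zmodPow y (1 : ZMod q) := by
    rw [← h3, hy1]
    have h5 : w⁻¹ = w := inv_eq_of_mul_eq_one_left h1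
    rw [h5]
    calc w * (w * y * w) * w = (w * w) * y * (w * w) := by group
      _ = y := by rw [h1, one_mul, mul_one]
  have h6 := zmodPow_injective hy h4
  rcases mul_self_eq_one_iff.1 h6 with h | h
  · exfalso
    rw [h, hy1, mul_inv_eq_iff_eq_mul] at hs
    exact D.not_regular_of_involution h1 h2
      ((C.regular_of_prime D hq hy dvd_rfl).of_commute D h2 hs)
  · rw [hs, h, zmodPow_neg hy, hy1]

open scoped Pointwise in
theorem CharData.sign_eq (C : CharData a m δ q k v) (D : DihedralTI a t m) {e : ℕ}
    (he : m = 2 ^ e) (M : Subgroup G)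
    (hM : ∀ g, g ∈ M ↔ g ∈ Subgroup.zpowers a ∨ g * t ∈ Subgroup.zpowers a)
    (hcard : Nat.card M = 2 * m) (hindex : Odd M.index) {x : G} (hx : x ∈ Subgroup.zpowers a)
    (hsol : ∀ H : Subgroup G, Group.IsSolvable H → x ∈ H → H ≤ M) : δ = -1 := by
  refine C.sign.resolve_left ?_
  rintro rfl
  have hq := C.q_prime D he
  have := Fact.mk hq
  have h8 := D.eight_dvd
  have hm0 := D.pos
  obtain ⟨P⟩ : Nonempty (Sylow q G) := inferInstance
  have hN := C.card_normalizer D P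
  have e1 : q = 2 * m + 1 := by have := C.q_eq; omega
  have e2 : k = m + 1 := by have := C.k_eq; omega
  have hN2 : Nat.card (Subgroup.normalizer (P : Set G)) = m * q := by
    apply Nat.eq_of_mul_eq_mul_right (Nat.succ_pos q)
    rw [Nat.succ_eq_add_one, hN, C.card, e2]
    have : q + 1 = 2 * (m + 1) := by omega
    rw [this]; ring
  have hPc : Nat.card P = q := by
    rw [Sylow.card_eq_multiplicity, C.factorization_eq_one hq, pow_one]
  obtain ⟨K, hK⟩ := Sylow.exists_subgroup_card_pow_prime
    (G := Subgroup.normalizer (P : Set G)) 2 (n := e) (by rw [hN2, he]; exact dvd_mul_right _ _)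
  rw [← he] at hK
  set S : Subgroup G := K.map (Subgroup.normalizer (P : Set G)).subtype with hS
  have hSc : Nat.card S = m := by
    rw [← hK]
    exact Subgroup.card_map_of_injective (Subgroup.subtype_injective _)
  have hSN : S ≤ Subgroup.normalizer (P : Set G) := by
    rw [hS]; exact Subgroup.map_subtype_le K
  have hM2 : IsPGroup 2 M := IsPGroup.of_card (n := e + 1) (by rw [hcard, he]; ring)
  have hMi : ¬ 2 ∣ M.index := by rw [← even_iff_two_dvd, Nat.not_even_iff_odd]; exact hindex
  obtain ⟨R, hR⟩ := (IsPGroup.of_card (hSc.trans he) : IsPGroup 2 S).exists_le_sylow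
  obtain ⟨g, hg⟩ := MulAction.exists_smul_eq G R (hM2.toSylow hMi)
  have hgS : ∀ s ∈ S, g * s * g⁻¹ ∈ M := by
    intro s hs
    have h1 : MulAut.conj g • s ∈ MulAut.conj g • (R : Subgroup G) :=
      Subgroup.smul_mem_pointwise_smul _ _ _ (hR hs)
    rw [← Sylow.coe_subgroup_smul, hg] at h1
    simpa using h1
  obtain ⟨⟨y, hyP⟩, hy⟩ := exists_prime_orderOf_dvd_card' (G := P) q (by rw [hPc])
  rw [Subgroup.orderOf_mk] at hy
  have hPy : Subgroup.zpowers y = (P : Subgroup G) := by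
    apply Subgroup.eq_of_le_of_card_ge (Subgroup.zpowers_le.2 hyP)
    rw [Nat.card_zpowers, hy]
    exact hPc.le
  have hzS : ∀ s ∈ S, g * s * g⁻¹ ∈ Subgroup.zpowers a := by
    by_contra! hcon
    obtain ⟨u, huS, hu⟩ := hcon
    have hinvol : ∀ w ∈ S, w * w = 1 → w ≠ 1 → w * y * w⁻¹ = y⁻¹ := by
      intro w hwS h1 h2
      apply C.inverts_of_normalizes D hq hy h1 h2
      rw [hPy]
      exact (Subgroup.mem_normalizer_iff.1 (hSN hwS) y).1 hyP
    have hsq : ∀ w ∈ S, g * w * g⁻¹ ∉ Subgroup.zpowers a → w * w = 1 ∧ w ≠ 1 := by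
      intro w hwS hw
      have h1 := ((hM _).1 (hgS w hwS)).resolve_left hw
      obtain ⟨l, hl⟩ := h1
      have htt : t⁻¹ = t := D.t_inv
      have h2 : g * w * g⁻¹ = a ^ l * t := by
        simp only at hl
        rw [hl, mul_assoc (g * w * g⁻¹), D.sq, mul_one]
      constructor
      · have h3 : (g * w * g⁻¹) * (g * w * g⁻¹) = 1 := by
          rw [h2]
          have h4 : t * a ^ l * t = a ^ (-l) := by
            have := D.inverts
            calc t * a ^ l * t = t * a ^ l * t⁻¹ := by rw [htt]
              _ = (t * a * t⁻¹) ^ l := (conj_zpow).symm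
              _ = _ := by rw [this]; simp
          calc a ^ l * t * (a ^ l * t) = a ^ l * (t * a ^ l * t) := by group
            _ = 1 := by rw [h4]; group
        have h4 : (g * w * g⁻¹) * (g * w * g⁻¹) = g * (w * w) * g⁻¹ := by group
        rw [h4] at h3
        exact conj_eq_one_iff.1 h3
      · rintro rfl
        apply hw
        simp [Subgroup.one_mem]
    obtain ⟨hu1, hu2⟩ := hsq u huS hu
    have hu3 := hinvol u huS hu1 hu2
    have hcomm : ∀ w, w * y * w⁻¹ = y⁻¹ → Commute (w * u) y := by
      intro w hw
      have h1 : (w * u) * y * (w * u)⁻¹ = y := by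
        calc (w * u) * y * (w * u)⁻¹ = w * (u * y * u⁻¹) * w⁻¹ := by group
          _ = (w * y * w⁻¹)⁻¹ := by rw [hu3]; group
          _ = y := by rw [hw, inv_inv]
      rwa [mul_inv_eq_iff_eq_mul] at h1
    have hreg := C.regular_of_prime D hq hy dvd_rfl
    have hcu : ∀ w ∈ S, (w * y * w⁻¹ = y⁻¹) → w = u := by
      intro w hwS hw
      by_contra hne
      have h1 : w * u ≠ 1 := by
        intro h
        apply hne
        rw [mul_eq_one_iff_eq_inv, inv_eq_of_mul_eq_one_left hu1] at h
        exact h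
      have h2 : Odd (orderOf (w * u)) := by
        have h3 := hreg.odd_centralizer D
        refine h3.of_dvd_nat (Subgroup.orderOf_dvd_natCard _ ?_)
        rw [Subgroup.mem_centralizer_singleton_iff]
        exact (hcomm w hw).eq
      have h3 : orderOf (w * u) ∣ m := by
        rw [← hSc]
        exact Subgroup.orderOf_dvd_natCard _ (S.mul_mem hwS huS)
      have h4 : Nat.Coprime (orderOf (w * u)) m := by
        rw [he]
        exact Nat.Coprime.pow_right _ h2.coprime_two_right
      exact h1 (orderOf_eq_one_iff.1 (h4.eq_one_of_dvd h3))
    have hall : ∀ w ∈ S, w = 1 ∨ w = u := by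
      intro w hwS
      by_cases hw : g * w * g⁻¹ ∈ Subgroup.zpowers a
      · left
        have h1 : g * (w * u) * g⁻¹ ∉ Subgroup.zpowers a := by
          intro h
          apply hu
          have h2 : g * u * g⁻¹ = (g * w * g⁻¹)⁻¹ * (g * (w * u) * g⁻¹) := by group
          rw [h2]
          exact Subgroup.mul_mem _ (Subgroup.inv_mem _ hw) h
        have h2 := S.mul_mem hwS huS
        obtain ⟨h3, h4⟩ := hsq _ h2 h1
        have h5 := hcu _ h2 (hinvol _ h2 h3 h4)
        simpa using h5
      · right
        obtain ⟨h3, h4⟩ := hsq _ hwS hw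
        exact hcu _ hwS (hinvol _ hwS h3 h4)
    have h1 : (S : Set G) ⊆ {1, u} := fun w hw => hall w hw
    have h2 := Set.ncard_le_ncard h1 (Set.toFinite _)
    have h3 : ({1, u} : Set G).ncard ≤ 2 := by
      refine (Set.ncard_insert_le _ _).trans ?_
      rw [Set.ncard_singleton]
    have h4 : (S : Set G).ncard = m := by rw [← hSc]; rfl
    have := Nat.le_of_dvd hm0 h8
    omega
  have hSA : S.map (MulAut.conj g : G ≃* G).toMonoidHom = Subgroup.zpowers a := by
    apply Subgroup.eq_of_le_of_card_ge
    · rintro _ ⟨s, hs, rfl⟩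
      simpa using hzS s hs
    · rw [Nat.card_zpowers, D.order]
      have : Nat.card (S.map (MulAut.conj g : G ≃* G).toMonoidHom) = Nat.card S :=
        Subgroup.card_map_of_injective (MulAut.conj g : G ≃* G).injective
      rw [this, hSc]
  set P' := g • P with hP'
  have hxN : x ∈ Subgroup.normalizer (P' : Set G) := by
    rw [← Sylow.smul_eq_iff_mem_normalizer]
    rw [← hSA] at hx
    obtain ⟨s, hs, rfl⟩ := hx
    have h1 : s • P = P := Sylow.smul_eq_iff_mem_normalizer.2 (hSN hs)
    have h2 : ((MulAut.conj g : G ≃* G).toMonoidHom s) = g * s * g⁻¹ := by simp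
    rw [h2, hP', mul_smul, mul_smul, inv_smul_smul, h1]
  have hPc' : Nat.card P' = q := by
    rw [Sylow.card_eq_multiplicity, C.factorization_eq_one hq, pow_one]
  have hcyc : IsCyclic (P' : Subgroup G) := isCyclic_of_prime_card hPc'
  obtain ⟨⟨y', hyP'⟩, hy'⟩ := exists_prime_orderOf_dvd_card' (G := P') q (by rw [hPc'])
  rw [Subgroup.orderOf_mk] at hy'
  have hle := hsol (Subgroup.normalizer (P' : Set G))
    (Subgroup.isSolvable_normalizer_of_isCyclic (P := (P' : Subgroup G)) ?_) hxN
  · have h1 : y' ∈ M := hle (Subgroup.le_normalizer hyP')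
    have h2 : orderOf y' ∣ Nat.card M := Subgroup.orderOf_dvd_natCard _ h1
    rw [hy', hcard] at h2
    exact hq.one_lt.ne' (C.coprime_m.eq_one_of_dvd h2)
  · intro c hc
    have h1 : Commute c y' := ((Subgroup.mem_centralizer_iff.1 hc) y' hyP').symm
    have h2 := C.mem_zpowers_of_commute D hq hy' h1
    exact (Subgroup.zpowers_le.2 hyP') h2

theorem exists_mulEquiv_psl [IsSimpleGroup G] (D : DihedralTI a t m) {e : ℕ}
    (he : m = 2 ^ e) (M : Subgroup G)
    (hM : ∀ g, g ∈ M ↔ g ∈ Subgroup.zpowers a ∨ g * t ∈ Subgroup.zpowers a)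
    (hcard : Nat.card M = 2 * m) (hindex : Odd M.index) {x : G} (hx : x ∈ Subgroup.zpowers a)
    (hsol : ∀ H : Subgroup G, Group.IsSolvable H → x ∈ H → H ≤ M) :
    ∃ p : ℕ, p.Prime ∧ (∃ n : ℕ, p = 2 ^ n - 1) ∧ 31 ≤ p ∧
      Nonempty (G ≃* PSL(2, ZMod p)) := by
  obtain ⟨δ, q, k, v, C⟩ := D.exists_charData (g₀ := M.index)
    (by rw [← hcard, Subgroup.card_mul_index, Nat.card_eq_fintype_card]) hindex
  obtain rfl := C.sign_eq D he M hM hcard hindex hx hsol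
  have hq := C.q_prime D he
  have := Fact.mk hq
  have e1 : q + 1 = 2 * m := by have := C.q_eq; omega
  have e2 : k + 1 = m := by have := C.k_eq; omega
  obtain ⟨j, hj⟩ := D.eight_dvd
  have hm0 := D.pos
  refine ⟨q, hq, ⟨e + 1, by rw [pow_succ, ← he]; omega⟩, ?_, ?_⟩
  · rcases Nat.lt_or_ge j 2 with h | h
    · have h1 : j = 1 := by
        rcases Nat.eq_zero_or_pos j with h0 | h0
        · rw [h0] at hj; omega
        · omega
      have h15 : q = 15 := by rw [h1] at hj; omega
      rw [h15] at hq
      exact absurd hq (by norm_num)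
    · omega
  · apply nonempty_mulEquiv_psl_of_sylow (p := q) (by omega) (C.card_sylow D)
    · intro P
      have h1 := C.card_normalizer D P
      rw [C.card, e1] at h1
      have h2 : q - 1 = 2 * k := by omega
      rw [h2]
      have h3 : Nat.card (Subgroup.normalizer (P : Set G)) = q * k := by
        apply Nat.eq_of_mul_eq_mul_right (show 0 < 2 * m by omega)
        rw [h1]; ring
      rw [h3]; ring
    · intro P
      rw [Sylow.card_eq_multiplicity, C.factorization_eq_one hq, pow_one]
    · intro y c hy h
      exact C.mem_zpowers_of_commute D hq hy h
    · intro w c hw h hc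
      exact D.eq_one_of_commute_involution he hw h hc

end DihedralTI

section SignCharacters

variable {G : Type*} [Group G]

/-- A predicate behaving like a parity defines a sign character. -/
theorem exists_sign_hom (p : G → Prop) (hp : ∀ a b, p (a * b) ↔ (p a ↔ p b)) :
    ∃ φ : G →* ℤˣ, ∀ a, φ a = -1 ↔ ¬ p a := by
  classical
  have hne : (1 : ℤˣ) ≠ -1 := by decide
  refine ⟨MonoidHom.mk' (fun a => if p a then 1 else -1) ?_, ?_⟩
  · intro a b
    by_cases h1 : p a <;> by_cases h2 : p b <;> simp [hp, h1, h2]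
  · intro a
    by_cases h1 : p a <;> simp [h1, hne]

theorem IsSimpleGroup.hom_eq_one [IsSimpleGroup G] (hna : ¬ ∀ a b : G, a * b = b * a)
    {A : Type*} [CommGroup A] (f : G →* A) (g : G) : f g = 1 := by
  rcases IsSimpleGroup.eq_bot_or_eq_top_of_normal f.ker inferInstance with h | h
  · exfalso
    apply hna
    intro a b
    apply (MonoidHom.ker_eq_bot_iff f).1 h
    rw [map_mul, map_mul, mul_comm]
  · have : g ∈ f.ker := by rw [h]; trivial
    exact this

/-- Transfer: an element of a subgroup `M` with sign `-1` cannot have all its fusion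
of sign `-1` controlled by `M`. -/
theorem IsSimpleGroup.false_of_transfer [Finite G] [IsSimpleGroup G]
    (hna : ¬ ∀ a b : G, a * b = b * a) (M : Subgroup G) (φ : M →* ℤˣ) {s : G} (hs : s ∈ M)
    (hφ : φ ⟨s, hs⟩ = -1)
    (h : ∀ (g : G) (n : ℕ) (hm : g⁻¹ * s ^ n * g ∈ M), φ ⟨_, hm⟩ = -1 → g ∈ M) : False := by
  classical
  have := Fintype.ofFinite (Quotient (MulAction.orbitRel (Subgroup.zpowers s) (G ⧸ M)))
  have h1 := MonoidHom.transfer_eq_prod_quotient_orbitRel_zpowers_quot φ s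
  rw [IsSimpleGroup.hom_eq_one hna] at h1
  set c₀ : G ⧸ M := ((1 : G) : G ⧸ M) with hc₀
  have hmk : ∀ g : G, (g : G ⧸ M) = c₀ ↔ g ∈ M := by
    intro g
    rw [hc₀, eq_comm, QuotientGroup.eq]
    simp
  have hfix : s • c₀ = c₀ := by
    rw [hc₀, MulAction.Quotient.smul_coe, smul_eq_mul, mul_one, hmk]
    exact hs
  set q₀ : Quotient (MulAction.orbitRel (Subgroup.zpowers s) (G ⧸ M)) := Quotient.mk'' c₀
  have hout : q₀.out = c₀ := by
    have h2 : (MulAction.orbitRel (Subgroup.zpowers s) (G ⧸ M)).r q₀.out c₀ :=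
      Quotient.mk_out c₀
    obtain ⟨⟨u, k, hu⟩, hu2⟩ := MulAction.orbitRel_apply.1 h2
    have h3 : u ∈ MulAction.stabilizer G c₀ := by
      rw [← hu]
      exact Subgroup.zpow_mem _ hfix k
    rw [← hu2]
    exact h3
  rw [Fintype.prod_eq_single q₀] at h1
  · have hmin : Function.minimalPeriod (s • ·) q₀.out = 1 := by
      rw [hout, Function.minimalPeriod_eq_one_iff_isFixedPt]
      exact hfix
    have hw : q₀.out.out ∈ M := by
      rw [← hmk, QuotientGroup.out_eq', hout]
    have h2 : φ ⟨q₀.out.out, hw⟩⁻¹ * φ ⟨s, hs⟩ * φ ⟨q₀.out.out, hw⟩ = 1 := by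
      rw [h1, ← map_mul, ← map_mul]
      congr 1
      apply Subtype.ext
      simp only [hmin, pow_one]
      rfl
    rw [hφ, mul_right_comm, ← map_mul, inv_mul_cancel, map_one, one_mul] at h2
    exact absurd h2 (by decide)
  · intro q hq
    rcases Int.units_eq_one_or (φ ⟨q.out.out⁻¹ * s ^ Function.minimalPeriod (s • ·) q.out *
      q.out.out, QuotientGroup.out_conj_pow_minimalPeriod_mem M s q.out⟩) with h2 | h2
    · exact h2
    · exfalso
      have h3 := h _ _ _ h2
      rw [← hmk, QuotientGroup.out_eq'] at h3
      apply hq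
      rw [← Quotient.out_eq' q, h3]

/-- In a simple group an involution is conjugate into every subgroup of twice odd index. -/
theorem IsSimpleGroup.exists_conj_mem [Finite G] [IsSimpleGroup G]
    (hna : ¬ ∀ a b : G, a * b = b * a) (A : Subgroup G) {j : ℕ} (hA : A.index = 2 * j)
    (hj : Odd j) {s : G} (h1 : s * s = 1) (h2 : s ≠ 1) : ∃ g : G, g⁻¹ * s * g ∈ A := by
  classical
  by_contra! hcon
  have := Fintype.ofFinite (G ⧸ A)
  set σ := MulAction.toPermHom G (G ⧸ A) s with hσ
  have hnofix : ∀ c, σ c ≠ c := by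
    intro c
    obtain ⟨g, rfl⟩ := QuotientGroup.mk_surjective c
    intro h
    have h3 : ((s * g : G) : G ⧸ A) = (g : G ⧸ A) := h
    rw [eq_comm, QuotientGroup.eq, ← mul_assoc] at h3
    exact hcon g h3
  have hσ2 : σ ^ 2 = 1 := by rw [hσ, ← map_pow, pow_two, h1, map_one]
  have hσ1 : σ ≠ 1 := by
    intro h
    apply hnofix ((1 : G) : G ⧸ A)
    rw [h]; rfl
  have hord : orderOf σ = 2 := orderOf_eq_prime hσ2 hσ1
  obtain ⟨n, hn⟩ := Equiv.Perm.cycleType_prime_order (σ := σ) (by rw [hord]; exact Nat.prime_two)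
  rw [hord] at hn
  have h4 := Equiv.Perm.sign_of_cycleType_eq_replicate (σ := σ) (n := 2) (by norm_num)
    (by rw [hn]; simp)
  have h5 : Fintype.card (Function.fixedPoints σ) = 0 := by
    rw [Fintype.card_eq_zero_iff]
    exact ⟨fun c => hnofix c.1 c.2⟩
  have h6 : Fintype.card (G ⧸ A) = 2 * j := by
    rw [← Nat.card_eq_fintype_card, ← hA]; rfl
  rw [if_neg (by decide), h5, h6, Nat.sub_zero, Nat.mul_div_cancel_left _ (by norm_num),
    hj.neg_one_pow] at h4
  have h7 := IsSimpleGroup.hom_eq_one hna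
    ((Equiv.Perm.sign (α := G ⧸ A)).comp (MulAction.toPermHom G (G ⧸ A))) s
  rw [MonoidHom.comp_apply, ← hσ, h4] at h7
  exact absurd h7 (by decide)

end SignCharacters

section MaximalTwoSubgroup

variable {G : Type*} [Group G] [Finite G] [IsSimpleGroup G] {M : Subgroup G}

theorem IsSimpleGroup.ne_bot_of_isCoatom (hna : ¬ ∀ a b : G, a * b = b * a) (hM : IsCoatom M) :
    M ≠ ⊥ := by
  rintro rfl
  obtain ⟨g, hg⟩ := exists_ne (1 : G)
  have h1 := hM.2 (Subgroup.zpowers g) (bot_lt_iff_ne_bot.2 (by simpa using hg))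
  have h2 : IsCyclic G := isCyclic_iff_exists_zpowers_eq_top.2 ⟨g, h1⟩
  exact hna fun a b => (IsCyclic.commGroup (α := G)).mul_comm a b

theorem IsSimpleGroup.normalizer_eq_of_isCoatom (hM : IsCoatom M) {N : Subgroup G}
    (hN : N ≠ ⊥) (hNM : N ≤ M) (h : M ≤ Subgroup.normalizer (N : Set G)) :
    Subgroup.normalizer (N : Set G) = M := by
  rcases hM.le_iff.1 h with h1 | h1
  · exfalso
    have h2 : N.Normal := Subgroup.normalizer_eq_top_iff.1 h1
    rcases IsSimpleGroup.eq_bot_or_eq_top_of_normal N h2 with h3 | h3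
    · exact hN h3
    · rw [h3, top_le_iff] at hNM
      exact hM.1 hNM
  · exact h1

theorem IsSimpleGroup.mem_of_commute (hM : IsCoatom M) {z : G}
    (hz1 : z ≠ 1) (hz : z ∈ M) (hc : ∀ g ∈ M, Commute g z) {g : G} (h : Commute g z) : g ∈ M := by
  have hmem : ∀ g : G, Commute g z → g ∈ Subgroup.normalizer (Subgroup.zpowers z : Set G) := by
    intro g hg
    apply Subgroup.mem_normalizer_fintype
    rintro _ ⟨k, rfl⟩
    have h1 : g * z ^ k * g⁻¹ = z ^ k := by
      rw [mul_inv_eq_iff_eq_mul]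
      exact (hg.zpow_right k).eq
    simp only
    rw [h1]
    exact ⟨k, rfl⟩
  rw [← IsSimpleGroup.normalizer_eq_of_isCoatom hM (N := Subgroup.zpowers z)
    (by simpa using hz1) (Subgroup.zpowers_le.2 hz) (fun g hg => hmem g (hc g hg))]
  exact hmem g h

theorem IsSimpleGroup.odd_index (hna : ¬ ∀ a b : G, a * b = b * a) (hM : IsCoatom M)
    (h2 : IsPGroup 2 M) : Odd M.index := by
  obtain ⟨R, hR⟩ := h2.exists_le_sylow
  rcases hM.le_iff.1 hR with h | h
  · exfalso
    have h3 : IsPGroup 2 G := by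
      have h4 := R.2
      rw [h] at h4
      exact h4.of_equiv Subgroup.topEquiv
    have h5 := h3.center_nontrivial
    rcases IsSimpleGroup.eq_bot_or_eq_top_of_normal (Subgroup.center G) inferInstance with h6 | h6
    · rw [h6] at h5
      exact not_nontrivial _ h5
    · apply hna
      intro a b
      have : a ∈ Subgroup.center G := by rw [h6]; trivial
      exact (Subgroup.mem_center_iff.1 this b).symm
  · rw [← h, ← Nat.not_even_iff_odd, even_iff_two_dvd]
    exact R.not_dvd_index

theorem IsPGroup.exists_pow_involution {H : Type*} [Group H] (h : IsPGroup 2 H) {s : H}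
    (hs : s ≠ 1) : ∃ n : ℕ, s ^ n * s ^ n = 1 ∧ s ^ n ≠ 1 := by
  classical
  have hex := h s
  have hpos : Nat.find hex ≠ 0 := by
    intro h0
    have := Nat.find_spec hex
    rw [h0] at this
    exact hs (by simpa using this)
  obtain ⟨k, hk⟩ := Nat.exists_eq_succ_of_ne_zero hpos
  refine ⟨2 ^ k, ?_, ?_⟩
  · have := Nat.find_spec hex
    rw [hk, Nat.succ_eq_add_one, pow_succ, pow_mul, pow_two] at this
    exact this
  · exact Nat.find_min hex (by omega)

/-- If `M` controls the fusion of all involutions that are powers of some `s` with sign `-1`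
then the ambient group is not simple. -/
theorem IsSimpleGroup.false_of_involutions (hna : ¬ ∀ a b : G, a * b = b * a)
    (h2 : IsPGroup 2 M) (φ : M →* ℤˣ) {s : G} (hs : s ∈ M) (hφ : φ ⟨s, hs⟩ = -1)
    (h : ∀ n : ℕ, s ^ n * s ^ n = 1 → s ^ n ≠ 1 → ∀ g, g⁻¹ * s ^ n * g ∈ M → g ∈ M) : False := by
  apply IsSimpleGroup.false_of_transfer hna M φ hs hφ
  intro g n hm hneg
  have h1 : s ^ n ≠ 1 := by
    intro h1
    have h3 : (⟨g⁻¹ * s ^ n * g, hm⟩ : M) = 1 := by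
      apply Subtype.ext
      simp [h1]
    rw [h3, map_one] at hneg
    exact absurd hneg (by decide)
  have h3 : (⟨s, hs⟩ : M) ^ n ≠ 1 := by
    intro h3
    exact h1 (congrArg Subtype.val h3)
  obtain ⟨l, hl1, hl2⟩ := h2.exists_pow_involution h3
  have e1 : (s ^ n) ^ l * (s ^ n) ^ l = 1 := congrArg Subtype.val hl1
  have e2 : (s ^ n) ^ l ≠ 1 := fun h4 => hl2 (Subtype.ext h4)
  rw [← pow_mul] at e1 e2
  apply h (n * l) e1 e2 g
  have h4 : g⁻¹ * s ^ (n * l) * g = (g⁻¹ * s ^ n * g) ^ l := by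
    have h5 := conj_pow (a := g⁻¹) (b := s ^ n) (i := l)
    rw [inv_inv] at h5
    rw [h5, pow_mul]
  rw [h4]
  exact M.pow_mem hm l

end MaximalTwoSubgroup

section MetacyclicStructure

variable {H : Type*} [Group H] [Finite H]

theorem eq_one_or_eq_of_mem_zpowers {a u : H} {n : ℕ} (ha : orderOf a = 2 ^ (n + 1))
    (hu : u ∈ Subgroup.zpowers a) (h : u * u = 1) : u = 1 ∨ u = a ^ 2 ^ n := by
  obtain ⟨i, rfl⟩ := mem_powers_iff_mem_zpowers.2 hu
  simp only at h ⊢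
  rw [← pow_add, ← orderOf_dvd_iff_pow_eq_one, ha, pow_succ', ← two_mul] at h
  obtain ⟨j, rfl⟩ := Nat.dvd_of_mul_dvd_mul_left (by norm_num) h
  have h2 : (a ^ 2 ^ n) ^ 2 = 1 := by
    rw [← pow_mul, ← pow_succ, ← ha, pow_orderOf_eq_one]
  rcases Nat.even_or_odd' j with ⟨l, rfl | rfl⟩
  · left
    rw [pow_mul, pow_mul, h2, one_pow]
  · right
    rw [pow_mul, pow_succ, pow_mul, h2, one_pow, one_mul]

theorem pow_two_pow_involution {a : H} {n : ℕ} (ha : orderOf a = 2 ^ (n + 1)) :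
    a ^ 2 ^ n * a ^ 2 ^ n = 1 ∧ a ^ 2 ^ n ≠ 1 := by
  constructor
  · rw [← pow_add, ← two_mul, ← pow_succ', ← ha, pow_orderOf_eq_one]
  · intro h
    rw [← orderOf_dvd_iff_pow_eq_one, ha] at h
    have := Nat.le_of_dvd (by positivity) h
    rw [pow_succ] at this
    have : 0 < 2 ^ n := by positivity
    omega

theorem eq_of_involution_of_isCyclic [IsCyclic H] (h2 : IsPGroup 2 H) {u v : H} (hu : u * u = 1)
    (hu1 : u ≠ 1) (hv : v * v = 1) (hv1 : v ≠ 1) : u = v := by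
  obtain ⟨c, hc⟩ := IsCyclic.exists_generator (α := H)
  obtain ⟨n, hn⟩ := (IsPGroup.iff_orderOf.1 h2) c
  rcases n with _ | n
  · rw [pow_zero, orderOf_eq_one_iff] at hn
    subst hn
    have := hc u
    rw [Subgroup.zpowers_one_eq_bot, Subgroup.mem_bot] at this
    exact absurd this hu1
  · exact ((eq_one_or_eq_of_mem_zpowers hn (hc u) hu).resolve_left hu1).trans
      ((eq_one_or_eq_of_mem_zpowers hn (hc v) hv).resolve_left hv1).symm

/-- In a cyclic 2-group, an involution that is not a square is the only nontrivial element. -/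
theorem eq_one_or_eq_of_not_isSquare [IsCyclic H] (h2 : IsPGroup 2 H) {u : H} (hu : u * u = 1)
    (hsq : ¬ IsSquare u) (g : H) : g = 1 ∨ g = u := by
  obtain ⟨c, hc⟩ := IsCyclic.exists_generator (α := H)
  obtain ⟨n, hn⟩ := (IsPGroup.iff_orderOf.1 h2) c
  obtain ⟨i, hi⟩ := mem_powers_iff_mem_zpowers.2 (hc u)
  obtain ⟨j, hj⟩ := mem_powers_iff_mem_zpowers.2 (hc g)
  simp only at hi hj
  rcases Nat.even_or_odd' i with ⟨l, rfl | rfl⟩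
  · exact absurd ⟨c ^ l, by rw [← hi, ← pow_add, two_mul]⟩ hsq
  have h3 : c ^ 2 = 1 := by
    rw [← hi, ← pow_add, ← two_mul, ← orderOf_dvd_iff_pow_eq_one, hn] at hu
    have h4 : Nat.Coprime (2 ^ n) (2 * l + 1) :=
      Nat.Coprime.pow_left _ (Nat.coprime_two_left.2 (odd_two_mul_add_one l))
    rw [← orderOf_dvd_iff_pow_eq_one, hn]
    exact h4.dvd_of_dvd_mul_right hu
  have hcu : c = u := by rw [← hi, pow_succ, pow_mul, h3, one_pow, one_mul]
  rcases Nat.even_or_odd' j with ⟨l', rfl | rfl⟩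
  · left; rw [← hj, pow_mul, h3, one_pow]
  · right; rw [← hj, pow_succ, pow_mul, h3, one_pow, one_mul, hcu]

theorem IsPGroup.metacyclic_trichotomy [Nontrivial H] (h2 : IsPGroup 2 H) (C : Subgroup H)
    [C.Normal] [IsCyclic C] [IsCyclic (H ⧸ C)] :
    (∃ z : H, z * z = 1 ∧ z ≠ 1 ∧ ∀ u, u * u = 1 → u ≠ 1 → u = z) ∨
    (∃ z t : H, z * z = 1 ∧ z ≠ 1 ∧ t * t = 1 ∧ t ≠ 1 ∧ t ≠ z ∧ (∀ g, Commute g z) ∧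
      ∀ u, u * u = 1 → u ≠ 1 → u = z ∨ u = t ∨ u = z * t) ∨
    (∃ (a t : H) (k : ℕ), orderOf a = 2 ^ (k + 2) ∧ t ∉ Subgroup.zpowers a ∧ t * t = 1 ∧
      (∀ g, g ∈ Subgroup.zpowers a ∨ g * t ∈ Subgroup.zpowers a) ∧
      (t * a * t⁻¹ = a⁻¹ ∨ (1 ≤ k ∧ t * a * t⁻¹ = a⁻¹ * a ^ 2 ^ (k + 1)))) := by
  obtain ⟨a, ha⟩ := (Subgroup.isCyclic_iff_exists_zpowers_eq_top C).1 inferInstance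
  obtain ⟨K, hK⟩ := (IsPGroup.iff_orderOf.1 h2) a
  by_cases hall : ∀ u : H, u * u = 1 → u ≠ 1 → u ∈ C
  · left
    obtain ⟨g, hg⟩ := exists_ne (1 : H)
    obtain ⟨n, hn1, hn2⟩ := h2.exists_pow_involution hg
    refine ⟨g ^ n, hn1, hn2, fun u hu1 hu2 => ?_⟩
    have h3 := eq_of_involution_of_isCyclic (h2.to_subgroup C)
      (u := ⟨u, hall u hu1 hu2⟩) (v := ⟨g ^ n, hall _ hn1 hn2⟩) (Subtype.ext hu1)
      (fun h => hu2 (congrArg Subtype.val h)) (Subtype.ext hn1)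
      (fun h => hn2 (congrArg Subtype.val h))
    exact congrArg Subtype.val h3
  push Not at hall
  obtain ⟨t, ht1, ht2, htC⟩ := hall
  have htinv : t⁻¹ = t := inv_eq_of_mul_eq_one_left ht1
  have hQ : IsPGroup 2 (H ⧸ C) := h2.to_quotient C
  have hout : ∀ u : H, u * u = 1 → u ∉ C → u * t ∈ C := by
    intro u hu hC
    have h3 : ∀ w : H, w ∉ C → (w : H ⧸ C) ≠ 1 := fun w hw h =>
      hw ((QuotientGroup.eq_one_iff w).1 h)
    have h4 : ∀ w : H, w * w = 1 → (w : H ⧸ C) * (w : H ⧸ C) = 1 := by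
      intro w hw
      rw [← QuotientGroup.mk_mul, hw, QuotientGroup.mk_one]
    have h5 := eq_of_involution_of_isCyclic hQ (h4 u hu) (h3 u hC) (h4 t ht1) (h3 t htC)
    rw [← QuotientGroup.eq_one_iff, QuotientGroup.mk_mul, h5]
    exact h4 t ht1
  rcases K with _ | L
  · left
    rw [pow_zero, orderOf_eq_one_iff] at hK
    have hbot : C = ⊥ := by rw [← ha, hK, Subgroup.zpowers_one_eq_bot]
    refine ⟨t, ht1, ht2, fun u hu1 hu2 => ?_⟩
    have h3 : u ∉ C := by rw [hbot, Subgroup.mem_bot]; exact hu2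
    have h4 := hout u hu1 h3
    rw [hbot, Subgroup.mem_bot, mul_eq_one_iff_eq_inv, htinv] at h4
    exact h4
  set z := a ^ 2 ^ L with hz
  obtain ⟨hz1, hz2⟩ := pow_two_pow_involution hK
  have haC : a ∈ C := by rw [← ha]; exact Subgroup.mem_zpowers a
  have hzC : z ∈ C := C.pow_mem haC _
  have hCz : ∀ u ∈ C, u * u = 1 → u ≠ 1 → u = z := by
    intro u hu h3 h4
    rw [← ha] at hu
    exact (eq_one_or_eq_of_mem_zpowers hK hu h3).resolve_left h4
  have hcent : ∀ g, Commute g z := by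
    intro g
    have h3 : g * z * g⁻¹ = z := by
      apply hCz _ (Subgroup.Normal.conj_mem inferInstance z hzC g)
      · calc g * z * g⁻¹ * (g * z * g⁻¹) = g * (z * z) * g⁻¹ := by group
          _ = 1 := by rw [hz1]; group
      · rw [Ne, conj_eq_one_iff]; exact hz2
    rwa [mul_inv_eq_iff_eq_mul] at h3
  have hact : ∀ g : H, ∃ l : ℕ, g * a * g⁻¹ = a ^ l := by
    intro g
    have h3 := Subgroup.Normal.conj_mem (H := C) inferInstance a haC g
    rw [← ha] at h3
    obtain ⟨l, hl⟩ := mem_powers_iff_mem_zpowers.2 h3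
    exact ⟨l, hl.symm⟩
  have hact2 : ∀ (g : H) (l : ℕ), g * a * g⁻¹ = a ^ l → g * g * a * (g * g)⁻¹ = a ^ (l * l) := by
    intro g l hl
    calc g * g * a * (g * g)⁻¹ = g * (g * a * g⁻¹) * g⁻¹ := by group
      _ = g * a ^ l * g⁻¹ := by rw [hl]
      _ = (g * a * g⁻¹) ^ l := conj_pow.symm
      _ = _ := by rw [hl, pow_mul]
  obtain ⟨r, hr⟩ := hact t
  have hrr : r * r ≡ 1 [MOD 2 ^ (L + 1)] := by
    rw [← hK, ← pow_eq_pow_iff_modEq, ← hact2 t r hr, ht1]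
    simp
  have hrodd : r % 2 = 1 := by
    have h3 : r * r ≡ 1 [MOD 2] := hrr.of_dvd (dvd_pow_self 2 (by omega))
    have h4 : r * r % 2 = 1 := h3
    rcases Nat.mod_two_eq_zero_or_one r with h5 | h5
    · rw [Nat.mul_mod, h5] at h4; omega
    · exact h5
  have hsq : ∀ i : ℕ, a ^ i * t * (a ^ i * t) = a ^ (i * (1 + r)) := by
    intro i
    calc a ^ i * t * (a ^ i * t) = a ^ i * (t * a ^ i * t⁻¹) := by rw [htinv]; group
      _ = a ^ i * (a ^ r) ^ i := by rw [← conj_pow, hr]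
      _ = _ := by rw [← pow_mul, ← pow_add]; congr 1; ring
  have hform : ∀ u, u * t ∈ C → ∃ i : ℕ, u = a ^ i * t := by
    intro u hu
    rw [← ha] at hu
    obtain ⟨i, hi⟩ := mem_powers_iff_mem_zpowers.2 hu
    refine ⟨i, ?_⟩
    simp only at hi
    rw [hi, mul_assoc, ht1, mul_one]
  by_cases hcase : L = 0 ∨ r % 4 = 1
  · right; left
    refine ⟨z, t, hz1, hz2, ht1, ht2, ?_, hcent, ?_⟩
    · rintro rfl
      exact htC hzC
    · intro u hu1 hu2
      by_cases huC : u ∈ C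
      · exact Or.inl (hCz u huC hu1 hu2)
      right
      obtain ⟨i, rfl⟩ := hform u (hout u hu1 huC)
      rw [hsq, ← orderOf_dvd_iff_pow_eq_one, hK] at hu1
      have hdvd : 2 ^ L ∣ i := by
        rcases hcase with rfl | h4
        · simp
        · have h5 : i * (1 + r) = 2 * (i * (2 * (r / 4) + 1)) := by
            have : r = 4 * (r / 4) + 1 := by omega
            conv_lhs => rw [this]
            ring
          rw [h5, pow_succ'] at hu1
          have h6 := Nat.dvd_of_mul_dvd_mul_left (by norm_num) hu1
          exact (Nat.Coprime.pow_left _ (Nat.coprime_two_left.2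
            (odd_two_mul_add_one _))).dvd_of_dvd_mul_right h6
      obtain ⟨j, rfl⟩ := hdvd
      have h2' : z ^ 2 = 1 := by rw [pow_two]; exact hz1
      rcases Nat.even_or_odd' j with ⟨l, rfl | rfl⟩
      · left; rw [pow_mul, pow_mul, ← hz, h2', one_pow, one_mul]
      · right; rw [pow_mul, pow_succ, pow_mul, ← hz, h2', one_pow, one_mul]
  · push Not at hcase
    obtain ⟨hL, h4⟩ := hcase
    obtain ⟨k, rfl⟩ := Nat.exists_eq_succ_of_ne_zero hL
    have hr3 : r = 4 * (r / 4) + 3 := by omega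
    right; right
    refine ⟨a, t, k, hK, by rwa [ha], ht1, ?_, ?_⟩
    · have hns : ¬ IsSquare (t : H ⧸ C) := by
        rintro ⟨c, hc⟩
        obtain ⟨h, rfl⟩ := QuotientGroup.mk_surjective c
        rw [← QuotientGroup.mk_mul, eq_comm, QuotientGroup.eq] at hc
        obtain ⟨l, hl⟩ := hact h
        have h5 := hact2 h l hl
        rw [← ha] at hc
        obtain ⟨b, hb⟩ := hc
        simp only at hb
        have h6 : t * a * t⁻¹ = a ^ (l * l) := by
          have h7 : t = h * h * a ^ b := by rw [hb]; group
          rw [← h5]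
          calc t * a * t⁻¹ = (h * h * a ^ b) * a * (h * h * a ^ b)⁻¹ := by rw [← h7]
            _ = _ := by group
        rw [hr, pow_eq_pow_iff_modEq, hK] at h6
        have h7 : r ≡ l * l [MOD 4] := h6.of_dvd ⟨2 ^ k, by
          rw [Nat.succ_eq_add_one, pow_succ, pow_succ]; ring⟩
        have h8 : l * l % 4 = 3 := by
          rw [← h7]; omega
        rw [Nat.mul_mod] at h8
        have h9 : l % 4 < 4 := Nat.mod_lt _ (by norm_num)
        interval_cases l % 4 <;> omega
      intro g
      have ht1' : (t : H ⧸ C) * (t : H ⧸ C) = 1 := by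
        rw [← QuotientGroup.mk_mul, ht1, QuotientGroup.mk_one]
      rw [ha]
      rcases eq_one_or_eq_of_not_isSquare hQ ht1' hns (g : H ⧸ C) with h5 | h5
      · exact Or.inl ((QuotientGroup.eq_one_iff g).1 h5)
      · right
        rw [← QuotientGroup.eq_one_iff, QuotientGroup.mk_mul, h5, ht1']
    · have hdvd : 2 ^ (k + 1) ∣ r + 1 := by
        have h5 : 2 ^ (k + 1 + 1) ∣ r * r - 1 :=
          (Nat.modEq_iff_dvd' (Nat.mul_pos (by omega) (by omega))).1 hrr.symm
        have h6 : r * r - 1 = 2 * ((2 * (r / 4) + 1) * (r + 1)) := by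
          have : r * r = 2 * ((2 * (r / 4) + 1) * (r + 1)) + 1 := by
            conv_lhs => rw [hr3]
            conv_rhs => rw [show r + 1 = 4 * (r / 4) + 3 + 1 by omega]
            ring
          omega
        rw [h6, pow_succ'] at h5
        have h7 := Nat.dvd_of_mul_dvd_mul_left (by norm_num) h5
        exact (Nat.Coprime.pow_left _ (Nat.coprime_two_left.2
          (odd_two_mul_add_one _))).dvd_of_dvd_mul_left h7
      obtain ⟨l, hl⟩ := hdvd
      have h5 : a ^ r * a = z ^ l := by
        rw [← pow_succ, hl, pow_mul]
      have h2' : z ^ 2 = 1 := by rw [pow_two]; exact hz1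
      rcases Nat.even_or_odd' l with ⟨j, rfl | rfl⟩
      · left
        rw [pow_mul, h2', one_pow] at h5
        rw [hr, ← mul_eq_one_iff_eq_inv, h5]
      · right
        constructor
        · by_contra hk
          have : k = 0 := by omega
          subst this
          omega
        · rw [pow_succ, pow_mul, h2', one_pow, one_mul] at h5
          rw [hr]
          have h6 : a ^ r = z * a⁻¹ := by rw [← h5]; group
          rw [h6]
          exact (hcent a⁻¹).eq.symm

end MetacyclicStructure

section NonDihedral

variable {G : Type*} [Group G] [Finite G] [IsSimpleGroup G] {M : Subgroup G}

theorem IsPGroup.exists_nontrivial_sign_hom {H : Type*} [Group H] [Finite H] [Nontrivial H]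
    (h2 : IsPGroup 2 H) : ∃ (φ : H →* ℤˣ) (s : H), φ s = -1 := by
  have : Fact (Nat.Prime 2) := ⟨Nat.prime_two⟩
  obtain ⟨n, hn⟩ := (IsPGroup.iff_card).1 h2
  have h1 := Finite.one_lt_card (α := H)
  rcases n with _ | n
  · omega
  obtain ⟨K, hK⟩ := Sylow.exists_subgroup_card_pow_prime (G := H) 2 (n := n)
    (by rw [hn]; exact pow_dvd_pow _ (Nat.le_succ n))
  have h3 := K.card_mul_index
  rw [hn, hK, pow_succ] at h3
  have h4 : K.index = 2 := Nat.eq_of_mul_eq_mul_left (by positivity) h3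
  obtain ⟨φ, hφ⟩ := exists_sign_hom (fun g => g ∈ K)
    fun _ _ => Subgroup.mul_mem_iff_of_index_two h4
  have h5 : K ≠ ⊤ := by
    rintro rfl
    rw [Subgroup.index_top] at h4
    omega
  obtain ⟨s, hs⟩ : ∃ s, s ∉ K := by
    by_contra! hcon
    exact h5 ((Subgroup.eq_top_iff' K).2 hcon)
  exact ⟨φ, s, (hφ s).2 hs⟩

theorem IsSimpleGroup.mem_of_conj_mem (hM : IsCoatom M)
    (hab : ∀ u ∈ M, u * u = 1 → ∀ v ∈ M, v * v = 1 → Commute u v) {v : G} (hv : v ∈ M)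
    (hv1 : v * v = 1) (hv2 : v ≠ 1) (hc : ∀ g ∈ M, Commute g v) {g : G}
    (hg : g⁻¹ * v * g ∈ M) : g ∈ M := by
  let V : Subgroup G :=
    { carrier := {y | y ∈ M ∧ y * y = 1}
      one_mem' := ⟨M.one_mem, one_mul 1⟩
      mul_mem' := fun {a b} ha hb => ⟨M.mul_mem ha.1 hb.1, by
        rw [(hab b hb.1 hb.2 a ha.1 ha.2).mul_mul_mul_comm, ha.2, hb.2, one_mul]⟩
      inv_mem' := fun {a} ha => ⟨M.inv_mem ha.1, by rw [← mul_inv_rev, ha.2, inv_one]⟩ }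
  have hsq : ∀ h y : G, y * y = 1 → h * y * h⁻¹ * (h * y * h⁻¹) = 1 := by
    intro h y hy
    calc h * y * h⁻¹ * (h * y * h⁻¹) = h * (y * y) * h⁻¹ := by group
      _ = 1 := by rw [hy]; group
  have hV : Subgroup.normalizer (V : Set G) = M := by
    apply IsSimpleGroup.normalizer_eq_of_isCoatom hM
    · intro hbot
      have : v ∈ V := ⟨hv, hv1⟩
      rw [hbot] at this
      exact hv2 this
    · exact fun y hy => hy.1
    · intro m hm
      apply Subgroup.mem_normalizer_fintype
      rintro y ⟨hy, hy1⟩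
      exact ⟨M.mul_mem (M.mul_mem hm hy) (M.inv_mem hm), hsq m y hy1⟩
  rw [← hV]
  apply Subgroup.mem_normalizer_fintype
  rintro y ⟨hy, hy1⟩
  refine ⟨IsSimpleGroup.mem_of_commute hM hv2 hv hc ?_, hsq g y hy1⟩
  have h1 := hab y hy hy1 (g⁻¹ * v * g) hg (by simpa using hsq g⁻¹ v hv1)
  have h2 : y * (g⁻¹ * v * g) = g⁻¹ * v * g * y := h1
  change g * y * g⁻¹ * v = v * (g * y * g⁻¹)
  calc g * y * g⁻¹ * v = g * (y * (g⁻¹ * v * g)) * g⁻¹ := by group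
    _ = g * (g⁻¹ * v * g * y) * g⁻¹ := by rw [h2]
    _ = _ := by group

theorem IsSimpleGroup.false_of_unique_involution (hna : ¬ ∀ a b : G, a * b = b * a)
    (hM : IsCoatom M) (h2 : IsPGroup 2 M) {z : G} (hz : z ∈ M) (hz1 : z * z = 1) (hz2 : z ≠ 1)
    (hu : ∀ u ∈ M, u * u = 1 → u ≠ 1 → u = z) : False := by
  have : Nontrivial M := (Subgroup.nontrivial_iff_ne_bot M).2
    (IsSimpleGroup.ne_bot_of_isCoatom hna hM)
  have hu' : ∀ u ∈ M, u * u = 1 → u = 1 ∨ u = z := by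
    intro u h3 h4
    by_cases h5 : u = 1
    · exact Or.inl h5
    · exact Or.inr (hu u h3 h4 h5)
  have hc : ∀ g ∈ M, Commute g z := by
    intro g hg
    have h3 : g * z * g⁻¹ = z := by
      apply hu _ (M.mul_mem (M.mul_mem hg hz) (M.inv_mem hg))
      · calc g * z * g⁻¹ * (g * z * g⁻¹) = g * (z * z) * g⁻¹ := by group
          _ = 1 := by rw [hz1]; group
      · rw [Ne, conj_eq_one_iff]; exact hz2
    rwa [mul_inv_eq_iff_eq_mul] at h3
  obtain ⟨φ, ⟨s, hs⟩, hφ⟩ := h2.exists_nontrivial_sign_hom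
  apply IsSimpleGroup.false_of_involutions hna h2 φ hs hφ
  intro n h3 h4 g hg
  have h5 := hu _ (M.pow_mem hs n) h3 h4
  rw [h5] at hg
  refine IsSimpleGroup.mem_of_conj_mem hM ?_ hz hz1 hz2 hc hg
  intro u h6 h7 v h8 h9
  rcases hu' u h6 h7 with rfl | rfl
  · exact Commute.one_left v
  · exact (hc v h8).symm

theorem IsSimpleGroup.false_of_central_four_group (hna : ¬ ∀ a b : G, a * b = b * a)
    (hM : IsCoatom M) (h2 : IsPGroup 2 M) {z t : G} (hz : z ∈ M) (ht : t ∈ M)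
    (hz1 : z * z = 1) (hz2 : z ≠ 1) (ht1 : t * t = 1) (ht2 : t ≠ 1) (htz : t ≠ z)
    (hc : ∀ g ∈ M, Commute g z)
    (hu : ∀ u ∈ M, u * u = 1 → u ≠ 1 → u = z ∨ u = t ∨ u = z * t) : False := by
  have : Nontrivial M := (Subgroup.nontrivial_iff_ne_bot M).2
    (IsSimpleGroup.ne_bot_of_isCoatom hna hM)
  have htcomm : ∀ u ∈ M, u * u = 1 → Commute u t := by
    intro u h3 h4
    by_cases h5 : u = 1
    · rw [h5]; exact Commute.one_left t
    rcases hu u h3 h4 h5 with rfl | rfl | rfl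
    · exact (hc t ht).symm
    · exact Commute.refl u
    · exact (hc t ht).symm.mul_left (Commute.refl t)
  have hab : ∀ u ∈ M, u * u = 1 → ∀ v ∈ M, v * v = 1 → Commute u v := by
    intro u h3 h4 v h6 h7
    by_cases h5 : v = 1
    · rw [h5]; exact Commute.one_right u
    rcases hu v h6 h7 h5 with rfl | rfl | rfl
    · exact hc u h3
    · exact htcomm u h3 h4
    · exact (hc u h3).mul_right (htcomm u h3 h4)
  by_cases htc : ∀ g ∈ M, Commute g t
  · obtain ⟨φ, ⟨s, hs⟩, hφ⟩ := h2.exists_nontrivial_sign_hom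
    apply IsSimpleGroup.false_of_involutions hna h2 φ hs hφ
    intro n h3 h4 g hg
    refine IsSimpleGroup.mem_of_conj_mem hM hab (M.pow_mem hs n) h3 h4 ?_ hg
    intro y hy
    rcases hu _ (M.pow_mem hs n) h3 h4 with h5 | h5 | h5 <;> rw [h5]
    · exact hc y hy
    · exact htc y hy
    · exact (hc y hy).mul_right (htc y hy)
  · push Not at htc
    obtain ⟨s, hs, hst⟩ := htc
    have hconj : ∀ g ∈ M, g * t * g⁻¹ = t ∨ g * t * g⁻¹ = z * t := by
      intro g hg
      have h3 : g * t * g⁻¹ ≠ z := by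
        intro h4
        rw [mul_inv_eq_iff_eq_mul, ← (hc g hg).eq] at h4
        exact htz (mul_left_cancel h4)
      refine (hu _ (M.mul_mem (M.mul_mem hg ht) (M.inv_mem hg)) ?_ ?_).resolve_left h3
      · calc g * t * g⁻¹ * (g * t * g⁻¹) = g * (t * t) * g⁻¹ := by group
          _ = 1 := by rw [ht1]; group
      · rw [Ne, conj_eq_one_iff]; exact ht2
    have hzt : z * t ≠ t := by
      intro h; exact hz2 (mul_eq_right.1 h)
    obtain ⟨φ, hφ⟩ := exists_sign_hom (G := M) (fun g => (g : G) * t * (g : G)⁻¹ = t) (by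
      rintro ⟨a, ha⟩ ⟨b, hb⟩
      change a * b * t * (a * b)⁻¹ = t ↔ (a * t * a⁻¹ = t ↔ b * t * b⁻¹ = t)
      have h3 : a * b * t * (a * b)⁻¹ = a * (b * t * b⁻¹) * a⁻¹ := by group
      have h4 : a * (z * t) * a⁻¹ = z * (a * t * a⁻¹) := by
        rw [← mul_assoc, (hc a ha).eq]; group
      rw [h3]
      rcases hconj b hb with h5 | h5
      · rw [h5]; simp
      · rw [h5, h4]
        rcases hconj a ha with h6 | h6
        · rw [h6]; simp
        · rw [h6, ← mul_assoc, hz1, one_mul]; simp [hzt])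
    have hφs : φ ⟨s, hs⟩ = -1 := by
      rw [hφ]
      intro h3
      exact hst (mul_inv_eq_iff_eq_mul.1 h3)
    apply IsSimpleGroup.false_of_involutions hna h2 φ hs hφs
    intro n h3 h4 g hg
    have h5 : s ^ n = z := by
      have hself : Commute s (s ^ n) := Commute.self_pow s n
      rcases hu _ (M.pow_mem hs n) h3 h4 with h5 | h5 | h5
      · exact h5
      · rw [h5] at hself; exact absurd hself hst
      · rw [h5] at hself
        have h6 : Commute s (z⁻¹ * (z * t)) := ((hc s hs).inv_right).mul_right hself
        rw [inv_mul_cancel_left] at h6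
        exact absurd h6 hst
    rw [h5] at hg
    exact IsSimpleGroup.mem_of_conj_mem hM hab hz hz1 hz2 hc hg

end NonDihedral

section Semidihedral

variable {G : Type*} [Group G] [Finite G] [IsSimpleGroup G] {M : Subgroup G}

theorem IsSimpleGroup.false_of_semidihedral (hna : ¬ ∀ a b : G, a * b = b * a)
    (hM : IsCoatom M) {a t : G} {k : ℕ} (haM : a ∈ M) (htM : t ∈ M)
    (ha : orderOf a = 2 ^ (k + 2)) (hk : 1 ≤ k) (ht : t ∉ Subgroup.zpowers a) (ht1 : t * t = 1)
    (hMat : ∀ g ∈ M, g ∈ Subgroup.zpowers a ∨ g * t ∈ Subgroup.zpowers a)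
    (hat : t * a * t⁻¹ = a⁻¹ * a ^ 2 ^ (k + 1)) : False := by
  have htinv : t⁻¹ = t := inv_eq_of_mul_eq_one_left ht1
  set r : ℤ := -1 + 2 ^ (k + 1) with hr
  have hat' : ∀ j : ℤ, t * a ^ j = a ^ (r * j) * t := by
    intro j
    have h1 : t * a ^ j * t⁻¹ = a ^ (r * j) := by
      rw [← conj_zpow, hat, ← zpow_natCast, ← zpow_neg_one, ← zpow_add, ← zpow_mul]
      push_cast
      rfl
    rw [← h1, inv_mul_cancel_right]
  have hodd : Odd r := by
    rw [hr, pow_succ']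
    exact ⟨2 ^ k - 1, by ring⟩
  have hone : ∀ j : ℤ, a ^ j = 1 → (2 : ℤ) ^ (k + 2) ∣ j := by
    intro j hj
    rw [← orderOf_dvd_iff_zpow_eq_one, ha] at hj
    exact_mod_cast hj
  have hform : ∀ g ∈ M, ∃ i : ℤ, g = a ^ i ∨ g = a ^ i * t := by
    intro g hg
    rcases hMat g hg with ⟨i, hi⟩ | ⟨i, hi⟩
    · exact ⟨i, Or.inl hi.symm⟩
    · refine ⟨i, Or.inr ?_⟩
      change a ^ i = g * t at hi
      rw [hi, mul_assoc, ht1, mul_one]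
  have hne : ∀ i j : ℤ, a ^ i ≠ a ^ j * t := by
    intro i j h
    apply ht
    refine ⟨-j + i, ?_⟩
    change a ^ (-j + i) = t
    rw [zpow_add, h, zpow_neg, inv_mul_cancel_left]
  have hpar : ∀ i j : ℤ, a ^ i = a ^ j → (Even i ↔ Even j) := by
    intro i j h
    have h1 : a ^ (i - j) = 1 := by rw [zpow_sub, h, mul_inv_cancel]
    have h2 : Even (i - j) := even_iff_two_dvd.2
      ((dvd_pow_self (2 : ℤ) (by omega : k + 2 ≠ 0)).trans (hone _ h1))
    exact Int.even_sub.1 h2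
  let p : G → Prop := fun g => ∃ i : ℤ, Even i ∧ (g = a ^ i ∨ g = a ^ i * t)
  have hp1 : ∀ i : ℤ, p (a ^ i) ↔ Even i := by
    intro i
    constructor
    · rintro ⟨j, hj, h | h⟩
      · exact (hpar i j h).2 hj
      · exact absurd h (hne i j)
    · exact fun h => ⟨i, h, Or.inl rfl⟩
  have hp2 : ∀ i : ℤ, p (a ^ i * t) ↔ Even i := by
    intro i
    constructor
    · rintro ⟨j, hj, h | h⟩
      · exact absurd h.symm (hne j i)
      · exact (hpar i j (mul_right_cancel h)).2 hj
    · exact fun h => ⟨i, h, Or.inr rfl⟩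
  have hrj : ∀ i j : ℤ, Even (i + r * j) ↔ (Even i ↔ Even j) := by
    intro i j
    have h1 : ¬ Even r := Int.not_even_iff_odd.2 hodd
    rw [Int.even_add, Int.even_mul]
    tauto
  have hmul : ∀ x ∈ M, ∀ y ∈ M, p (x * y) ↔ (p x ↔ p y) := by
    intro x hx y hy
    obtain ⟨i, rfl | rfl⟩ := hform x hx <;> obtain ⟨j, rfl | rfl⟩ := hform y hy
    · rw [← zpow_add, hp1, hp1, hp1, Int.even_add]
    · rw [← mul_assoc, ← zpow_add, hp1, hp2, hp2, Int.even_add]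
    · rw [mul_assoc, hat', ← mul_assoc, ← zpow_add, hp1, hp2, hp2, hrj]
    · rw [show a ^ i * t * (a ^ j * t) = a ^ i * (t * a ^ j) * t by group, hat',
        mul_assoc, mul_assoc (a ^ (r * j)), ht1, mul_one, ← zpow_add, hp1, hp2, hp2, hrj]
  obtain ⟨φ, hφ⟩ := exists_sign_hom (G := M) (fun g => p (g : G))
    fun x y => hmul x x.2 y y.2
  set z : G := a ^ ((2 : ℤ) ^ (k + 1)) with hz
  have hzz : z * z = 1 := by
    rw [hz, ← zpow_add, ← two_mul, ← pow_succ', ← orderOf_dvd_iff_zpow_eq_one, ha]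
    exact_mod_cast dvd_refl _
  have hz1 : z ≠ 1 := by
    intro h
    have h1 := hone _ h
    rw [pow_succ (2 : ℤ) (k + 1)] at h1
    have h2 := Int.le_of_dvd (by positivity) h1
    have h3 : (0 : ℤ) < 2 ^ (k + 1) := by positivity
    omega
  have hzodd : ∀ i : ℤ, Odd i → z ^ i = z := by
    rintro _ ⟨i, rfl⟩
    have h2 : z ^ (2 : ℤ) = 1 := by rw [zpow_two]; exact hzz
    rw [zpow_add, zpow_mul, h2, one_zpow, one_mul, zpow_one]
  have hsq : ∀ i : ℤ, a ^ i * t * (a ^ i * t) = z ^ i := by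
    intro i
    rw [show a ^ i * t * (a ^ i * t) = a ^ i * (t * a ^ i) * t by group, hat',
        mul_assoc, mul_assoc (a ^ (r * i)), ht1, mul_one, ← zpow_add, hz, ← zpow_mul, hr]
    congr 1
    ring
  have hzM : z ∈ M := M.zpow_mem haM _
  have hcz : ∀ g ∈ M, Commute g z := by
    have h1 : Commute a z := Commute.self_zpow a _
    have h2 : Commute t z := by
      change t * z = z * t
      rw [hz, hat', mul_comm, zpow_mul, ← hz, hzodd r hodd]
    intro g hg
    obtain ⟨i, rfl | rfl⟩ := hform g hg
    · exact h1.zpow_left i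
    · exact (h1.zpow_left i).mul_left h2
  have hsM : a * t ∈ M := M.mul_mem haM htM
  have hs2 : a * t * (a * t) = z := by simpa using hsq 1
  have hφs : φ ⟨a * t, hsM⟩ = -1 := by
    rw [hφ]
    have := hp2 1
    rw [zpow_one] at this
    change ¬ p (a * t)
    rw [this]
    decide
  apply IsSimpleGroup.false_of_transfer hna M φ hsM hφs
  intro g n hm hn
  rw [hφ] at hn
  change ¬ p (g⁻¹ * (a * t) ^ n * g) at hn
  have hw2 : g⁻¹ * (a * t) ^ n * g * (g⁻¹ * (a * t) ^ n * g) = g⁻¹ * z ^ n * g := by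
    rw [show g⁻¹ * (a * t) ^ n * g * (g⁻¹ * (a * t) ^ n * g) =
      g⁻¹ * ((a * t) ^ n * (a * t) ^ n) * g by group, ← (Commute.refl (a * t)).mul_pow, hs2]
  have hw4 : g⁻¹ * z ^ n * g * (g⁻¹ * z ^ n * g) = 1 := by
    rw [show g⁻¹ * z ^ n * g * (g⁻¹ * z ^ n * g) = g⁻¹ * (z ^ n * z ^ n) * g by group,
      ← (Commute.refl z).mul_pow, hzz]
    group
  obtain ⟨i, hi | hi⟩ := hform _ hm
  · rw [hi] at hw2 hn
    rw [hp1, Int.not_even_iff_odd] at hn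
    rw [← hw2, ← zpow_add, ← zpow_add] at hw4
    have h1 := (pow_dvd_pow (2 : ℤ) (by omega : 3 ≤ k + 2)).trans (hone _ hw4)
    obtain ⟨j, rfl⟩ := hn
    norm_num at h1
    omega
  · rw [hi] at hw2 hn
    rw [hp2, Int.not_even_iff_odd] at hn
    rw [hsq, hzodd i hn] at hw2
    rcases Nat.even_or_odd n with hne | hno
    · obtain ⟨l, rfl⟩ := hne
      rw [pow_add, ← (Commute.refl z).mul_pow, hzz] at hw2
      exact absurd (by simpa using hw2) hz1
    · have h1 := hzodd n (by exact_mod_cast hno)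
      rw [zpow_natCast] at h1
      rw [h1] at hw2
      apply IsSimpleGroup.mem_of_commute hM hz1 hzM hcz
      change g * z = z * g
      nth_rw 1 [hw2]
      group

end Semidihedral

section SolvableNormalizer

theorem Equiv.Perm.isSolvable_fin_three : Group.IsSolvable (Equiv.Perm (Fin 3)) := by
  have hcomm : ∀ x y : Equiv.Perm (Fin 3), Equiv.Perm.sign x = 1 → Equiv.Perm.sign y = 1 →
      x * y = y * x := by decide
  have : Group.IsSolvable (Equiv.Perm.sign (α := Fin 3)).ker :=
    Group.isSolvable_of_comm fun x y => Subtype.ext (hcomm x y x.2 y.2)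
  exact Group.isSolvable_of_ker_le_range (Equiv.Perm.sign (α := Fin 3)).ker.subtype
    Equiv.Perm.sign (by rw [Subgroup.range_subtype])

variable {G : Type*} [Group G]

theorem Subgroup.isSolvable_normalizer (V : Subgroup G) (h3 : ((V : Set G) \ {1}).ncard = 3)
    (hc : ∀ g, (∀ v ∈ V, Commute g v) → g ∈ V) (hab : ∀ u ∈ V, ∀ v ∈ V, Commute u v) :
    Group.IsSolvable (Subgroup.normalizer (V : Set G)) := by
  have := Equiv.Perm.isSolvable_fin_three
  have hfin : Finite ((V : Set G) \ {1} : Set G) :=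
    Set.finite_of_ncard_ne_zero (by rw [h3]; norm_num)
  have e : ((V : Set G) \ {1} : Set G) ≃ Fin 3 := Finite.equivFinOfCardEq h3
  have hact : ∀ n : Subgroup.normalizer (V : Set G), ∀ v : G,
      v ∈ (V : Set G) \ {1} ↔ MulAut.toPerm G (MulAut.conj (n : G)) v ∈ (V : Set G) \ {1} := by
    intro n v
    have h1 := Subgroup.mem_normalizer_iff.1 n.2 v
    change (v ∈ V ∧ ¬ v = 1) ↔ ((n : G) * v * (n : G)⁻¹ ∈ V ∧ ¬ (n : G) * v * (n : G)⁻¹ = 1)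
    rw [← h1, conj_eq_one_iff]
  let f : Subgroup.normalizer (V : Set G) →* Equiv.Perm ((V : Set G) \ {1} : Set G) :=
    MonoidHom.mk' (fun n => (MulAut.toPerm G (MulAut.conj (n : G))).subtypePerm
      fun v => (hact n v).symm) (by
        intro m n
        ext v
        change (m : G) * n * v * ((m : G) * n)⁻¹ = m * (n * v * (n : G)⁻¹) * (m : G)⁻¹
        group)
  let F := (e.permCongrHom : _ →* Equiv.Perm (Fin 3)).comp f
  have hker : ∀ n : Subgroup.normalizer (V : Set G), F n = 1 → (n : G) ∈ V := by
    intro n hn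
    have h1 : f n = 1 := by
      have : e.permCongrHom (f n) = 1 := hn
      exact (map_eq_one_iff _ e.permCongrHom.injective).1 this
    apply hc
    intro v hv
    by_cases hv1 : v = 1
    · rw [hv1]; exact Commute.one_right _
    have h2 := congrArg (fun σ => ((σ ⟨v, hv, hv1⟩ : ((V : Set G) \ {1} : Set G)) : G)) h1
    change (n : G) * v * (n : G)⁻¹ = v at h2
    exact mul_inv_eq_iff_eq_mul.1 h2
  have : Group.IsSolvable F.ker := Group.isSolvable_of_comm fun x y =>
    Subtype.ext (Subtype.ext (hab _ (hker x x.2) _ (hker y y.2)))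
  exact Group.isSolvable_of_ker_le_range F.ker.subtype F (by rw [Subgroup.range_subtype])

end SolvableNormalizer

section DihedralMaximal

variable {G : Type*} [Group G] [Finite G] [IsSimpleGroup G] {M : Subgroup G}

theorem IsSimpleGroup.exists_mulEquiv_psl_of_dihedral (hna : ¬ ∀ a b : G, a * b = b * a)
    (hM : IsCoatom M) (h2 : IsPGroup 2 M) {a t x : G} {k : ℕ} (haM : a ∈ M) (htM : t ∈ M)
    (ha : orderOf a = 2 ^ (k + 2)) (ht : t ∉ Subgroup.zpowers a) (ht1 : t * t = 1)
    (hMat : ∀ g ∈ M, g ∈ Subgroup.zpowers a ∨ g * t ∈ Subgroup.zpowers a)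
    (hat : t * a * t⁻¹ = a⁻¹)
    (hsol : ∀ H : Subgroup G, Group.IsSolvable H → x ∈ H → H ≤ M) :
    ∃ p : ℕ, p.Prime ∧ (∃ n : ℕ, p = 2 ^ n - 1) ∧ 31 ≤ p ∧
      Nonempty (G ≃* PSL(2, ZMod p)) := by
  set A := Subgroup.zpowers a with hA
  have hAM : A ≤ M := (Subgroup.zpowers_le).2 haM
  have haA : a ∈ A := Subgroup.mem_zpowers a
  have hAcomm : ∀ c ∈ A, ∀ d ∈ A, Commute c d := by
    rintro _ ⟨i, rfl⟩ _ ⟨j, rfl⟩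
    exact (Commute.refl a).zpow_zpow i j
  have hinv0 : ∀ c ∈ A, t * c * t⁻¹ = c⁻¹ := by
    rintro _ ⟨i, rfl⟩
    change t * a ^ i * t⁻¹ = (a ^ i)⁻¹
    rw [← conj_zpow, hat, inv_zpow]
  have hAt : ∀ s ∈ M, s ∉ A → s * t ∈ A := fun s hs hsA => (hMat s hs).resolve_left hsA
  have hinv : ∀ c ∈ A, ∀ s ∈ M, s ∉ A → s * c * s⁻¹ = c⁻¹ := by
    intro c hc s hs hsA
    have h3 := hAcomm _ (hAt s hs hsA) _ (A.inv_mem hc)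
    calc s * c * s⁻¹ = s * t * (t⁻¹ * c * t⁻¹⁻¹) * (s * t)⁻¹ := by group
      _ = s * t * (t * c * t⁻¹) * (s * t)⁻¹ := by
        rw [inv_inv, inv_eq_of_mul_eq_one_left ht1]
      _ = s * t * c⁻¹ * (s * t)⁻¹ := by rw [hinv0 c hc]
      _ = c⁻¹ := by rw [h3.eq]; group
  have hsq : ∀ s ∈ M, s ∉ A → s * s = 1 := by
    intro s hs hsA
    have h3 := hinv0 _ (hAt s hs hsA)
    rw [inv_eq_of_mul_eq_one_left ht1] at h3
    calc s * s = s * (t * t) * s * (t * t) := by rw [ht1]; group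
      _ = s * t * (t * (s * t) * t) := by group
      _ = 1 := by rw [h3, mul_inv_cancel]
  have hmulA : ∀ s₁ ∈ M, s₁ ∉ A → ∀ s₂ ∈ M, s₂ ∉ A → s₁ * s₂ ∈ A := by
    intro s₁ h3 h4 s₂ h5 h6
    have h7 := A.mul_mem (hAt s₁ h3 h4) (A.inv_mem (hAt s₂ h5 h6))
    rwa [show s₁ * t * (s₂ * t)⁻¹ = s₁ * s₂⁻¹ by group,
      inv_eq_of_mul_eq_one_left (hsq s₂ h5 h6)] at h7
  set z := a ^ 2 ^ (k + 1) with hz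
  obtain ⟨hz1, hz2⟩ := pow_two_pow_involution (n := k + 1) ha
  rw [← hz] at hz1 hz2
  have hzinv : z⁻¹ = z := inv_eq_of_mul_eq_one_left hz1
  have hzA : z ∈ A := A.pow_mem haA _
  have hA1 : ∀ c ∈ A, c * c = 1 → c = 1 ∨ c = z := fun c hc h =>
    eq_one_or_eq_of_mem_zpowers (n := k + 1) ha hc h
  have hcz : ∀ g ∈ M, Commute g z := by
    intro g hg
    by_cases hgA : g ∈ A
    · exact hAcomm g hgA z hzA
    · have h3 := hinv z hzA g hg hgA
      rw [hzinv] at h3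
      exact mul_inv_eq_iff_eq_mul.1 h3
  have hzM : ∀ g, Commute g z → g ∈ M := fun g hg =>
    IsSimpleGroup.mem_of_commute hM hz2 (hAM hzA) hcz hg
  have hrel : A.relIndex M = 2 := by
    apply Subgroup.index_eq_two_iff.2
    refine ⟨⟨t, htM⟩, ?_⟩
    rintro ⟨b, hb⟩
    change Xor (b * t ∈ A) (b ∈ A)
    rcases hMat b hb with h3 | h3
    · refine Or.inr ⟨h3, fun h4 => ht ?_⟩
      exact (A.mul_mem_cancel_left h3).1 h4
    · refine Or.inl ⟨h3, fun h4 => ht ?_⟩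
      exact (A.mul_mem_cancel_left h4).1 h3
  have hindex := IsSimpleGroup.odd_index hna hM h2
  have hAindex : A.index = 2 * M.index := by
    rw [← Subgroup.relIndex_mul_index hAM, hrel]
  have hcard : Nat.card M = 2 * 2 ^ (k + 2) := by
    have h3 := Subgroup.card_mul_index (A.subgroupOf M)
    have h4 : (A.subgroupOf M).index = 2 := hrel
    have h5 : Nat.card (A.subgroupOf M) = 2 ^ (k + 2) := by
      rw [Nat.card_congr (Subgroup.subgroupOfEquivOfLe hAM).toEquiv, hA, Nat.card_zpowers, ha]
    rw [← h3, h4, h5, mul_comm]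
  have hconj : ∀ s : G, s * s = 1 → s ≠ 1 → ∃ g : G, s = g * z * g⁻¹ := by
    intro s h3 h4
    obtain ⟨g, hg⟩ := IsSimpleGroup.exists_conj_mem hna A hAindex hindex h3 h4
    refine ⟨g, ?_⟩
    rcases hA1 _ hg (by
      rw [show g⁻¹ * s * g * (g⁻¹ * s * g) = g⁻¹ * (s * s) * g by group, h3]; group) with h5 | h5
    · exfalso
      apply h4
      calc s = g * (g⁻¹ * s * g) * g⁻¹ := by group
        _ = 1 := by rw [h5]; group
    · rw [← h5]; group
  have hx : ∀ s ∈ M, s ∉ A → ∀ y, y = 1 ∨ y = z ∨ y = s ∨ y = z * s →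
      x * s * x⁻¹ ≠ y ∨ x * z * x⁻¹ ≠ z := by
    intro s hs hsA y hy
    by_contra! hcon
    obtain ⟨hxs, hxz⟩ := hcon
    have hs1 := hsq s hs hsA
    let V : Subgroup G := Subgroup.centralizer {z} ⊓ Subgroup.centralizer {s}
    have hVdef : ∀ g, g ∈ V ↔ Commute g z ∧ Commute g s := by
      intro g
      simp only [V, Subgroup.mem_inf, Subgroup.mem_centralizer_singleton_iff]
      rfl
    have hzs : Commute z s := (hcz s hs).symm
    have hV : ∀ g, g ∈ V ↔ g = 1 ∨ g = z ∨ g = s ∨ g = z * s := by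
      intro g
      rw [hVdef]
      constructor
      · rintro ⟨h3, h4⟩
        have hAV : ∀ c ∈ A, Commute c s → c = 1 ∨ c = z := by
          intro c hc h5
          apply hA1 c hc
          have h6 := hinv c hc s hs hsA
          rw [← h5.eq, mul_inv_cancel_right] at h6
          nth_rw 1 [h6]
          exact inv_mul_cancel c
        by_cases hgA : g ∈ A
        · rcases hAV g hgA h4 with h5 | h5
          · exact Or.inl h5
          · exact Or.inr (Or.inl h5)
        · rcases hAV _ (hmulA g (hzM g h3) hgA s hs hsA) (h4.mul_left (Commute.refl s))
            with h5 | h5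
          · exact Or.inr (Or.inr (Or.inl (by
              rw [eq_inv_of_mul_eq_one_left h5, inv_eq_of_mul_eq_one_left hs1])))
          · exact Or.inr (Or.inr (Or.inr (by rw [← h5, mul_assoc, hs1, mul_one])))
      · rintro (rfl | rfl | rfl | rfl)
        · exact ⟨Commute.one_left _, Commute.one_left _⟩
        · exact ⟨Commute.refl _, hzs⟩
        · exact ⟨hzs.symm, Commute.refl _⟩
        · exact ⟨(Commute.refl _).mul_left hzs.symm, hzs.mul_left (Commute.refl _)⟩
    have hnorm : ∀ n : G, n * z * n⁻¹ ∈ V → n * s * n⁻¹ ∈ V →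
        n ∈ Subgroup.normalizer (V : Set G) := by
      intro n h3 h4
      apply Subgroup.mem_normalizer_fintype
      intro v hv
      rcases (hV v).1 hv with rfl | rfl | rfl | rfl
      · simp
      · exact h3
      · exact h4
      · have h5 := V.mul_mem h3 h4
        rwa [show n * z * n⁻¹ * (n * s * n⁻¹) = n * (z * s) * n⁻¹ by group] at h5
    have hsV : s ∈ V := (hV s).2 (by simp)
    have hzV : z ∈ V := (hV z).2 (by simp)
    have hsol' : Group.IsSolvable (Subgroup.normalizer (V : Set G)) := by
      apply Subgroup.isSolvable_normalizer V
      · rw [Set.ncard_eq_three]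
        refine ⟨z, s, z * s, ?_, ?_, ?_, ?_⟩
        · rintro rfl; exact hsA hzA
        · intro h
          apply hsA
          rw [mul_eq_left.1 h.symm]
          exact A.one_mem
        · intro h
          exact hz2 (mul_eq_right.1 h.symm)
        · ext y
          simp only [Set.mem_sdiff, SetLike.mem_coe, hV, Set.mem_singleton_iff,
            Set.mem_insert_iff]
          constructor
          · rintro ⟨h3, h4⟩
            exact h3.resolve_left h4
          · intro h3
            refine ⟨Or.inr h3, ?_⟩
            rintro rfl
            rcases h3 with h3 | h3 | h3
            · exact hz2 h3.symm
            · exact hsA (h3 ▸ A.one_mem)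
            · apply hsA
              rw [← inv_eq_of_mul_eq_one_right h3.symm]
              exact A.inv_mem hzA
      · intro g hg
        exact (hVdef g).2 ⟨hg z hzV, hg s hsV⟩
      · intro u hu v hv
        obtain ⟨h3, h4⟩ := (hVdef u).1 hu
        rcases (hV v).1 hv with rfl | rfl | rfl | rfl
        · exact Commute.one_right _
        · exact h3
        · exact h4
        · exact h3.mul_right h4
    have hle := hsol _ hsol' (hnorm x (by rw [hxz]; exact hzV) (by rw [hxs]; exact (hV y).2 hy))
    obtain ⟨g, hg⟩ := hconj s hs1 (by rintro rfl; exact hsA A.one_mem)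
    set u := g⁻¹ * z * g with hu
    have huM : u ∈ M := by
      apply hzM
      have h3 : z * (g * z * g⁻¹) = g * z * g⁻¹ * z := by rw [← hg]; exact hzs.eq
      change g⁻¹ * z * g * z = z * (g⁻¹ * z * g)
      calc g⁻¹ * z * g * z = g⁻¹ * (z * (g * z * g⁻¹)) * g := by group
        _ = _ := by rw [h3]; group
    have huA : u ∉ A := by
      intro h3
      rcases hA1 u h3 (by
        rw [hu, show g⁻¹ * z * g * (g⁻¹ * z * g) = g⁻¹ * (z * z) * g by group, hz1]; group)
        with h4 | h4
      · apply hz2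
        calc z = g * u * g⁻¹ := by rw [hu]; group
          _ = 1 := by rw [h4]; group
      · apply hsA
        rw [hg, ← h4, hu, show g * (g⁻¹ * z * g) * g⁻¹ = z by group]
        exact hzA
    set b := a ^ 2 ^ k with hb
    have hbA : b ∈ A := A.pow_mem haA _
    have hbb : b * b = z := by
      rw [hb, hz, ← pow_add]
      congr 1
      ring
    have hbu : b * u * b⁻¹ = z * u := by
      have h3 := hinv b hbA u huM huA
      calc b * u * b⁻¹ = b * (u * b * u⁻¹)⁻¹ * u := by group
        _ = z * u := by rw [h3, inv_inv, hbb]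
    have hn1 : g * b * g⁻¹ * z * (g * b * g⁻¹)⁻¹ = s * z := by
      calc g * b * g⁻¹ * z * (g * b * g⁻¹)⁻¹ = g * (b * u * b⁻¹) * g⁻¹ := by rw [hu]; group
        _ = g * (z * u) * g⁻¹ := by rw [hbu]
        _ = s * z := by rw [hu, hg]; group
    have hn2 : g * b * g⁻¹ * s * (g * b * g⁻¹)⁻¹ = s := by
      have h3 : b * z = z * b := (hAcomm b hbA z hzA).eq
      calc g * b * g⁻¹ * s * (g * b * g⁻¹)⁻¹ = g * (b * z) * b⁻¹ * g⁻¹ := by rw [hg]; group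
        _ = g * z * g⁻¹ := by rw [h3]; group
        _ = s := hg.symm
    have hnM := hle (hnorm (g * b * g⁻¹) (by rw [hn1]; exact V.mul_mem hsV hzV)
      (by rw [hn2]; exact hsV))
    have h3 := (hcz _ hnM).eq
    rw [mul_inv_eq_iff_eq_mul, h3] at hn1
    apply hsA
    have h4 : z * (g * b * g⁻¹) = s * (z * (g * b * g⁻¹)) := hn1.trans (mul_assoc _ _ _)
    rw [mul_eq_right.1 h4.symm]
    exact A.one_mem
  have hxM : x ∈ M := by
    have h3 : Group.IsSolvable (Subgroup.zpowers x) :=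
      Group.isSolvable_of_comm (by
        rintro ⟨_, i, rfl⟩ ⟨_, j, rfl⟩
        exact Subtype.ext (zpow_mul_comm x i j))
    exact hsol _ h3 (Subgroup.mem_zpowers x) (Subgroup.mem_zpowers x)
  have hxz : x * z * x⁻¹ = z := mul_inv_eq_iff_eq_mul.2 (hcz x hxM).eq
  have hxA : x ∈ A := by
    by_contra h3
    rcases hx x hxM h3 x (by simp) with h4 | h4
    · exact h4 (by group)
    · exact h4 hxz
  have hx4 : x * x * (x * x) ≠ 1 := by
    intro h3
    have h4 : x * t * x⁻¹ = x * x * t := by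
      have h5 := hinv0 x hxA
      calc x * t * x⁻¹ = x * (t * x * t⁻¹)⁻¹ * t := by group
        _ = _ := by rw [h5, inv_inv]
    rcases hx t htM ht (x * x * t) (by
      rcases hA1 _ (A.mul_mem hxA hxA) h3 with h5 | h5 <;> rw [h5] <;> simp) with h5 | h5
    · exact h5 h4
    · exact h5 hxz
  have hk : 1 ≤ k := by
    by_contra! hk
    obtain rfl : k = 0 := by omega
    apply hx4
    have h3 := orderOf_dvd_of_mem_zpowers hxA
    rw [ha, orderOf_dvd_iff_pow_eq_one] at h3
    rw [← pow_two, ← pow_two, ← pow_mul]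
    exact h3
  have hhalf : 2 ^ (k + 2) / 2 = 2 ^ (k + 1) := by
    rw [pow_succ, Nat.mul_div_cancel _ (by norm_num)]
  have D : DihedralTI a t (2 ^ (k + 2)) :=
    { order := ha
      eight_dvd := pow_dvd_pow 2 (by omega : 3 ≤ k + 2)
      pos := by positivity
      notMem := ht
      sq := ht1
      inverts := hat
      ti := by
        intro c hc hc1 g hg
        obtain ⟨n, h3, h4⟩ := h2.exists_pow_involution (s := ⟨c, hAM hc⟩)
          (fun h => hc1 (congrArg Subtype.val h))
        have h5 : c ^ n = z := (hA1 _ (A.pow_mem hc n) (congrArg Subtype.val h3)).resolve_left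
          fun h => h4 (Subtype.ext h)
        have h6 : g * z * g⁻¹ ∈ A := by
          rw [← h5, ← conj_pow]
          exact A.pow_mem hg n
        rcases hA1 _ h6 (by
          rw [show g * z * g⁻¹ * (g * z * g⁻¹) = g * (z * z) * g⁻¹ by group, hz1]; group)
          with h7 | h7
        · rw [conj_eq_one_iff] at h7
          exact absurd h7 hz2
        · exact hMat g (hzM g (mul_inv_eq_iff_eq_mul.1 h7))
      involution := by
        rw [hhalf]
        exact hconj }
  have := Fintype.ofFinite G
  refine D.exists_mulEquiv_psl rfl M ?_ hcard hindex hxA hsol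
  intro g
  refine ⟨hMat g, ?_⟩
  rintro (h3 | h3)
  · exact hAM h3
  · exact (M.mul_mem_cancel_right htM).1 (hAM h3)

end DihedralMaximal

theorem stmt_17 {G : Type*} [Group G] [Finite G] [IsSimpleGroup G]
    (hna : ¬ ∀ a b : G, a * b = b * a)
    (x : G) (Q : Subgroup G) (hQ : (Q : Set G) = solubilizer x)
    (hmax : IsCoatom Q) (hmeta : IsMetacyclic ↥Q)
    (h2 : ∃ n : ℕ, Nat.card Q = 2 ^ n) :
    ∃ p : ℕ, p.Prime ∧ (∃ n : ℕ, p = 2 ^ n - 1) ∧ 31 ≤ p ∧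
      Nonempty (G ≃* PSL(2, ZMod p)) := by
  have hsol : ∀ H : Subgroup G, Group.IsSolvable H → x ∈ H → H ≤ Q := by
    intro H hH hx y hy
    rw [← SetLike.mem_coe, hQ]
    have hle : Subgroup.closure ({x, y} : Set G) ≤ H := by
      rw [Subgroup.closure_le]
      rintro _ (rfl | rfl)
      · exact hx
      · exact hy
    exact Group.isSolvable_of_isSolvable_injective (Subgroup.inclusion_injective hle)
  obtain ⟨n, hn⟩ := h2
  have hp : IsPGroup 2 Q := IsPGroup.of_card hn
  have : Nontrivial Q := (Subgroup.nontrivial_iff_ne_bot Q).2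
    (IsSimpleGroup.ne_bot_of_isCoatom hna hmax)
  obtain ⟨C, hC, hC1, hC2⟩ := hmeta
  have hmk : ∀ {u : G} (hu : u ∈ Q), u * u = 1 → (⟨u, hu⟩ : Q) * ⟨u, hu⟩ = 1 :=
    fun _ h => Subtype.ext h
  have hmk1 : ∀ {u : G} (hu : u ∈ Q), u ≠ 1 → (⟨u, hu⟩ : Q) ≠ 1 :=
    fun _ h h' => h (congrArg Subtype.val h')
  have hmem : ∀ a g : Q, g ∈ Subgroup.zpowers a ↔ (g : G) ∈ Subgroup.zpowers (a : G) := by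
    intro a g
    constructor
    · rintro ⟨i, rfl⟩
      exact ⟨i, rfl⟩
    · rintro ⟨i, hi⟩
      exact ⟨i, Subtype.ext hi⟩
  rcases hp.metacyclic_trichotomy C with ⟨z, hz1, hz2, hu⟩ |
    ⟨z, t, hz1, hz2, ht1, ht2, htz, hc, hu⟩ | ⟨a, t, k, ha, ht, ht1, hat, hr⟩
  · exact (IsSimpleGroup.false_of_unique_involution hna hmax hp z.2 (congrArg Subtype.val hz1)
      (fun h => hz2 (Subtype.ext h))
      fun u hu1 hu2 hu3 => congrArg Subtype.val (hu ⟨u, hu1⟩ (hmk hu1 hu2) (hmk1 hu1 hu3))).elim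
  · refine (IsSimpleGroup.false_of_central_four_group hna hmax hp z.2 t.2
      (congrArg Subtype.val hz1) (fun h => hz2 (Subtype.ext h)) (congrArg Subtype.val ht1)
      (fun h => ht2 (Subtype.ext h)) (fun h => htz (Subtype.ext h))
      (fun g hg => congrArg Subtype.val (hc ⟨g, hg⟩).eq) fun u hu1 hu2 hu3 => ?_).elim
    rcases hu ⟨u, hu1⟩ (hmk hu1 hu2) (hmk1 hu1 hu3) with h | h | h
    · exact Or.inl (congrArg Subtype.val h)
    · exact Or.inr (Or.inl (congrArg Subtype.val h))
    · exact Or.inr (Or.inr (congrArg Subtype.val h))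
  · have ha' : orderOf (a : G) = 2 ^ (k + 2) := by rw [Subgroup.orderOf_coe, ha]
    have ht' : (t : G) ∉ Subgroup.zpowers (a : G) := by rwa [← hmem]
    have hat' : ∀ g ∈ Q, g ∈ Subgroup.zpowers (a : G) ∨ g * t ∈ Subgroup.zpowers (a : G) := by
      intro g hg
      have h := hat ⟨g, hg⟩
      rwa [hmem, hmem] at h
    rcases hr with hr | ⟨hk, hr⟩
    · exact IsSimpleGroup.exists_mulEquiv_psl_of_dihedral hna hmax hp a.2 t.2 ha' ht'
        (congrArg Subtype.val ht1) hat' (congrArg Subtype.val hr) hsol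
    · exact (IsSimpleGroup.false_of_semidihedral hna hmax a.2 t.2 ha' hk ht'
        (congrArg Subtype.val ht1) hat' (congrArg Subtype.val hr)).elim
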